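/- arXiv:1708.00217 — 2 statements merged into one kernel-verified Lean document; each statement's English description precedes it below -/
import Mathlib

section
/- Let a_n = Σ_{k=0}^n (binom(n,k))² · binom(n+k, n) and let f : ℂ → ℂ be the entire function f(z) = Σ_{n≥0} (a_n/n!) z^n. Then f(α) is transcendental for every nonzero algebraic number α. -/
noncomputable section

open scoped Nat

namespace AperyE

open MvPolynomial
open Polynomial (derivative)

/-! ### Derivations of polynomial rings induced by linear maps on the variables -/

section Locally

variable {R S : Type*} [CommRing R] [CommRing S] [Algebra R S]

lemma Derivation.iterate_mul_eq_zero (d : Derivation R S S) (n : ℕ) :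
    ∀ k l : ℕ, k + l = n → ∀ x y : S, (d^[k]) x = 0 → (d^[l]) y = 0 → (d^[n]) (x * y) = 0 := by
  induction n with
  | zero =>
    intro k l h x y hx hy
    obtain rfl : k = 0 := by omega
    simp only [Function.iterate_zero, id] at *
    simp [hx]
  | succ n ih =>
    intro k l h x y hx hy
    have hz : ∀ m : ℕ, (d^[m]) (0 : S) = 0 := fun m => iterate_map_zero d m
    have hadd : ∀ (m : ℕ) (a b : S), (d^[m]) (a + b) = (d^[m]) a + (d^[m]) b :=
      fun m a b => iterate_map_add d m a b
    rw [Function.iterate_succ_apply, d.leibniz, hadd]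
    simp only [smul_eq_mul]
    have h1 : (d^[n]) (x * d y) = 0 := by
      cases l with
      | zero =>
        simp only [Function.iterate_zero, id] at hy
        simp [hy, hz]
      | succ l =>
        exact ih k l (by omega) x (d y) hx (by rwa [Function.iterate_succ_apply] at hy)
    have h2 : (d^[n]) (y * d x) = 0 := by
      cases k with
      | zero =>
        simp only [Function.iterate_zero, id] at hx
        simp [hx, hz]
      | succ k =>
        exact ih l k (by omega) y (d x) hy (by rwa [Function.iterate_succ_apply] at hx)
    rw [h1, h2, add_zero]

/-- A derivation of a polynomial ring that is locally nilpotent on the variables is locally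
nilpotent. -/
lemma exists_iterate_eq_zero {σ : Type*} (d : Derivation R (MvPolynomial σ R) (MvPolynomial σ R))
    (h : ∀ s, ∃ k, (d^[k]) (X s) = 0) (p : MvPolynomial σ R) : ∃ k, (d^[k]) p = 0 := by
  have hz : ∀ m : ℕ, (d^[m]) (0 : MvPolynomial σ R) = 0 := fun m => iterate_map_zero d m
  induction p using MvPolynomial.induction_on with
  | C a => exact ⟨1, by simp⟩
  | add p q hp hq =>
    obtain ⟨k, hk⟩ := hp
    obtain ⟨l, hl⟩ := hq
    refine ⟨k + l, ?_⟩
    have hadd : ∀ (m : ℕ) (a b : MvPolynomial σ R), (d^[m]) (a + b) = (d^[m]) a + (d^[m]) b :=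
      fun m a b => iterate_map_add d m a b
    rw [hadd, add_comm k l, Function.iterate_add_apply, hk, hz, add_comm l k,
      Function.iterate_add_apply, hl, hz, add_zero]
  | mul_X p s hp =>
    obtain ⟨k, hk⟩ := hp
    obtain ⟨l, hl⟩ := h s
    exact ⟨k + l, Derivation.iterate_mul_eq_zero d _ k l rfl _ _ hk hl⟩

end Locally

section Eigen

variable {K : Type*} [Field K] {σ : Type*}
  (d : Derivation K (MvPolynomial σ K) (MvPolynomial σ K))

/-- If the linear forms are sums of eigenvectors of a derivation, so are all polynomials. -/
lemma mem_iSup_eigenspace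
    (h : ∀ s, (X s : MvPolynomial σ K) ∈ ⨆ μ, Module.End.eigenspace d.toLinearMap μ)
    (p : MvPolynomial σ K) : p ∈ ⨆ μ, Module.End.eigenspace d.toLinearMap μ := by
  induction p using MvPolynomial.induction_on with
  | C a =>
    refine Submodule.mem_iSup_of_mem 0 ?_
    rw [Module.End.mem_eigenspace_iff]
    simp
  | add p q hp hq => exact add_mem hp hq
  | mul_X p s hp =>
    have key : ∀ q ∈ ⨆ μ, Module.End.eigenspace d.toLinearMap μ,
        ∀ r ∈ ⨆ μ, Module.End.eigenspace d.toLinearMap μ,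
        q * r ∈ ⨆ μ, Module.End.eigenspace d.toLinearMap μ := by
      intro q hq r hr
      induction hq using Submodule.iSup_induction' with
      | zero => simp
      | add x y _ _ hx hy => rw [add_mul]; exact add_mem hx hy
      | mem μ x hx =>
        induction hr using Submodule.iSup_induction' with
        | zero => simp
        | add y z _ _ hy hz => rw [mul_add]; exact add_mem hy hz
        | mem ν y hy =>
          refine Submodule.mem_iSup_of_mem (μ + ν) ?_
          rw [Module.End.mem_eigenspace_iff] at hx hy ⊢
          replace hx : d x = μ • x := hx
          replace hy : d y = ν • y := hy
          change d (x * y) = _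
          rw [d.leibniz, hx, hy, smul_eq_mul, smul_eq_mul, mul_smul_comm, mul_smul_comm,
            mul_comm y x, ← add_smul, add_comm]
    exact key p hp _ (h s)

lemma sub_smul_mem_iSup_eigenspace
    (h : ∀ s, (X s : MvPolynomial σ K) ∈ ⨆ μ, Module.End.eigenspace d.toLinearMap μ)
    (p : MvPolynomial σ K) (μ : K) :
    d p - μ • p ∈ ⨆ ν, ⨆ (_ : ν ≠ μ), Module.End.eigenspace d.toLinearMap ν := by
  have hp := mem_iSup_eigenspace d h p
  induction hp using Submodule.iSup_induction' with
  | zero => simp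
  | add x y _ _ hx hy =>
    have : d (x + y) - μ • (x + y) = (d x - μ • x) + (d y - μ • y) := by
      rw [map_add, smul_add]; abel
    rw [this]; exact add_mem hx hy
  | mem ν x hx =>
    have hx' : d x = ν • x := by
      rw [Module.End.mem_eigenspace_iff] at hx
      simpa using hx
    by_cases hν : ν = μ
    · rw [hx', hν, sub_self]; exact zero_mem _
    · refine Submodule.mem_iSup_of_mem ν (Submodule.mem_iSup_of_mem hν ?_)
      rw [hx', ← sub_smul]
      exact Submodule.smul_mem _ _ hx

/-- An eigenvector of a diagonalisable derivation which lies in the image of `d - μ` modulo other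
eigenspaces vanishes. -/
lemma eq_zero_of_eigenvector
    (h : ∀ s, (X s : MvPolynomial σ K) ∈ ⨆ μ, Module.End.eigenspace d.toLinearMap μ)
    {p q r : MvPolynomial σ K} {μ : K} (hp : d p = μ • p)
    (hr : r ∈ ⨆ ν, ⨆ (_ : ν ≠ μ), Module.End.eigenspace d.toLinearMap ν)
    (hpq : p = d q - μ • q + r) : p = 0 := by
  have hind := Module.End.eigenspaces_iSupIndep d.toLinearMap
  have h1 : p ∈ Module.End.eigenspace d.toLinearMap μ := by
    rw [Module.End.mem_eigenspace_iff]; simpa using hp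
  have h2 : p ∈ ⨆ ν, ⨆ (_ : ν ≠ μ), Module.End.eigenspace d.toLinearMap ν := by
    rw [hpq]; exact add_mem (sub_smul_mem_iSup_eigenspace d h q μ) hr
  exact (Submodule.disjoint_def.mp (hind μ)) p h1 h2

end Eigen

section LinDer

variable (R : Type*) [CommRing R] (J : Type*)

/-- The derivation of the polynomial ring in several copies of three variables which acts on the
variables of each copy through the matrix `M`. -/
def linDer (M : Matrix (Fin 3) (Fin 3) R) :
    Derivation R (MvPolynomial (J × Fin 3) R) (MvPolynomial (J × Fin 3) R) :=
  mkDerivation R fun s => ∑ k, C (M s.2 k) * X (s.1, k)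

variable {R J}

@[simp] lemma linDer_X (M : Matrix (Fin 3) (Fin 3) R) (s : J × Fin 3) :
    linDer R J M (X s) = ∑ k, C (M s.2 k) * X (s.1, k) := by
  simp [linDer]

lemma linDer_linDer_sub (M N L : Matrix (Fin 3) (Fin 3) R) (h : N * M - M * N = L)
    (p : MvPolynomial (J × Fin 3) R) :
    linDer R J M (linDer R J N p) - linDer R J N (linDer R J M p) = linDer R J L p := by
  have : ⁅linDer R J M, linDer R J N⁆ = linDer R J L := by
    refine MvPolynomial.derivation_ext fun s => ?_
    rw [Derivation.commutator_apply]
    subst h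
    simp only [linDer_X, Derivation.leibniz, derivation_C, smul_eq_mul, Matrix.sub_apply,
      Matrix.mul_apply, Fin.sum_univ_three, map_sub, map_add,
      map_mul]
    ring
  rw [← Derivation.commutator_apply, this]

lemma linDer_add (M N : Matrix (Fin 3) (Fin 3) R) (p : MvPolynomial (J × Fin 3) R) :
    linDer R J (M + N) p = linDer R J M p + linDer R J N p := by
  have : linDer R J (M + N) = linDer R J M + linDer R J N := by
    refine MvPolynomial.derivation_ext fun s => ?_
    simp only [linDer_X, Derivation.add_apply, Matrix.add_apply, map_add, Fin.sum_univ_three]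
    ring
  rw [this]; rfl

lemma linDer_smul (c : R) (M : Matrix (Fin 3) (Fin 3) R) (p : MvPolynomial (J × Fin 3) R) :
    linDer R J (c • M) p = c • linDer R J M p := by
  have : linDer R J (c • M) = c • linDer R J M := by
    refine MvPolynomial.derivation_ext fun s => ?_
    simp only [linDer_X, Derivation.smul_apply, Matrix.smul_apply, smul_eq_C_mul, smul_eq_mul,
      map_mul, Fin.sum_univ_three]
    ring
  rw [this]; rfl

end LinDer

/-! ### The matrices of the differential system and semi-invariant polynomials -/

section Semi

/-- The residue at infinity of the system `z Y' = (z A + B) Y`. -/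
def matA (R : Type*) [CommRing R] : Matrix (Fin 3) (Fin 3) R := !![3, 1, 0; 20, 5, 1; 75, 20, 3]

/-- The residue at zero of the system `z Y' = (z A + B) Y`. -/
def matB (R : Type*) [CommRing R] : Matrix (Fin 3) (Fin 3) R := !![1, 0, 0; 0, 0, 0; 0, 0, -1]

/-- The elementary matrix with a single entry at `(1, 0)`. -/
def matU : Matrix (Fin 3) (Fin 3) ℂ := !![0, 0, 0; 1, 0, 0; 0, 0, 0]

/-- The elementary matrix with a single entry at `(2, 0)`. -/
def matV : Matrix (Fin 3) (Fin 3) ℂ := !![0, 0, 0; 0, 0, 0; 1, 0, 0]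

/-- The lowering matrix of the `sl₂`-triple attached to the system. -/
def matF : Matrix (Fin 3) (Fin 3) ℂ := !![0, 1, 0; 0, 0, 1; 0, 0, 0]

/-- The raising matrix of the `sl₂`-triple attached to the system. -/
def matE : Matrix (Fin 3) (Fin 3) ℂ := !![0, 0, 0; 2, 0, 0; 0, 2, 0]

/-- The diagonal part of `matA`. -/
def matD : Matrix (Fin 3) (Fin 3) ℂ := !![3, 0, 0; 0, 5, 0; 0, 0, 3]

/-- A matrix whose commutator with `matA` is `matB`. -/
def matX : Matrix (Fin 3) (Fin 3) ℂ := !![0, -16/25, 23/125; 0, 12/5, -16/25; 0, 0, 0]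

variable {J : Type*}

lemma X_mem_iSup_eigenspace_matB (s : J × Fin 3) : (X s : MvPolynomial (J × Fin 3) ℂ) ∈
    ⨆ μ, Module.End.eigenspace (linDer ℂ J (matB ℂ)).toLinearMap μ := by
  obtain ⟨j, i⟩ := s
  refine Submodule.mem_iSup_of_mem (matB ℂ i i) ?_
  rw [Module.End.mem_eigenspace_iff]
  change linDer ℂ J (matB ℂ) (X (j, i)) = _
  fin_cases i <;> simp [Fin.sum_univ_three, matB]

lemma X_mem_iSup_eigenspace_matA (s : J × Fin 3) : (X s : MvPolynomial (J × Fin 3) ℂ) ∈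
    ⨆ μ, Module.End.eigenspace (linDer ℂ J (matA ℂ)).toLinearMap μ := by
  obtain ⟨j, i⟩ := s
  obtain ⟨t, ht⟩ : ∃ t : ℂ, t ^ 2 = 5 := IsAlgClosed.exists_pow_nat_eq 5 (by norm_num)
  set w : ℂ → MvPolynomial (J × Fin 3) ℂ := fun l =>
    C (l ^ 2 - 8 * l - 5) * X (j, 0) + C (l - 3) * X (j, 1) + X (j, 2) with hw
  have hmem : ∀ l : ℂ, l ^ 3 - 11 * l ^ 2 - l = 0 →
      w l ∈ ⨆ μ, Module.End.eigenspace (linDer ℂ J (matA ℂ)).toLinearMap μ := by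
    intro l hl
    refine Submodule.mem_iSup_of_mem l ?_
    rw [Module.End.mem_eigenspace_iff]
    change linDer ℂ J (matA ℂ) (w l) = _
    have hl' : (C (l ^ 3 - 11 * l ^ 2 - l) : MvPolynomial (J × Fin 3) ℂ) = 0 := by
      rw [hl, map_zero]
    have hd : linDer ℂ J (matA ℂ) (w l) =
        C (l ^ 2 - 8 * l - 5) * (C 3 * X (j, 0) + X (j, 1)) +
        C (l - 3) * (C 20 * X (j, 0) + C 5 * X (j, 1) + X (j, 2)) +
        (C 75 * X (j, 0) + C 20 * X (j, 1) + C 3 * X (j, 2)) := by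
      simp only [hw, map_add, Derivation.leibniz, linDer_X, derivation_C, Fin.sum_univ_three]
      simp [matA]
    rw [hd, smul_eq_C_mul]
    simp only [hw]
    have c8 : (C 8 : MvPolynomial (J × Fin 3) ℂ) = 8 := rfl
    have c5 : (C 5 : MvPolynomial (J × Fin 3) ℂ) = 5 := rfl
    have c3 : (C 3 : MvPolynomial (J × Fin 3) ℂ) = 3 := rfl
    have c20 : (C 20 : MvPolynomial (J × Fin 3) ℂ) = 20 := rfl
    have c75 : (C 75 : MvPolynomial (J × Fin 3) ℂ) = 75 := rfl
    have c11 : (C 11 : MvPolynomial (J × Fin 3) ℂ) = 11 := rfl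
    simp only [map_sub, map_mul, map_pow, c8, c5, c3, c20, c75, c11] at hl' ⊢
    linear_combination (-X (j, 0)) * hl'
  have h0 := hmem 0 (by ring)
  have h1 := hmem ((11 + 5 * t) / 2) (by linear_combination (11 + 5 * t) / 2 * (25 / 4) * ht)
  have h2 := hmem ((11 - 5 * t) / 2) (by linear_combination (11 - 5 * t) / 2 * (25 / 4) * ht)
  generalize hW : (⨆ μ, Module.End.eigenspace (linDer ℂ J (matA ℂ)).toLinearMap μ) = W at *
  have hu : C 3 * X (j, 0) + X (j, 1) ∈ W := by
    have := W.smul_mem (t / 25) (sub_mem h1 h2)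
    convert this using 1
    simp only [hw, ← smul_eq_C_mul]
    match_scalars
    · linear_combination (-(3 / 5)) * ht
    · linear_combination (-(1 / 5)) * ht
    · ring
  have hx0 : X (j, 0) ∈ W := by
    have := sub_mem (W.smul_mem (1 / 2) (sub_mem (add_mem h1 h2) (W.smul_mem 2 h0)))
      (W.smul_mem (11 / 2) hu)
    convert this using 1
    simp only [hw, ← smul_eq_C_mul]
    match_scalars
    · linear_combination (-(25 / 4)) * ht
    · ring
    · ring
  have hx1 : X (j, 1) ∈ W := by
    have := sub_mem hu (W.smul_mem 3 hx0)
    rwa [smul_eq_C_mul, add_sub_cancel_left] at this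
  have hx2 : X (j, 2) ∈ W := by
    have := add_mem (add_mem h0 (W.smul_mem 5 hx0)) (W.smul_mem 3 hx1)
    convert this using 1
    simp only [hw, ← smul_eq_C_mul]
    match_scalars <;> ring
  fin_cases i
  · exact hx0
  · exact hx1
  · exact hx2

/-- The polynomial sequences occurring as coefficients in `z` of a solution of
`(z d/dz + z A + B) Q = (ρ₀ + ρ₁ z) Q` with `Q(0) ≠ 0` are constant, and killed by the raising
operators. -/
theorem semiinvariant (q : ℕ → MvPolynomial (J × Fin 3) ℂ) (m : ℕ) (hm : q m ≠ 0)
    (hgt : ∀ i, m < i → q i = 0) (h0 : q 0 ≠ 0) (ρ₀ ρ₁ : ℂ)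
    (hz : linDer ℂ J (matB ℂ) (q 0) = ρ₀ • q 0)
    (hs : ∀ i, ((i + 1 : ℕ) : ℂ) • q (i + 1) + linDer ℂ J (matA ℂ) (q i) +
      linDer ℂ J (matB ℂ) (q (i + 1)) = ρ₀ • q (i + 1) + ρ₁ • q i) :
    m = 0 ∧ linDer ℂ J matU (q 0) = 0 ∧ linDer ℂ J matV (q 0) = 0 := by
  have htop : linDer ℂ J (matA ℂ) (q m) = ρ₁ • q m := by
    have := hs m
    simpa [hgt (m + 1) (by omega)] using this
  have hρ : ρ₀ = m := by
    obtain ⟨pr, hpr⟩ : ∃ pr, (m : ℂ) • q m + linDer ℂ J (matA ℂ) pr +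
        linDer ℂ J (matB ℂ) (q m) = ρ₀ • q m + ρ₁ • pr := by
      cases m with
      | zero => exact ⟨0, by simpa using hz⟩
      | succ m => exact ⟨q m, hs m⟩
    have hX := linDer_linDer_sub (J := J) (matA ℂ) matX (matB ℂ) (by
      ext i j; fin_cases i <;> fin_cases j <;>
        simp [matA, matX, matB] <;> norm_num) (q m)
    have := eq_zero_of_eigenvector (linDer ℂ J (matA ℂ)) X_mem_iSup_eigenspace_matA
      (p := (ρ₀ - m) • q m) (q := pr + linDer ℂ J matX (q m)) (r := 0) (μ := ρ₁)
      (by rw [Derivation.map_smul, htop, smul_comm]) (zero_mem _) (by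
        rw [map_add, smul_add, add_zero]
        rw [htop, Derivation.map_smul] at hX
        rw [← hX] at hpr
        linear_combination (norm := module) (-1 : ℂ) • hpr)
    rcases smul_eq_zero.mp this with h | h
    · exact sub_eq_zero.mp h
    · exact absurd h hm
  subst hρ
  have hsplit : ∀ p, linDer ℂ J (matA ℂ) p = linDer ℂ J matF p + linDer ℂ J matD p +
      (10 : ℂ) • linDer ℂ J matE p + (75 : ℂ) • linDer ℂ J matV p := by
    intro p
    rw [← linDer_smul, ← linDer_smul, ← linDer_add, ← linDer_add, ← linDer_add]
    congr 2
    ext i j; fin_cases i <;> fin_cases j <;>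
        simp [matA, matF, matD, matE, matV] <;> norm_num
  have hwt : ∀ (M : Matrix (Fin 3) (Fin 3) ℂ) (c μ : ℂ) (p : MvPolynomial (J × Fin 3) ℂ),
      M * matB ℂ - matB ℂ * M = c • M → linDer ℂ J (matB ℂ) p = μ • p →
      linDer ℂ J (matB ℂ) (linDer ℂ J M p) = (μ + c) • linDer ℂ J M p := by
    intro M c μ p hM hp
    have := linDer_linDer_sub (J := J) (matB ℂ) M (c • M) hM p
    rw [hp, Derivation.map_smul, linDer_smul] at this
    rw [add_smul, ← this]; abel
  have hF := hwt matF (-1) m (q 0) (by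
    ext i j; fin_cases i <;> fin_cases j <;>
      simp [matF, matB]) hz
  have hD := hwt matD 0 m (q 0) (by
    ext i j; fin_cases i <;> fin_cases j <;>
      simp [matD, matB]) hz
  have hE' : matE * matB ℂ - matB ℂ * matE = (1 : ℂ) • matE := by
    ext i j; fin_cases i <;> fin_cases j <;>
      simp [matE, matB]
  have hE := hwt matE 1 m (q 0) hE' hz
  have hV := hwt matV 2 m (q 0) (by
    ext i j; fin_cases i <;> fin_cases j <;>
      simp [matV, matB]; norm_num) hz
  have heig : ∀ (μ c : ℂ) (p : MvPolynomial (J × Fin 3) ℂ), linDer ℂ J (matB ℂ) p = c • p →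
      c ≠ μ →
      p ∈ ⨆ ν, ⨆ (_ : ν ≠ μ), Module.End.eigenspace (linDer ℂ J (matB ℂ)).toLinearMap ν := by
    intro μ c p hp hc
    refine Submodule.mem_iSup_of_mem c (Submodule.mem_iSup_of_mem hc ?_)
    rw [Module.End.mem_eigenspace_iff]
    exact hp
  have hF0 : linDer ℂ J matF (q 0) = 0 := by
    refine eq_zero_of_eigenvector (linDer ℂ J (matB ℂ)) X_mem_iSup_eigenspace_matB
      (q := - q 1) (μ := (m : ℂ) + -1)
      (r := ρ₁ • q 0 - linDer ℂ J matD (q 0) - (10 : ℂ) • linDer ℂ J matE (q 0)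
        - (75 : ℂ) • linDer ℂ J matV (q 0)) hF ?_ ?_
    · refine sub_mem (sub_mem (sub_mem (Submodule.smul_mem _ _ (heig _ _ _ hz ?_))
        (heig _ _ _ hD ?_)) (Submodule.smul_mem _ _ (heig _ _ _ hE ?_)))
        (Submodule.smul_mem _ _ (heig _ _ _ hV ?_)) <;>
      · intro h
        have h' := sub_eq_zero.mpr h
        ring_nf at h'
        norm_num at h'
    · have h1 := hs 0
      rw [hsplit (q 0)] at h1
      rw [map_neg]
      simp only [zero_add, Nat.cast_one, one_smul] at h1
      linear_combination (norm := module) h1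
  have hB : ∀ k : ℕ, linDer ℂ J (matB ℂ) ((linDer ℂ J matE)^[k] (q 0)) =
      ((m : ℂ) + k) • (linDer ℂ J matE)^[k] (q 0) := by
    intro k
    induction k with
    | zero => simpa using hz
    | succ k ih =>
      rw [Function.iterate_succ_apply', hwt matE 1 _ _ hE' ih]
      push_cast; ring_nf
  have hFE : ∀ k : ℕ, linDer ℂ J matF ((linDer ℂ J matE)^[k + 1] (q 0)) =
      (-((k + 1 : ℂ) * (2 * m + k))) • (linDer ℂ J matE)^[k] (q 0) := by
    have hc := fun p => linDer_linDer_sub (J := J) matE matF ((2 : ℂ) • matB ℂ) (by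
      ext i j; fin_cases i <;> fin_cases j <;>
        simp [matF, matE, matB]) p
    intro k
    induction k with
    | zero =>
      have := hc (q 0)
      rw [hF0, map_zero, linDer_smul, hz] at this
      simp only [Function.iterate_succ_apply', Function.iterate_zero, id]
      linear_combination (norm := module) (-1 : ℂ) • this
    | succ k ih =>
      have := hc ((linDer ℂ J matE)^[k + 1] (q 0))
      rw [ih, linDer_smul, hB, Derivation.map_smul,
        ← Function.iterate_succ_apply' (f := linDer ℂ J matE) (n := k)] at this
      rw [Function.iterate_succ_apply' (f := linDer ℂ J matE) (n := k + 1)]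
      simp only [Nat.succ_eq_add_one, smul_smul] at this ⊢
      push_cast at this ⊢
      linear_combination (norm := module) (-1 : ℂ) • this
  have hmE : m = 0 ∧ linDer ℂ J matE (q 0) = 0 := by
    have hnil : ∃ k, ((linDer ℂ J matE)^[k]) (q 0) = 0 := by
      refine exists_iterate_eq_zero _ (fun s => ⟨3, ?_⟩) _
      obtain ⟨j, i⟩ := s
      fin_cases i <;> simp [Fin.sum_univ_three, matE]
    classical
    obtain ⟨k, hk⟩ : ∃ k, Nat.find hnil = k + 1 :=
      Nat.exists_eq_succ_of_ne_zero fun h => h0 (by simpa [h] using Nat.find_spec hnil)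
    have h1 := Nat.find_spec hnil
    have h2 := Nat.find_min hnil (m := k) (by omega)
    have h3 := hFE k
    rw [hk] at h1
    rw [h1, map_zero] at h3
    rcases smul_eq_zero.mp h3.symm with h4 | h4
    · have h5 : (k + 1) * (2 * m + k) = 0 := by
        have := neg_eq_zero.mp h4
        exact_mod_cast this
      have hk0 : k = 0 := by rcases Nat.mul_eq_zero.mp h5 with h | h <;> omega
      have hm0 : m = 0 := by rcases Nat.mul_eq_zero.mp h5 with h | h <;> omega
      subst hk0
      exact ⟨hm0, by simpa using h1⟩
    · exact absurd h4 h2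
  obtain ⟨rfl, hE0⟩ := hmE
  rw [hsplit, hF0, hE0] at htop
  have hV0 : linDer ℂ J matV (q 0) = 0 := by
    refine eq_zero_of_eigenvector (linDer ℂ J (matB ℂ)) X_mem_iSup_eigenspace_matB
      (q := 0) (μ := ((0 : ℕ) : ℂ) + 2)
      (r := (1 / 75 : ℂ) • (ρ₁ • q 0 - linDer ℂ J matD (q 0))) hV ?_ ?_
    · refine Submodule.smul_mem _ _ (sub_mem (Submodule.smul_mem _ _ (heig _ _ _ hz ?_))
        (heig _ _ _ hD ?_)) <;> norm_num
    · rw [← htop, map_zero]; module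
  refine ⟨rfl, ?_, hV0⟩
  rw [hV0] at htop
  have hDD : linDer ℂ J matD (q 0) = ρ₁ • q 0 := by simpa using htop
  have hN := linDer_linDer_sub (J := J) matD matE ((2 : ℂ) • matE + (-8 : ℂ) • matU) (by
      ext i j; fin_cases i <;> fin_cases j <;>
        simp [matD, matE, matU] <;> norm_num) (q 0)
  rw [hE0, hDD, Derivation.map_smul, hE0, linDer_add, linDer_smul, hE0,
    linDer_smul] at hN
  simpa using hN.symm

end Semi

/-! ### The derivation attached to the differential system -/

section SysDer

variable (R : Type*) [CommRing R] (J : Type*)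

/-- Polynomials in several copies of three variables with coefficients in `R[z]`. -/
abbrev Pol := MvPolynomial (J × Fin 3) (Polynomial R)

/-- The ring homomorphism to dual numbers `p ↦ p + ε D p` defining the derivation `sysDer`. -/
def sysLift : Pol R J →+* TrivSqZeroExt (Pol R J) (Pol R J) :=
  eval₂Hom (Polynomial.eval₂RingHom
      ((TrivSqZeroExt.inlHom _ _).comp ((C : Polynomial R →+* Pol R J).comp Polynomial.C))
      (TrivSqZeroExt.inl (C Polynomial.X) + TrivSqZeroExt.inr (C Polynomial.X)))
    fun s => TrivSqZeroExt.inl (X s) + TrivSqZeroExt.inr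
      (∑ k, C (Polynomial.X * Polynomial.C (matA R s.2 k) + Polynomial.C (matB R s.2 k)) *
        X (s.1, k))

variable {R J}

lemma fst_sysLift (p : Pol R J) : (sysLift R J p).fst = p := by
  have : (TrivSqZeroExt.fstHom ℤ (Pol R J) (Pol R J)).toRingHom.comp (sysLift R J) =
      RingHom.id _ := by
    refine MvPolynomial.ringHom_ext' (Polynomial.ringHom_ext (fun a => ?_) ?_) fun s => ?_ <;>
    simp [sysLift]
  exact congrArg (fun g : Pol R J →+* Pol R J => g p) this

variable (R J) in
/-- The derivation `z d/dz` along the differential system `z Y' = (z A + B) Y`. -/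
def sysDer : Derivation ℤ (Pol R J) (Pol R J) :=
  Derivation.mk' (AddMonoidHom.toIntLinearMap
      { toFun := fun p => (sysLift R J p).snd
        map_zero' := by simp
        map_add' := by simp }) fun p q => by
    change (sysLift R J (p * q)).snd = _
    simp only [map_mul, TrivSqZeroExt.snd_mul, fst_sysLift]
    simp [mul_comm]

lemma sysDer_apply (p : Pol R J) : sysDer R J p = (sysLift R J p).snd := rfl

@[simp] lemma sysDer_X (s : J × Fin 3) : sysDer R J (X s) =
    ∑ k, C (Polynomial.X * Polynomial.C (matA R s.2 k) + Polynomial.C (matB R s.2 k)) *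
        X (s.1, k) := by
  simp [sysDer_apply, sysLift]

@[simp] lemma sysDer_C_C (r : R) : sysDer R J (C (Polynomial.C r)) = 0 := by
  simp [sysDer_apply, sysLift]

@[simp] lemma sysDer_C_X : sysDer R J (C Polynomial.X) = C Polynomial.X := by
  simp [sysDer_apply, sysLift]

/-- A ring homomorphism intertwines `sysDer` with a derivation as soon as it does so on
generators. -/
lemma derivation_comp_eq {S : Type*} [CommRing S] [Algebra ℤ S]
    (f : Pol R J →+* S) (δ : Derivation ℤ S S)
    (hC : ∀ r, δ (f (C (Polynomial.C r))) = 0) (hz : δ (f (C Polynomial.X)) = f (C Polynomial.X))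
    (hX : ∀ s, δ (f (X s)) = f (sysDer R J (X s))) (p : Pol R J) :
    δ (f p) = f (sysDer R J p) := by
  induction p using MvPolynomial.induction_on with
  | C c =>
    induction c using Polynomial.induction_on with
    | C a => simp [hC]
    | add p q hp hq => simp only [map_add, hp, hq]
    | monomial n a h =>
      rw [pow_succ, ← mul_assoc, map_mul C, map_mul f, δ.leibniz, (sysDer R J).leibniz, h, hz]
      simp
  | add p q hp hq => simp only [map_add, hp, hq]
  | mul_X p s hp =>
    rw [map_mul f, δ.leibniz, (sysDer R J).leibniz, hp, hX]
    simp only [smul_eq_mul, map_mul, map_add]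

lemma sysDer_C (c : Polynomial R) :
    sysDer R J (C c) = C (Polynomial.X * derivative c) := by
  induction c using Polynomial.induction_on with
  | C a => simp
  | add p q hp hq => simp only [map_add, hp, hq, mul_add]
  | monomial n a h =>
    rw [pow_succ, ← mul_assoc, map_mul C, (sysDer R J).leibniz, h, sysDer_C_X]
    simp only [smul_eq_mul, Polynomial.derivative_mul, Polynomial.derivative_X, ← map_mul,
      ← map_add]
    congr 1
    ring

lemma map_sysDer {S : Type*} [CommRing S] (g : R →+* S) (p : Pol R J) :
    map (Polynomial.mapRingHom g) (sysDer R J p) =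
      sysDer S J (map (Polynomial.mapRingHom g) p) := by
  have hn : ∀ (n : ℕ) [n.AtLeastTwo], g ofNat(n) = ofNat(n) := fun n _ => map_ofNat g n
  have hA : ∀ i j, g (matA R i j) = matA S i j := by
    intro i j; fin_cases i <;> fin_cases j <;> simp [matA, hn]
  have hB : ∀ i j, g (matB R i j) = matB S i j := by
    intro i j; fin_cases i <;> fin_cases j <;> simp [matB]
  refine (derivation_comp_eq (map (Polynomial.mapRingHom g)) (sysDer S J) ?_ ?_ ?_ p).symm
  · simp
  · simp
  · intro s; simp [hA, hB, Polynomial.coe_mapRingHom]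

lemma rename_sysDer {J' : Type*} (j : J → J') (p : Pol R J) :
    rename (Prod.map j id) (sysDer R J p) = sysDer R J' (rename (Prod.map j id) p) := by
  refine (derivation_comp_eq (rename (Prod.map j id) :
    Pol R J →ₐ[Polynomial R] Pol R J').toRingHom (sysDer R J') ?_ ?_ ?_ p).symm
  · simp
  · simp
  · intro s; simp

variable (R J) in
/-- Regarding a polynomial with coefficients in `R[z]` as a polynomial in `z`. -/
def toPoly : Pol R J →+* Polynomial (MvPolynomial (J × Fin 3) R) :=
  eval₂Hom (Polynomial.mapRingHom C) fun s => Polynomial.C (X s)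

lemma toPoly_injective : Function.Injective (toPoly R J) := by
  have : (Polynomial.eval₂RingHom (map Polynomial.C) (C Polynomial.X)).comp (toPoly R J) =
      RingHom.id _ := by
    refine MvPolynomial.ringHom_ext' (Polynomial.ringHom_ext (fun a => ?_) ?_) fun s => ?_ <;>
    simp [toPoly]
  exact Function.LeftInverse.injective
    (g := Polynomial.eval₂RingHom (map Polynomial.C) (C Polynomial.X))
    fun p => congrArg (fun g : Pol R J →+* Pol R J => g p) this

lemma eval_toPoly (ζ : R) (p : Pol R J) :
    (toPoly R J p).eval (C ζ) = map (Polynomial.evalRingHom ζ) p := by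
  have : (Polynomial.evalRingHom (C ζ)).comp (toPoly R J) = map (Polynomial.evalRingHom ζ) := by
    refine MvPolynomial.ringHom_ext' (Polynomial.ringHom_ext (fun a => ?_) ?_) fun s => ?_ <;>
    simp [toPoly]
  exact congrArg (fun g : Pol R J →+* MvPolynomial (J × Fin 3) R => g p) this

lemma toPoly_map_C (p : MvPolynomial (J × Fin 3) R) :
    toPoly R J (map Polynomial.C p) = Polynomial.C p := by
  have : (toPoly R J).comp (map Polynomial.C) = Polynomial.C := by
    refine MvPolynomial.ringHom_ext (fun a => ?_) fun s => ?_ <;>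
    simp [toPoly]
  exact congrArg (fun g : MvPolynomial (J × Fin 3) R →+* Polynomial (MvPolynomial (J × Fin 3) R) =>
    g p) this

lemma toPoly_sysDer_X (s : J × Fin 3) : toPoly R J (sysDer R J (X s)) =
    Polynomial.X * Polynomial.C (linDer R J (matA R) (X s)) +
      Polynomial.C (linDer R J (matB R) (X s)) := by
  simp only [sysDer_X, linDer_X, map_mul, map_add, Fin.sum_univ_three]
  simp [toPoly]
  ring

lemma coeff_toPoly_sysDer_aux (p : Pol R J) (i : ℕ) :
    ((toPoly R J (sysDer R J p)).coeff 0 = linDer R J (matB R) ((toPoly R J p).coeff 0)) ∧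
    (toPoly R J (sysDer R J p)).coeff (i + 1) =
      ((i + 1 : ℕ) : R) • (toPoly R J p).coeff (i + 1) +
      linDer R J (matA R) ((toPoly R J p).coeff i) +
      linDer R J (matB R) ((toPoly R J p).coeff (i + 1)) := by
  induction p using MvPolynomial.induction_on with
  | C c =>
    rw [sysDer_C]
    simp [toPoly, Polynomial.coeff_X_mul, Polynomial.coeff_derivative, smul_eq_C_mul, mul_comm]
  | add p q hp hq =>
    refine ⟨?_, ?_⟩
    · simp only [map_add, Polynomial.coeff_add, hp.1, hq.1]
    · simp only [map_add, Polynomial.coeff_add, hp.2, hq.2, smul_add]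
      abel
  | mul_X p s hp =>
    have hX : toPoly R J (X s) = Polynomial.C (X s) := by simp [toPoly]
    rw [(sysDer R J).leibniz]
    simp only [smul_eq_mul, map_mul, map_add, toPoly_sysDer_X, hX]
    refine ⟨?_, ?_⟩
    · simp only [Polynomial.coeff_add, hp.1,
        Derivation.leibniz, smul_eq_mul, Polynomial.mul_coeff_zero, Polynomial.coeff_X_zero,
        Polynomial.coeff_C_zero]
      ring
    · simp only [mul_add, Polynomial.coeff_add, Polynomial.coeff_C_mul, hp.2,
        Polynomial.coeff_mul_C, Derivation.leibniz, smul_eq_mul, smul_eq_C_mul,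
        ← mul_assoc, Polynomial.coeff_mul_X]
      ring

lemma coeff_zero_toPoly_sysDer (p : Pol R J) :
    (toPoly R J (sysDer R J p)).coeff 0 = linDer R J (matB R) ((toPoly R J p).coeff 0) :=
  (coeff_toPoly_sysDer_aux p 0).1

lemma coeff_succ_toPoly_sysDer (p : Pol R J) (i : ℕ) :
    (toPoly R J (sysDer R J p)).coeff (i + 1) =
      ((i + 1 : ℕ) : R) • (toPoly R J p).coeff (i + 1) +
      linDer R J (matA R) ((toPoly R J p).coeff i) +
      linDer R J (matB R) ((toPoly R J p).coeff (i + 1)) :=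
  (coeff_toPoly_sysDer_aux p i).2

end SysDer

/-! ### Eigenvectors of the derivation -/

section Factor

variable {J : Type*}

lemma exists_eq_C_mul_of_map_eval_eq_zero {Q : Pol ℂ J} {ζ : ℂ}
    (h : map (Polynomial.evalRingHom ζ) Q = 0) :
    ∃ Q', Q = C (Polynomial.X - Polynomial.C ζ) * Q' := by
  refine (C_dvd_iff_dvd_coeff _ _).mpr fun i => ?_
  rw [Polynomial.dvd_iff_isRoot]
  have := congrArg (coeff i) h
  rwa [coeff_map, coeff_zero] at this

lemma exists_primitive_factor (Q : Pol ℂ J) (hQ : Q ≠ 0) :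
    ∃ c Q₁, Q = C c * Q₁ ∧ ∀ ζ, map (Polynomial.evalRingHom ζ) Q₁ ≠ 0 := by
  obtain ⟨i, hi⟩ := exists_coeff_ne_zero hQ
  have key : ∀ n : ℕ, ∀ c Q₁, Q = C c * Q₁ → (coeff i Q₁).natDegree ≤ n →
      ∃ c Q₁, Q = C c * Q₁ ∧ ∀ ζ, map (Polynomial.evalRingHom ζ) Q₁ ≠ 0 := by
    intro n
    induction n with
    | zero =>
      intro c Q₁ h hn
      refine ⟨c, Q₁, h, fun ζ hζ => hi ?_⟩
      have h0 := congrArg (coeff i) hζ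
      have h1 : coeff i Q₁ = 0 := by
        obtain ⟨x, hx⟩ := Polynomial.natDegree_eq_zero.mp (Nat.le_zero.mp hn)
        rw [coeff_map, coeff_zero, ← hx] at h0
        rw [← hx]
        simpa using h0
      rw [h, coeff_C_mul, h1, mul_zero]
    | succ n ih =>
      intro c Q₁ h hn
      by_cases hz : ∀ ζ, map (Polynomial.evalRingHom ζ) Q₁ ≠ 0
      · exact ⟨c, Q₁, h, hz⟩
      push Not at hz
      obtain ⟨ζ, hζ⟩ := hz
      obtain ⟨Q', rfl⟩ := exists_eq_C_mul_of_map_eval_eq_zero hζ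
      refine ih (c * (Polynomial.X - Polynomial.C ζ)) Q' (by rw [h, map_mul, mul_assoc]) ?_
      have h1 : coeff i Q' ≠ 0 := by
        intro h0
        rw [h, coeff_C_mul, coeff_C_mul, h0] at hi
        simp at hi
      rw [coeff_C_mul, Polynomial.natDegree_mul (Polynomial.X_sub_C_ne_zero ζ) h1,
        Polynomial.natDegree_X_sub_C] at hn
      omega
  exact key _ 1 Q (by simp) le_rfl

lemma exists_eq_C_mul_of_C_mul_eq {Q Q' : Pol ℂ J}
    (hQ : ∀ ζ, map (Polynomial.evalRingHom ζ) Q ≠ 0) (n : ℕ) :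
    ∀ (b a : Polynomial ℂ), b.natDegree = n → b ≠ 0 → C b * Q' = C a * Q → ∃ ρ, Q' = C ρ * Q := by
  induction n with
  | zero =>
    intro b a hb hb0 h
    rw [Polynomial.natDegree_eq_zero] at hb
    obtain ⟨x, rfl⟩ := hb
    have hx : x ≠ 0 := fun hx => hb0 (by simp [hx])
    refine ⟨Polynomial.C x⁻¹ * a, ?_⟩
    rw [map_mul, mul_assoc, ← h, ← mul_assoc, ← map_mul, ← map_mul, inv_mul_cancel₀ hx]
    simp
  | succ n ih =>
    intro b a hb hb0 h
    obtain ⟨ζ, hζ⟩ := Complex.exists_root (f := b) (by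
      rw [Polynomial.degree_eq_natDegree hb0, hb]; positivity)
    have h1 : (C (a.eval ζ) : MvPolynomial (J × Fin 3) ℂ) *
        map (Polynomial.evalRingHom ζ) Q = 0 := by
      have := congrArg (map (Polynomial.evalRingHom ζ)) h
      rw [map_mul, map_mul, map_C, map_C] at this
      simpa [hζ.eq_zero] using this.symm
    have h2 : a.eval ζ = 0 := by
      simpa using (mul_eq_zero.mp h1).resolve_right (hQ ζ)
    obtain ⟨b', rfl⟩ := Polynomial.dvd_iff_isRoot.mpr hζ
    obtain ⟨a', rfl⟩ := Polynomial.dvd_iff_isRoot.mpr h2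
    have hb' : b' ≠ 0 := right_ne_zero_of_mul hb0
    refine ih b' a' ?_ hb' ?_
    · rw [Polynomial.natDegree_mul (Polynomial.X_sub_C_ne_zero ζ) hb',
        Polynomial.natDegree_X_sub_C] at hb
      omega
    · rw [map_mul, map_mul, mul_assoc, mul_assoc] at h
      refine mul_left_cancel₀ ?_ h
      rw [Ne, C_eq_zero]
      exact Polynomial.X_sub_C_ne_zero ζ

/-- A polynomial that is an eigenvector of `sysDer` over `ℂ(z)` is, up to a factor in `ℂ[z]`,
constant in `z` and invariant under the unipotent group generated by `matU` and `matV`. -/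
theorem exists_const_factor (Q : Pol ℂ J) (hQ : Q ≠ 0) (b a : Polynomial ℂ) (hb : b ≠ 0)
    (h : C b * sysDer ℂ J Q = C a * Q) :
    ∃ c Q₀, Q = C c * map Polynomial.C Q₀ ∧ Q₀ ≠ 0 ∧
      linDer ℂ J matU Q₀ = 0 ∧ linDer ℂ J matV Q₀ = 0 := by
  obtain ⟨c, Q₁, rfl, hQ₁⟩ := exists_primitive_factor Q hQ
  have hc : c ≠ 0 := by rintro rfl; simp at hQ
  have hQ₁0 : Q₁ ≠ 0 := right_ne_zero_of_mul hQ
  obtain ⟨ρ, hρ⟩ : ∃ ρ, sysDer ℂ J Q₁ = C ρ * Q₁ := by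
    refine exists_eq_C_mul_of_C_mul_eq hQ₁ _ (b * c)
      (a * c - b * (Polynomial.X * derivative c)) rfl (mul_ne_zero hb hc) ?_
    rw [(sysDer ℂ J).leibniz, sysDer_C] at h
    simp only [map_sub, map_mul, smul_eq_mul] at h ⊢
    linear_combination h
  have hT : toPoly ℂ J Q₁ ≠ 0 := fun h0 => hQ₁0 (toPoly_injective (by rw [h0, map_zero]))
  have hTρ : toPoly ℂ J (sysDer ℂ J Q₁) = ρ.map C * toPoly ℂ J Q₁ := by
    rw [hρ, map_mul]; simp [toPoly]
  set q : ℕ → MvPolynomial (J × Fin 3) ℂ := fun i => (toPoly ℂ J Q₁).coeff i with hq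
  set m := (toPoly ℂ J Q₁).natDegree with hm
  have hgt : ∀ i, m < i → q i = 0 := fun i hi => Polynomial.coeff_eq_zero_of_natDegree_lt hi
  have hρ1 : ρ.natDegree ≤ 1 := by
    by_cases hρ0 : ρ = 0
    · simp [hρ0]
    have h1 : (ρ.map (C : ℂ →+* MvPolynomial (J × Fin 3) ℂ)).natDegree = ρ.natDegree :=
      Polynomial.natDegree_map_eq_of_injective (C_injective _ _) _
    have h2 : (ρ.map (C : ℂ →+* MvPolynomial (J × Fin 3) ℂ)) ≠ 0 :=
      (Polynomial.map_ne_zero_iff (C_injective _ _)).mpr hρ0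
    have h3 : (toPoly ℂ J (sysDer ℂ J Q₁)).natDegree ≤ m + 1 := by
      rw [Polynomial.natDegree_le_iff_coeff_eq_zero]
      intro i hi
      obtain ⟨i, rfl⟩ : ∃ k, i = k + 1 := ⟨i - 1, by omega⟩
      rw [coeff_succ_toPoly_sysDer]
      have e1 := hgt (i + 1) (by omega)
      have e2 := hgt i (by omega)
      simp only [hq] at e1 e2
      simp [e1, e2]
    rw [hTρ, Polynomial.natDegree_mul h2 hT, h1, ← hm] at h3
    omega
  obtain ⟨ρ₁, ρ₀, rfl⟩ := Polynomial.exists_eq_X_add_C_of_natDegree_le_one hρ1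
  have h0 : q 0 ≠ 0 := by
    have := hQ₁ 0
    rw [← eval_toPoly, map_zero, ← Polynomial.coeff_zero_eq_eval_zero] at this
    exact this
  obtain ⟨hm0, hU, hV⟩ := semiinvariant q m (Polynomial.leadingCoeff_ne_zero.mpr hT) hgt h0 ρ₀ ρ₁
    (by
      rw [hq]; dsimp only
      rw [← coeff_zero_toPoly_sysDer, hTρ]
      simp [Polynomial.mul_coeff_zero, smul_eq_C_mul])
    (fun i => by
      rw [hq]; dsimp only
      rw [← coeff_succ_toPoly_sysDer, hTρ]
      simp only [Polynomial.map_add, Polynomial.map_mul, Polynomial.map_C, Polynomial.map_X,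
        add_mul, Polynomial.coeff_add, mul_assoc, Polynomial.coeff_C_mul, Polynomial.coeff_X_mul,
        smul_eq_C_mul]
      ring)
  refine ⟨c, q 0, ?_, h0, hU, hV⟩
  congr 1
  apply toPoly_injective
  rw [toPoly_map_C]
  exact Polynomial.eq_C_of_natDegree_eq_zero hm0

/-- A polynomial killed by a square-zero linear derivation is invariant under the
corresponding unipotent substitution. -/
lemma aeval_unipotent_eq {S : Type*} [CommRing S] [IsDomain S] [CharZero S]
    (N : Matrix (Fin 3) (Fin 3) S) (hN : N * N = 0) (p : MvPolynomial (J × Fin 3) S)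
    (hp : linDer S J N p = 0) :
    aeval (fun s => X s + linDer S J N (X s)) p = p := by
  set ψ : MvPolynomial (J × Fin 3) S →ₐ[S] Polynomial (MvPolynomial (J × Fin 3) S) :=
    aeval fun s => Polynomial.C (X s) + Polynomial.X * Polynomial.C (linDer S J N (X s)) with hψ
  have hNN : ∀ s, linDer S J N (linDer S J N (X s)) = 0 := by
    intro s
    have h : ∀ i k, N i 0 * N 0 k + N i 1 * N 1 k + N i 2 * N 2 k = 0 := by
      intro i k
      simpa [Matrix.mul_apply, Fin.sum_univ_three] using congrFun (congrFun hN i) k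
    have h' : ∀ i k, (C (N i 0) * C (N 0 k) + C (N i 1) * C (N 1 k) + C (N i 2) * C (N 2 k) :
        MvPolynomial (J × Fin 3) S) = 0 := by
      intro i k
      rw [← map_mul, ← map_mul, ← map_mul, ← map_add, ← map_add, h, map_zero]
    simp only [linDer_X, Fin.sum_univ_three, map_add, Derivation.leibniz, derivation_C,
      smul_eq_mul]
    linear_combination X (s.1, 0) * h' s.2 0 + X (s.1, 1) * h' s.2 1 + X (s.1, 2) * h' s.2 2
  have hlin : ∀ s, ψ (linDer S J N (X s)) = Polynomial.C (linDer S J N (X s)) := by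
    intro s
    have h1 : ψ (linDer S J N (X s)) = Polynomial.C (linDer S J N (X s)) +
        Polynomial.X * Polynomial.C (linDer S J N (linDer S J N (X s))) := by
      conv_lhs => rw [linDer_X]
      conv_rhs => rw [linDer_X]
      simp only [Fin.sum_univ_three, map_add, map_mul, Derivation.leibniz, derivation_C,
        smul_eq_mul, hψ, aeval_X]
      simp only [aeval_C, Polynomial.algebraMap_apply, algebraMap_eq]
      simp only [Fin.sum_univ_three, linDer_X, map_add, map_mul]
      simp only [map_zero]
      ring
    rw [h1, hNN, map_zero, mul_zero, add_zero]
  have hder : ∀ r, derivative (ψ r) = ψ (linDer S J N r) := by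
    intro r
    induction r using MvPolynomial.induction_on with
    | C a => simp [hψ, Polynomial.algebraMap_apply]
    | add p q hp hq => simp only [map_add, hp, hq]
    | mul_X p s hp =>
      rw [map_mul, Polynomial.derivative_mul, hp, Derivation.leibniz, smul_eq_mul, smul_eq_mul,
        map_add, map_mul, map_mul, hlin]
      have : derivative (ψ (X s)) = Polynomial.C (linDer S J N (X s)) := by
        rw [hψ, aeval_X]; simp
      rw [this]; ring
  have h0 := hder p
  rw [hp, map_zero] at h0
  have h1 := Polynomial.derivative_eq_zero.mp h0
  rw [Polynomial.natDegree_eq_zero] at h1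
  obtain ⟨g, hg⟩ := h1
  have e0 : (ψ p).eval 0 = p := by
    have : (Polynomial.evalRingHom 0).comp ψ.toRingHom = RingHom.id _ := by
      refine MvPolynomial.ringHom_ext (fun a => ?_) fun s => ?_ <;>
        simp [hψ, Polynomial.algebraMap_apply]
    exact congrArg (fun g : MvPolynomial (J × Fin 3) S →+* MvPolynomial (J × Fin 3) S => g p) this
  have e1 : (ψ p).eval 1 = aeval (fun s => X s + linDer S J N (X s)) p := by
    have : (Polynomial.evalRingHom 1).comp ψ.toRingHom =
        (aeval fun s => X s + linDer S J N (X s)).toRingHom := by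
      refine MvPolynomial.ringHom_ext (fun a => ?_) fun s => ?_ <;>
        simp [hψ, Polynomial.algebraMap_apply, Polynomial.eval_finsetSum]
    exact congrArg (fun g : MvPolynomial (J × Fin 3) S →+* MvPolynomial (J × Fin 3) S => g p) this
  rw [← e1, ← hg, Polynomial.eval_C]
  rw [← hg, Polynomial.eval_C] at e0
  exact e0

end Factor

/-! ### Determinants -/

section Det

lemma derivation_prod {S ι : Type*} [CommRing S] [Algebra ℤ S] [DecidableEq ι]
    (δ : Derivation ℤ S S) (s : Finset ι) (f : ι → S) :
    δ (∏ i ∈ s, f i) = ∑ i ∈ s, ∏ j ∈ s, Function.update f i (δ (f i)) j := by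
  induction s using Finset.induction_on with
  | empty => simp
  | insert a s ha ih =>
    rw [Finset.prod_insert ha, δ.leibniz, ih, Finset.sum_insert ha, Finset.prod_insert ha,
      Function.update_self, smul_eq_mul, smul_eq_mul, Finset.mul_sum, add_comm]
    congr 1
    · rw [mul_comm]
      congr 1
      refine Finset.prod_congr rfl fun j hj => ?_
      rw [Function.update_of_ne (by rintro rfl; exact ha hj)]
    · refine Finset.sum_congr rfl fun i hi => ?_
      rw [Finset.prod_insert ha, Function.update_of_ne (by rintro rfl; exact ha hi)]

lemma derivation_det {S n : Type*} [CommRing S] [Algebra ℤ S] [Fintype n] [DecidableEq n]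
    (δ : Derivation ℤ S S) (M : Matrix n n S) :
    δ M.det = ∑ i, (M.updateRow i fun j => δ (M i j)).det := by
  rw [← Matrix.det_transpose M, Matrix.det_apply, map_sum]
  simp only [Matrix.transpose_apply]
  rw [Finset.sum_congr rfl (g := fun σ : Equiv.Perm n => ∑ i, Equiv.Perm.sign σ •
    ∏ j, Function.update (fun i => M i (σ i)) i (δ (M i (σ i))) j)]
  · rw [Finset.sum_comm]
    refine Finset.sum_congr rfl fun i _ => ?_
    rw [← Matrix.det_transpose, Matrix.det_apply]
    refine Finset.sum_congr rfl fun σ _ => ?_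
    congr 1
    refine Finset.prod_congr rfl fun j _ => ?_
    rw [Matrix.transpose_apply]
    by_cases h : j = i
    · subst h; simp
    · simp [h]
  · intro σ _
    rw [← Finset.smul_sum, ← derivation_prod, Units.smul_def, Units.smul_def, map_zsmul]

lemma natDegree_det_le {S n : Type*} [CommRing S] [Fintype n] [DecidableEq n]
    (M : Matrix n n (Polynomial S)) (d : ℕ) (h : ∀ i j, (M i j).natDegree ≤ d) :
    M.det.natDegree ≤ Fintype.card n * d := by
  rw [Matrix.det_apply]
  refine Polynomial.natDegree_sum_le_of_forall_le _ _ fun σ _ => ?_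
  refine (Polynomial.natDegree_smul_le _ _).trans ((Polynomial.natDegree_prod_le _ _).trans ?_)
  refine (Finset.sum_le_card_nsmul _ _ d fun i _ => h _ _).trans ?_
  simp

lemma totalDegree_det_le {S n σ : Type*} [CommRing S] [Fintype n] [DecidableEq n]
    (M : Matrix n n (MvPolynomial σ S)) (d : ℕ) (h : ∀ i j, (M i j).totalDegree ≤ d) :
    M.det.totalDegree ≤ Fintype.card n * d := by
  rw [Matrix.det_apply]
  refine totalDegree_finsetSum_le fun τ _ => ?_
  rw [Units.smul_def, zsmul_eq_mul, ← map_intCast (C (σ := σ) (R := S)), ← smul_eq_C_mul]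
  refine (totalDegree_smul_le _ _).trans ((totalDegree_finsetProd _ _).trans ?_)
  refine (Finset.sum_le_card_nsmul _ _ d fun i _ => h _ _).trans ?_
  simp

lemma exists_det_ne_zero_of_span_eq_top {F ι n : Type*} [Field F] [Fintype n] [DecidableEq n]
    (v : ι → n → F) (h : Submodule.span F (Set.range v) = ⊤) :
    ∃ e : n → ι, (Matrix.of fun i => v (e i)).det ≠ 0 := by
  obtain ⟨κ, a, -, hspan, hli⟩ := exists_linearIndependent' F v
  rw [h] at hspan
  let b := Module.Basis.mk hli (by rw [hspan])
  have : Finite κ := Module.Finite.finite_basis b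
  have : Fintype κ := Fintype.ofFinite κ
  let e : n ≃ κ := (Pi.basisFun F n).indexEquiv b
  refine ⟨fun i => a (e i), ?_⟩
  have h1 : LinearIndependent F (Matrix.of fun i => v (a (e i))).row :=
    hli.comp e e.injective
  rw [Matrix.linearIndependent_rows_iff_isUnit, Matrix.isUnit_iff_isUnit_det] at h1
  exact h1.ne_zero

lemma det_rename_ne_zero {A : Type*} [CommRing A] [IsDomain A] [Infinite A] {r : ℕ}
    (p : Fin r → MvPolynomial (Unit × Fin 3) A) (hp : LinearIndependent A p) :
    (Matrix.of fun k j : Fin r =>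
      rename (Prod.map (fun _ : Unit => j) (id : Fin 3 → Fin 3)) (p k)).det ≠ 0 := by
  classical
  let F := FractionRing A
  let v : ((Unit × Fin 3) → A) → Fin r → F := fun x k => algebraMap A F (eval x (p k))
  have hspan : Submodule.span F (Set.range v) = ⊤ := by
    by_contra hne
    obtain ⟨g, hg, hle⟩ := Submodule.exists_le_ker_of_lt_top _ (lt_top_iff_ne_top.mpr hne)
    obtain ⟨d, hd⟩ := IsLocalization.exist_integer_multiples_of_finite (nonZeroDivisors A)
      fun k : Fin r => g (Pi.single k 1)
    choose c hc using hd
    have hgv : ∀ w : Fin r → F, g w = ∑ k, w k * g (Pi.single k 1) := by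
      intro w
      conv_lhs => rw [← Finset.univ_sum_single w]
      rw [map_sum]
      refine Finset.sum_congr rfl fun k _ => ?_
      rw [← smul_eq_mul, ← map_smul, ← Pi.single_smul, smul_eq_mul, mul_one]
    have hsum : ∑ k, c k • p k = 0 := by
      refine MvPolynomial.funext fun x => ?_
      apply IsFractionRing.injective A F
      have h1 : g (v x) = 0 := hle (Submodule.subset_span ⟨x, rfl⟩)
      rw [hgv] at h1
      simp only [smul_eq_C_mul, map_sum, map_mul, eval_C, map_zero, hc]
      have h2 : (d : A) • (0 : F) = 0 := smul_zero _
      rw [← h1, Finset.smul_sum, h1] at h2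
      rw [← h2]
      refine Finset.sum_congr rfl fun k _ => ?_
      rw [Algebra.smul_mul_assoc, mul_comm]
    have hc0 := Fintype.linearIndependent_iff.mp hp c hsum
    apply hg
    ext k
    have h3 := hc k
    rw [hc0 k, map_zero, eq_comm, Algebra.smul_def, mul_eq_zero] at h3
    have h4 : algebraMap A F d ≠ 0 := by
      simp
    simpa using h3.resolve_left h4
  obtain ⟨e, he⟩ := exists_det_ne_zero_of_span_eq_top v hspan
  intro h0
  apply he
  have h1 := congrArg (algebraMap A F) (congrArg (eval fun q : Fin r × Fin 3 => e q.1 ((), q.2)) h0)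
  rw [RingHom.map_det, RingHom.map_det, map_zero, map_zero] at h1
  rw [← Matrix.det_transpose, ← h1]
  congr 1
  ext k j
  simp only [Matrix.transpose_apply, Matrix.of_apply, RingHom.mapMatrix_apply, Matrix.map_apply,
    eval_rename, v]
  rfl

end Det

/-! ### The zero estimate -/

section Zero

variable {J : Type*}

lemma map_linDer {R S : Type*} [CommRing R] [CommRing S] (g : R →+* S)
    (M : Matrix (Fin 3) (Fin 3) R) (p : MvPolynomial (J × Fin 3) R) :
    map g (linDer R J M p) = linDer S J (M.map g) (map g p) := by
  induction p using MvPolynomial.induction_on with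
  | C a => simp
  | add p q hp hq => simp only [map_add, hp, hq]
  | mul_X p s hp =>
    simp only [map_mul, map_add, Derivation.leibniz, smul_eq_mul, hp, linDer_X, map_sum, map_C,
      map_X, Matrix.map_apply]

/-- Unipotent invariance in terms of values. -/
lemma aeval_eq_aeval_of_linDer_eq_zero {S : Type*} [CommRing S] [IsDomain S] [Algebra ℂ S]
    (p : MvPolynomial (J × Fin 3) ℂ) (hU : linDer ℂ J matU p = 0) (hV : linDer ℂ J matV p = 0)
    (g : J × Fin 3 → S) (s t : S) :
    aeval g p = aeval (fun q => g q - ![0, s, t] q.2 * g (q.1, 0)) p := by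
  have : CharZero S := charZero_of_injective_algebraMap (algebraMap ℂ S).injective
  set N : Matrix (Fin 3) (Fin 3) S :=
    (-s) • matU.map (algebraMap ℂ S) + (-t) • matV.map (algebraMap ℂ S) with hN
  have hNN : N * N = 0 := by
    ext i j
    fin_cases i <;> fin_cases j <;>
      simp [hN, matU, matV, Matrix.mul_apply, Fin.sum_univ_three]
  have hp : linDer S J N (map (algebraMap ℂ S) p) = 0 := by
    rw [hN, linDer_add, linDer_smul, linDer_smul, ← map_linDer, ← map_linDer, hU, hV]
    simp
  have h := congrArg (aeval g) (aeval_unipotent_eq N hNN _ hp)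
  rw [aeval_map_algebraMap, aeval_map_algebraMap] at h
  rw [← h]
  have hcomp : ∀ (u : J × Fin 3 → MvPolynomial (J × Fin 3) S),
      (aeval g : MvPolynomial (J × Fin 3) S →ₐ[S] S) (aeval u p) =
        aeval (fun q => aeval g (u q)) p := by
    intro u
    have := MvPolynomial.comp_aeval_apply (R := ℂ) u
      ((aeval g : MvPolynomial (J × Fin 3) S →ₐ[S] S).restrictScalars ℂ) p
    exact this
  rw [hcomp]
  congr 2
  funext q
  obtain ⟨j, i⟩ := q
  fin_cases i <;> simp [hN, matU, matV, Fin.sum_univ_three] <;> ring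

lemma exists_coe_eq_X_pow_mul (c : Polynomial ℂ) (hc : c ≠ 0) :
    ∃ e ≤ c.natDegree, ∃ u : Polynomial ℂ, c = Polynomial.X ^ e * u ∧ u.eval 0 ≠ 0 := by
  obtain ⟨u, hu, hnd⟩ := Polynomial.exists_eq_pow_rootMultiplicity_mul_and_not_dvd c hc 0
  rw [Polynomial.dvd_iff_isRoot] at hnd
  rw [map_zero, sub_zero] at hu
  refine ⟨_, ?_, u, hu, hnd⟩
  have h0 : u ≠ 0 := by rintro rfl; simp at hnd
  conv_rhs => rw [hu]
  rw [Polynomial.natDegree_mul (pow_ne_zero _ Polynomial.X_ne_zero) h0, Polynomial.natDegree_X_pow]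
  omega

lemma X_pow_dvd_of_dvd_coe_mul {c : Polynomial ℂ} (hc : c ≠ 0) {T : ℕ} {F : PowerSeries ℂ}
    (h : PowerSeries.X ^ T ∣ (c : PowerSeries ℂ) * F) :
    PowerSeries.X ^ (T - c.natDegree) ∣ F := by
  obtain ⟨e, he, u, rfl, hu⟩ := exists_coe_eq_X_pow_mul c hc
  have hunit : IsUnit (u : PowerSeries ℂ) := by
    rw [PowerSeries.isUnit_iff_constantCoeff, isUnit_iff_ne_zero]
    rwa [← Polynomial.coeff_zero_eq_eval_zero] at hu
  refine (pow_dvd_pow _ (Nat.sub_le_sub_left he T)).trans ?_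
  by_cases heT : e ≤ T
  · rw [← Nat.add_sub_cancel' heT, pow_add, Polynomial.coe_mul, Polynomial.coe_pow,
      Polynomial.coe_X, mul_assoc] at h
    have := (mul_dvd_mul_iff_left (pow_ne_zero e PowerSeries.X_ne_zero)).mp h
    exact (hunit.dvd_mul_left).mp this
  · rw [Nat.sub_eq_zero_of_le (by omega)]; simp

lemma not_X_pow_dvd_aeval {p : Polynomial ℂ} (hp : p ≠ 0) {w : PowerSeries ℂ}
    (hw : PowerSeries.constantCoeff w ≠ 0) {L : ℕ} (hL : p.natDegree < L) :
    ¬ PowerSeries.X ^ L ∣ Polynomial.aeval (PowerSeries.X * w) p := by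
  intro h
  obtain ⟨e, he, u, rfl, hu⟩ := exists_coe_eq_X_pow_mul p hp
  have heL : e < L := by omega
  rw [map_mul, map_pow, Polynomial.aeval_X, mul_pow, mul_assoc, ← Nat.add_sub_cancel' heL.le,
    pow_add, mul_dvd_mul_iff_left (pow_ne_zero e PowerSeries.X_ne_zero)] at h
  have h1 : PowerSeries.X ∣ w ^ e * Polynomial.aeval (PowerSeries.X * w) u :=
    (dvd_pow_self _ (by omega)).trans h
  rw [PowerSeries.X_dvd_iff, map_mul, map_pow] at h1
  have h2 : PowerSeries.constantCoeff (Polynomial.aeval (PowerSeries.X * w) u) = u.eval 0 := by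
    rw [Polynomial.aeval_def, Polynomial.hom_eval₂]
    have : (PowerSeries.constantCoeff (R := ℂ)).comp (algebraMap ℂ (PowerSeries ℂ)) =
        RingHom.id ℂ := by
      ext
      simp
    rw [this]
    simp [Polynomial.coeff_zero_eq_eval_zero]
  rw [h2] at h1
  exact (mul_ne_zero (pow_ne_zero e hw) hu) h1

/-- The substitution of power series for the variables. -/
def subst (Y : Fin 3 → PowerSeries ℂ) : Pol ℂ Unit →+* PowerSeries ℂ :=
  eval₂Hom Polynomial.coeToPowerSeries.ringHom fun s => Y s.2

lemma natDegree_toPoly_sysDer_le {R : Type*} [CommRing R] (p : Pol R J) (n : ℕ)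
    (h : (toPoly R J p).natDegree ≤ n) : (toPoly R J (sysDer R J p)).natDegree ≤ n + 1 := by
  rw [Polynomial.natDegree_le_iff_coeff_eq_zero] at h ⊢
  intro i hi
  obtain ⟨i, rfl⟩ : ∃ k, i = k + 1 := ⟨i - 1, by omega⟩
  rw [coeff_succ_toPoly_sysDer, h i (by omega), h (i + 1) (by omega)]
  simp

lemma natDegree_toPoly_iterate_sysDer_le {R : Type*} [CommRing R] (p : Pol R J) (n : ℕ)
    (h : (toPoly R J p).natDegree ≤ n) (k : ℕ) :
    (toPoly R J ((sysDer R J)^[k] p)).natDegree ≤ n + k := by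
  induction k with
  | zero => simpa using h
  | succ k ih =>
    rw [Function.iterate_succ_apply']
    exact natDegree_toPoly_sysDer_le _ _ ih

end Zero

/-! ### Independent copies of a solution -/

section CopyDet

/-- The Wronskian-type determinant formed with independent copies of the solution. -/
def copyDet (r : ℕ) (P : Pol ℂ Unit) : Pol ℂ (Fin r) :=
  (Matrix.of fun k j : Fin r => rename (Prod.map (fun _ : Unit => j) (id : Fin 3 → Fin 3))
    ((sysDer ℂ Unit)^[k] P)).det

lemma C_mul_sysDer_copyDet {m : ℕ} (P : Pol ℂ Unit) (a : Fin (m + 1) → Polynomial ℂ)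
    (b : Polynomial ℂ)
    (h : C b * (sysDer ℂ Unit)^[m + 1] P = ∑ k : Fin (m + 1), C (a k) * (sysDer ℂ Unit)^[k] P) :
    C b * sysDer ℂ (Fin (m + 1)) (copyDet (m + 1) P) = C (a (Fin.last m)) * copyDet (m + 1) P := by
  rw [copyDet, derivation_det, Finset.sum_eq_single (Fin.last m)]
  · set W : Matrix (Fin (m + 1)) (Fin (m + 1)) (Pol ℂ (Fin (m + 1))) :=
      Matrix.of fun k j => rename (Prod.map (fun _ : Unit => j) (id : Fin 3 → Fin 3))
        ((sysDer ℂ Unit)^[k] P) with hW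
    have h1 : ((C b : Pol ℂ (Fin (m + 1))) • fun j => sysDer ℂ (Fin (m + 1)) (W (Fin.last m) j)) =
        ∑ k, (C (a k) : Pol ℂ (Fin (m + 1))) • W k := by
      funext j
      simp only [Pi.smul_apply, Finset.sum_apply, hW, Matrix.of_apply, ← rename_sysDer,
        ← Function.iterate_succ_apply' (sysDer ℂ Unit), Fin.val_last, smul_eq_mul]
      rw [← rename_C (Prod.map (fun _ : Unit => j) (id : Fin 3 → Fin 3)), ← map_mul, h, map_sum]
      simp
    rw [← Matrix.det_updateRow_smul, h1, Matrix.det_updateRow_sum, smul_eq_mul]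
  · intro i _ hi
    have hi' : (i : ℕ) + 1 < m + 1 := by
      have := Fin.val_lt_last hi
      omega
    refine Matrix.det_zero_of_row_eq (i := i) (j := ⟨i + 1, hi'⟩) (by simp [Fin.ext_iff]) ?_
    rw [Matrix.updateRow_self, Matrix.updateRow_ne (by simp [Fin.ext_iff])]
    funext j
    simp only [Matrix.of_apply, ← rename_sysDer, ← Function.iterate_succ_apply' (sysDer ℂ Unit)]
  · simp

lemma totalDegree_sysDer_le {R J : Type*} [CommRing R] (p : Pol R J) :
    (sysDer R J p).totalDegree ≤ p.totalDegree := by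
  have hX : ∀ s : J × Fin 3, (sysDer R J (X s)).totalDegree ≤ 1 := by
    intro s
    rw [sysDer_X]
    refine totalDegree_finsetSum_le fun k _ => ?_
    refine (totalDegree_mul _ _).trans ?_
    rw [totalDegree_C, zero_add]
    exact (totalDegree_monomial_le _ _).trans (by simp)
  have hmul : ∀ (p q : Pol R J) (a b : ℕ), p.totalDegree ≤ a → (sysDer R J p).totalDegree ≤ a →
      q.totalDegree ≤ b → (sysDer R J q).totalDegree ≤ b →
      (p * q).totalDegree ≤ a + b ∧ (sysDer R J (p * q)).totalDegree ≤ a + b := by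
    intro p q a b h1 h2 h3 h4
    refine ⟨(totalDegree_mul _ _).trans (by omega), ?_⟩
    rw [Derivation.leibniz, smul_eq_mul, smul_eq_mul]
    refine (totalDegree_add _ _).trans (max_le ?_ ?_) <;>
    exact (totalDegree_mul _ _).trans (by omega)
  have hmon : ∀ (d : ℕ) (s : J × Fin 3 →₀ ℕ), s.degree = d →
      ∀ a : Polynomial R, (sysDer R J (monomial s a)).totalDegree ≤ d := by
    intro d
    induction d with
    | zero =>
      intro s hs a
      rw [Finsupp.degree_eq_zero_iff] at hs
      subst hs
      rw [monomial_zero', sysDer_C, totalDegree_C]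
    | succ d ih =>
      intro s hs a
      have hs0 : s ≠ 0 := by rintro rfl; simp at hs
      obtain ⟨i, hi⟩ := Finsupp.ne_iff.mp hs0
      have hle : Finsupp.single i 1 ≤ s := by
        rw [Finsupp.single_le_iff]
        exact Nat.one_le_iff_ne_zero.mpr hi
      obtain ⟨s', rfl⟩ := exists_add_of_le hle
      rw [map_add, Finsupp.degree_single] at hs
      have hs' : s'.degree = d := by omega
      rw [← one_mul a, ← monomial_mul, add_comm d]
      refine (hmul _ _ _ _ ?_ ?_ ?_ (ih s' hs' a)).2
      · exact (totalDegree_monomial_le _ _).trans (by simp)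
      · exact hX i
      · exact (totalDegree_monomial_le _ _).trans hs'.le
  conv_lhs => rw [p.as_sum, map_sum]
  refine totalDegree_finsetSum_le fun s hs => ?_
  refine (hmon _ s rfl _).trans ?_
  exact le_totalDegree hs

lemma totalDegree_iterate_sysDer_le {R J : Type*} [CommRing R] (p : Pol R J) (k : ℕ) :
    ((sysDer R J)^[k] p).totalDegree ≤ p.totalDegree := by
  induction k with
  | zero => simp
  | succ k ih =>
    rw [Function.iterate_succ_apply']
    exact (totalDegree_sysDer_le _).trans ih

lemma exists_minimal_relation {A V : Type*} [CommRing A] [IsDomain A] [AddCommGroup V] [Module A V]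
    [Module.IsTorsionFree A V] (v : ℕ → V) (h0 : v 0 ≠ 0) (M : ℕ)
    (h : ¬ LinearIndependent A fun k : Fin M => v k) :
    ∃ m, m + 2 ≤ M ∧ LinearIndependent A (fun k : Fin (m + 1) => v k) ∧
      ∃ (a : Fin (m + 1) → A) (b : A), b ≠ 0 ∧ b • v (m + 1) = ∑ k : Fin (m + 1), a k • v k := by
  classical
  have hex : ∃ r, ¬ LinearIndependent A fun k : Fin r => v k := ⟨M, h⟩
  obtain ⟨r, hr⟩ : ∃ r, r = Nat.find hex := ⟨_, rfl⟩
  have hspec := Nat.find_spec hex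
  have hmin := fun m => Nat.find_min hex (m := m)
  have hle := Nat.find_min' hex h
  rw [← hr] at hspec hmin hle
  obtain _ | _ | m := r
  · exact absurd (linearIndependent_empty_type) hspec
  · refine absurd ?_ hspec
    change LinearIndependent A fun k : Fin 1 => v k
    rw [linearIndependent_unique_iff]
    simpa using h0
  · have hli : LinearIndependent A fun k : Fin (m + 1) => v k :=
      not_not.mp (hmin (m + 1) (by omega))
    refine ⟨m, hle, hli, ?_⟩
    rw [Fintype.not_linearIndependent_iff] at hspec
    obtain ⟨g, hg, i, hi⟩ := hspec
    rw [Fin.sum_univ_castSucc] at hg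
    simp only [Fin.val_castSucc, Fin.val_last] at hg
    have hb : g (Fin.last _) ≠ 0 := by
      intro hb
      rw [hb, zero_smul, add_zero] at hg
      have := Fintype.linearIndependent_iff.mp hli _ hg
      induction i using Fin.lastCases with
      | last => exact hi hb
      | cast i => exact hi (this i)
    refine ⟨fun k => -g k.castSucc, _, hb, ?_⟩
    rw [eq_comm]
    simp only [neg_smul, Finset.sum_neg_distrib]
    exact neg_eq_of_add_eq_zero_right hg

lemma natDegree_toPoly_rename_le {R J J' : Type*} [CommRing R] (j : J → J') (p : Pol R J) :
    (toPoly R J' (rename (Prod.map j id) p)).natDegree ≤ (toPoly R J p).natDegree := by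
  have : (toPoly R J').comp (rename (Prod.map j (id : Fin 3 → Fin 3)) :
      Pol R J →ₐ[Polynomial R] Pol R J').toRingHom =
      (Polynomial.mapRingHom (rename (Prod.map j (id : Fin 3 → Fin 3)) :
        MvPolynomial (J × Fin 3) R →ₐ[R] MvPolynomial (J' × Fin 3) R).toRingHom).comp
        (toPoly R J) := by
    refine MvPolynomial.ringHom_ext' (Polynomial.ringHom_ext (fun a => ?_) ?_) fun s => ?_ <;>
    simp [toPoly]
  have := congrArg (fun g : Pol R J →+* Polynomial (MvPolynomial (J' × Fin 3) R) => g p) this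
  have h : toPoly R J' (rename (Prod.map j id) p) = Polynomial.map
      (rename (Prod.map j (id : Fin 3 → Fin 3)) :
        MvPolynomial (J × Fin 3) R →ₐ[R] MvPolynomial (J' × Fin 3) R).toRingHom
      (toPoly R J p) := this
  rw [h]
  exact Polynomial.natDegree_map_le

lemma natDegree_toPoly_C {R J : Type*} [CommRing R] [IsDomain R] (c : Polynomial R) :
    (toPoly R J (C c)).natDegree = c.natDegree := by
  simp only [toPoly, coe_eval₂Hom, eval₂_C, Polynomial.coe_mapRingHom]
  exact Polynomial.natDegree_map_eq_of_injective (C_injective _ _) _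

lemma natDegree_le_natDegree_toPoly_mul {J : Type*} (c : Polynomial ℂ)
    (Q₀ : MvPolynomial (J × Fin 3) ℂ) (h : C c * map Polynomial.C Q₀ ≠ 0) :
    c.natDegree ≤ (toPoly ℂ J (C c * map Polynomial.C Q₀)).natDegree := by
  have h1 : toPoly ℂ J (C c * map Polynomial.C Q₀) ≠ 0 := by
    rw [← map_zero (toPoly ℂ J)]
    exact fun h' => h (toPoly_injective h')
  rw [map_mul] at h1 ⊢
  rw [Polynomial.natDegree_mul (left_ne_zero_of_mul h1) (right_ne_zero_of_mul h1),
    natDegree_toPoly_C]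
  omega

lemma totalDegree_le_totalDegree_mul {J : Type*} (c : Polynomial ℂ) (hc : c ≠ 0)
    (Q₀ : MvPolynomial (J × Fin 3) ℂ) :
    Q₀.totalDegree ≤ (C c * map Polynomial.C Q₀).totalDegree := by
  refine Finset.sup_mono fun s hs => ?_
  rw [mem_support_iff] at hs ⊢
  rw [coeff_C_mul, coeff_map]
  exact mul_ne_zero hc (by simpa using hs)

lemma natDegree_toPoly_copyDet_le (m : ℕ) (P : Pol ℂ Unit) (n : ℕ)
    (hn : (toPoly ℂ Unit P).natDegree ≤ n) :
    (toPoly ℂ _ (copyDet (m + 1) P)).natDegree ≤ (m + 1) * (n + m) := by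
  rw [copyDet, RingHom.map_det]
  refine (natDegree_det_le _ (n + m) fun i j => ?_).trans (by simp)
  refine (natDegree_toPoly_rename_le (fun _ : Unit => j) _).trans ?_
  refine (natDegree_toPoly_iterate_sysDer_le _ n hn _).trans ?_
  omega

lemma totalDegree_copyDet_le (m : ℕ) (P : Pol ℂ Unit) :
    (copyDet (m + 1) P).totalDegree ≤ (m + 1) * P.totalDegree := by
  rw [copyDet]
  refine (totalDegree_det_le _ P.totalDegree fun i j => ?_).trans (by simp)
  refine (totalDegree_rename_le _ _).trans (totalDegree_iterate_sysDer_le _ _)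

lemma exists_invariant (m : ℕ) (P : Pol ℂ Unit) (n : ℕ) (hn : (toPoly ℂ Unit P).natDegree ≤ n)
    (hli : LinearIndependent (Polynomial ℂ) fun k : Fin (m + 1) => (sysDer ℂ Unit)^[k] P)
    (a : Fin (m + 1) → Polynomial ℂ) (b : Polynomial ℂ) (hb : b ≠ 0)
    (h : b • (sysDer ℂ Unit)^[m + 1] P = ∑ k : Fin (m + 1), a k • (sysDer ℂ Unit)^[k] P) :
    ∃ c Q₀, copyDet (m + 1) P = C c * map Polynomial.C Q₀ ∧ c ≠ 0 ∧ Q₀ ≠ 0 ∧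
      linDer ℂ _ matU Q₀ = 0 ∧ linDer ℂ _ matV Q₀ = 0 ∧
      c.natDegree ≤ (m + 1) * (n + m) ∧ Q₀.totalDegree ≤ (m + 1) * P.totalDegree := by
  have hQ : copyDet (m + 1) P ≠ 0 := det_rename_ne_zero _ hli
  simp only [smul_eq_C_mul] at h
  obtain ⟨c, Q₀, h1, h2, h3, h4⟩ :=
    exists_const_factor _ hQ b _ hb (C_mul_sysDer_copyDet P a b h)
  have hc : c ≠ 0 := by rintro rfl; simp [h1] at hQ
  refine ⟨c, Q₀, h1, hc, h2, h3, h4, ?_, ?_⟩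
  · refine (natDegree_le_natDegree_toPoly_mul c Q₀ (h1 ▸ hQ)).trans ?_
    rw [← h1]
    exact natDegree_toPoly_copyDet_le m P n hn
  · refine (totalDegree_le_totalDegree_mul c hc Q₀).trans ?_
    rw [← h1]
    exact totalDegree_copyDet_le m P

end CopyDet

/-! ### Linear independence of the iterated derivatives -/

section Independence

lemma dvd_det_of_dvd_col {S n : Type*} [CommRing S] [Fintype n] [DecidableEq n] (M : Matrix n n S)
    (j : n) (d : S) (h : ∀ i, d ∣ M i j) : d ∣ M.det := by
  rw [Matrix.det_apply']
  refine Finset.dvd_sum fun σ _ => Dvd.dvd.mul_left ?_ _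
  exact (h (σ j)).trans (Finset.dvd_prod_of_mem (fun i => M (σ i) i) (Finset.mem_univ j))

theorem linearIndependent_iterate_sysDer (Y : Fin 3 → PowerSeries ℂ) (w s t : PowerSeries ℂ)
    (hY0 : Y 0 = PowerSeries.X * w) (hw : PowerSeries.constantCoeff w ≠ 0)
    (hY1 : Y 1 = s * Y 0) (hY2 : Y 2 = t * Y 0) (P : Pol ℂ Unit) (hP : P ≠ 0) (n N T M : ℕ)
    (hn : (toPoly ℂ Unit P).natDegree ≤ n) (hN : P.totalDegree ≤ N)
    (hT : ∀ k, PowerSeries.X ^ T ∣ subst Y ((sysDer ℂ Unit)^[k] P))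
    (hM : (M - 1) * (n + M) + M * N < T) :
    LinearIndependent (Polynomial ℂ) fun k : Fin M => (sysDer ℂ Unit)^[k] P := by
  by_contra hcon
  obtain ⟨m, hm, hli, a, b, hb, hab⟩ :=
    exists_minimal_relation (fun k => (sysDer ℂ Unit)^[k] P) hP M hcon
  obtain ⟨c, Q₀, hQ, hc, hQ₀, hU, hV, hcd, hQd⟩ := exists_invariant m P n hn hli a b hb hab
  obtain ⟨x, hx⟩ : ∃ x : Fin (m + 1) × Fin 3 → ℂ, eval x (X (0, 0) * Q₀) ≠ 0 := by
    by_contra! h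
    have := MvPolynomial.funext (p := X ((0 : Fin (m + 1)), (0 : Fin 3)) * Q₀) (q := 0)
      fun x => by simpa using h x
    exact mul_ne_zero (X_ne_zero _) hQ₀ this
  rw [map_mul, eval_X] at hx
  have hx0 : x (0, 0) ≠ 0 := left_ne_zero_of_mul hx
  have hxQ := right_ne_zero_of_mul hx
  obtain ⟨x', hx'⟩ : ∃ x' : Fin (m + 1) × Fin 3 → ℂ, x' = fun q =>
    x q - ![0, x (0, 1) / x (0, 0), x (0, 2) / x (0, 0)] q.2 * x (q.1, 0) := ⟨_, rfl⟩
  have hx'Q : aeval x' Q₀ ≠ 0 := by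
    rw [hx', ← aeval_eq_aeval_of_linDer_eq_zero Q₀ hU hV x]
    rwa [← coe_aeval_eq_eval] at hxQ
  have hx1 : x' (0, 1) = 0 := by simp [hx', hx0]
  have hx2 : x' (0, 2) = 0 := by simp [hx', hx0]
  set G : Fin (m + 1) × Fin 3 → PowerSeries ℂ := fun q => if q.1 = 0 then Y q.2 else
    algebraMap ℂ _ (x' q) + ![0, s, t] q.2 * algebraMap ℂ _ (x' (q.1, 0)) with hG
  set ev : Pol ℂ (Fin (m + 1)) →+* PowerSeries ℂ :=
    eval₂Hom Polynomial.coeToPowerSeries.ringHom G with hev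
  have hdvd : PowerSeries.X ^ T ∣ ev (copyDet (m + 1) P) := by
    rw [copyDet, RingHom.map_det]
    refine dvd_det_of_dvd_col _ 0 _ fun i => ?_
    rw [RingHom.mapMatrix_apply, Matrix.map_apply, Matrix.of_apply]
    convert hT i using 1
    rw [hev, coe_eval₂Hom, eval₂_rename]
    rfl
  have hev0 : ev (map Polynomial.C Q₀) = aeval G Q₀ := by
    rw [hev, coe_eval₂Hom, eval₂_map, aeval_def]
    congr 1
    ext a
    simp
  have hevc : ev (C c) = (c : PowerSeries ℂ) := by simp [hev]
  rw [hQ, map_mul, hevc, hev0] at hdvd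
  have hdvd2 := X_pow_dvd_of_dvd_coe_mul hc hdvd
  rw [aeval_eq_aeval_of_linDer_eq_zero Q₀ hU hV G s t] at hdvd2
  set p : Polynomial ℂ := aeval (fun q : Fin (m + 1) × Fin 3 =>
    if q = (0, 0) then Polynomial.X else Polynomial.C (x' q)) Q₀ with hp
  have hp0 : p ≠ 0 := by
    intro h
    apply hx'Q
    have h1 := congrArg (Polynomial.aeval (x' (0, 0))) h
    rw [hp, MvPolynomial.comp_aeval_apply, map_zero] at h1
    rw [← h1]
    congr 2
    funext q
    split_ifs with hq <;> simp [hq]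
  have hpd : p.natDegree ≤ Q₀.totalDegree := by
    have := aeval_natDegree_le Q₀ (n := 1) (f := fun q : Fin (m + 1) × Fin 3 =>
      if q = (0, 0) then Polynomial.X else Polynomial.C (x' q)) le_rfl ?_
    · simpa using this
    · intro q
      split_ifs <;> simp
  have hpe : Polynomial.aeval (PowerSeries.X * w) p =
      aeval (fun q => G q - ![0, s, t] q.2 * G (q.1, 0)) Q₀ := by
    rw [hp, MvPolynomial.comp_aeval_apply]
    congr 2
    funext q
    obtain ⟨j, i⟩ := q
    by_cases hj : j = 0
    · subst hj
      fin_cases i <;> simp [hG, hY0, hY1, hY2, hx1, hx2]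
    · fin_cases i <;> simp [hG, hj, PowerSeries.C_eq_algebraMap]
  rw [← hpe] at hdvd2
  refine not_X_pow_dvd_aeval hp0 hw ?_ hdvd2
  have h1 : (m + 1) * (n + m) ≤ (M - 1) * (n + M) := Nat.mul_le_mul (by omega) (by omega)
  have h2 : (m + 1) * P.totalDegree ≤ M * N := Nat.mul_le_mul (by omega) hN
  omega

end Independence

/-! ### The Apéry numbers -/

section Apery

/-- The Apéry numbers for `ζ(2)`. -/
def apery (n : ℕ) : ℕ := ∑ k ∈ Finset.range (n + 1), (n.choose k) ^ 2 * ((n + k).choose n)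

/-- The summand of the Apéry numbers. -/
def aperyTerm (n k : ℕ) : ℚ := (n.choose k : ℚ) ^ 2 * ((n + k).choose n : ℚ)

/-- The Zeilberger certificate. -/
def aperyCert (n k : ℕ) : ℚ :=
  ((k : ℚ) ^ 2 + 3 * (2 * n + 1) * k - 11 * n ^ 2 - 9 * n - 2) * aperyTerm n k

lemma aperyTerm_eq_zero {n k : ℕ} (h : n < k) : aperyTerm n k = 0 := by
  simp [aperyTerm, Nat.choose_eq_zero_of_lt h]

lemma aperyTerm_add (k j : ℕ) :
    aperyTerm (k + j) k = (k + j)! * (k + j + k)! / (k ! ^ 3 * j ! ^ 2) := by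
  rw [aperyTerm, Nat.cast_add_choose, Nat.cast_add_choose]
  field_simp

lemma aperyTerm_succ (n k : ℕ) (hk : k ≤ n + 2) :
    ((n : ℚ) + 2) ^ 2 * aperyTerm (n + 2) (k + 1) -
      (11 * ((n : ℚ) + 1) ^ 2 + 11 * (n + 1) + 3) * aperyTerm (n + 1) (k + 1) -
      ((n : ℚ) + 1) ^ 2 * aperyTerm n (k + 1) =
    aperyCert (n + 1) (k + 1) - aperyCert (n + 1) k := by
  unfold aperyCert
  have hdiag : ∀ m : ℕ, aperyTerm m m = m ! * (m + m)! / m ! ^ 3 := fun m => by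
    simpa using aperyTerm_add m 0
  rcases (by omega : k + 1 ≤ n ∨ k = n ∨ k = n + 1 ∨ k = n + 2) with h | rfl | rfl | rfl
  · obtain ⟨j, rfl⟩ := exists_add_of_le h
    rw [show k + 1 + j + 2 = (k + 1) + (j + 2) by ring, aperyTerm_add,
      show k + 1 + j + 1 = (k + 1) + (j + 1) by ring, aperyTerm_add, aperyTerm_add,
      show k + 1 + (j + 1) = k + (j + 2) by ring, aperyTerm_add,
      show k + 1 + (j + 2) + (k + 1) = 2 * k + j + 1 + 1 + 1 + 1 by ring,
      show k + 1 + (j + 2) = k + j + 1 + 1 + 1 by ring,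
      show k + (j + 2) + (k + 1) = 2 * k + j + 1 + 1 + 1 by ring,
      show k + (j + 2) = k + j + 1 + 1 by ring,
      show k + 1 + j + (k + 1) = 2 * k + j + 1 + 1 by ring,
      show k + j + 1 + 1 + k = 2 * k + j + 1 + 1 by ring,
      show k + 1 + j = k + j + 1 by ring]
    simp only [Nat.factorial_succ]
    push_cast
    field_simp
    ring
  · rw [aperyTerm_eq_zero (show k < k + 1 by omega),
      show k + 2 = (k + 1) + 1 by ring, aperyTerm_add (k + 1) 1, aperyTerm_add k 1,
      hdiag (k + 1),
      show k + 1 + 1 + (k + 1) = 2 * k + 1 + 1 + 1 by ring,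
      show k + 1 + (k + 1) = 2 * k + 1 + 1 by ring,
      show k + 1 + k = 2 * k + 1 by ring]
    simp only [Nat.factorial_succ]
    push_cast
    field_simp
    ring
  · rw [aperyTerm_eq_zero (show n < n + 1 + 1 by omega),
      aperyTerm_eq_zero (show n + 1 < n + 1 + 1 by omega),
      show n + 1 + 1 = n + 2 by ring, hdiag (n + 2), hdiag (n + 1),
      show n + 2 + (n + 2) = 2 * n + 1 + 1 + 1 + 1 by ring,
      show n + 1 + (n + 1) = 2 * n + 1 + 1 by ring, show n + 2 = n + 1 + 1 by ring]
    simp only [Nat.factorial_succ]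
    push_cast
    field_simp
    ring
  · simp [aperyTerm_eq_zero]

lemma apery_eq_sum (n m : ℕ) (h : n < m) : (apery n : ℚ) = ∑ k ∈ Finset.range m, aperyTerm n k := by
  rw [← Finset.sum_subset (Finset.range_mono h)]
  · simp [apery, aperyTerm]
  · intro k _ hk
    exact aperyTerm_eq_zero (by simpa using hk)

lemma apery_succ_succ (n : ℕ) : ((n : ℤ) + 2) ^ 2 * apery (n + 2) =
    (11 * ((n : ℤ) + 1) ^ 2 + 11 * (n + 1) + 3) * apery (n + 1) + ((n : ℤ) + 1) ^ 2 * apery n := by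
  have h : ((n : ℚ) + 2) ^ 2 * apery (n + 2) -
      (11 * ((n : ℚ) + 1) ^ 2 + 11 * (n + 1) + 3) * apery (n + 1) -
      ((n : ℚ) + 1) ^ 2 * apery n = 0 := by
    rw [apery_eq_sum _ (n + 3 + 1) (by omega), apery_eq_sum (n + 1) (n + 3 + 1) (by omega),
      apery_eq_sum n (n + 3 + 1) (by omega)]
    simp only [Finset.mul_sum]
    rw [← Finset.sum_sub_distrib, ← Finset.sum_sub_distrib, Finset.sum_range_succ',
      Finset.sum_congr rfl fun k hk => aperyTerm_succ n k (by
        have := Finset.mem_range.mp hk; omega),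
      Finset.sum_range_sub]
    simp only [aperyCert, aperyTerm_eq_zero (show n + 1 < n + 3 by omega)]
    simp [aperyTerm]
    ring
  have h' : ((n : ℚ) + 2) ^ 2 * apery (n + 2) = (11 * ((n : ℚ) + 1) ^ 2 + 11 * (n + 1) + 3) *
      apery (n + 1) + ((n : ℚ) + 1) ^ 2 * apery n := by linear_combination h
  exact_mod_cast h'

lemma apery_le (n : ℕ) : apery n ≤ 16 ^ n := by
  calc apery n ≤ ∑ k ∈ Finset.range (n + 1), n.choose k * (2 ^ n * 4 ^ n) := by
        refine Finset.sum_le_sum fun k hk => ?_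
        have hk' : k ≤ n := Nat.lt_succ_iff.mp (Finset.mem_range.mp hk)
        rw [sq, mul_assoc]
        refine Nat.mul_le_mul le_rfl (Nat.mul_le_mul (Nat.choose_le_two_pow n k) ?_)
        refine (Nat.choose_le_two_pow _ _).trans ?_
        rw [show 4 = 2 ^ 2 by norm_num, ← pow_mul]
        exact Nat.pow_le_pow_right (by norm_num) (by omega)
    _ = 16 ^ n := by
        rw [← Finset.sum_mul, Nat.sum_range_choose, ← mul_pow, ← mul_pow]
        norm_num

/-- The integer numerators of the coefficients of the solution of the system. -/
def aperySol (n : ℕ) : Fin 3 → ℤ :=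
  ![n * apery (n - 1), n * apery n - 3 * (n * apery (n - 1)),
    (n + 1) * apery (n + 1) - 3 * apery n - 8 * (n * apery n) - 5 * (n * apery (n - 1))]

lemma aperySol_zero : aperySol 0 = 0 := by
  have h0 : apery 0 = 1 := by decide
  have h1 : apery 1 = 3 := by decide
  ext i
  fin_cases i <;> simp [aperySol, h0, h1]

lemma aperySol_succ (n : ℕ) (i : Fin 3) : ((n : ℤ) + 1) * aperySol (n + 1) i =
    (n + 1) * ∑ j, matA ℤ i j * aperySol n j + ∑ j, matB ℤ i j * aperySol (n + 1) j := by
  have h0 : apery 0 = 1 := by decide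
  have h1 : apery 1 = 3 := by decide
  have h2 : apery 2 = 19 := by decide
  simp only [Fin.sum_univ_three]
  obtain _ | n := n
  · fin_cases i <;> simp [aperySol, matA, matB, h0, h1, h2]
  have h := apery_succ_succ (n + 1)
  push_cast at h
  fin_cases i <;> simp [aperySol, matA, matB]
  · ring
  · exact Or.inl (by ring)
  · linear_combination h

lemma abs_aperySol_le (n : ℕ) (i : Fin 3) : |aperySol n i| ≤ 32 * 32 ^ n := by
  have h1 : (n : ℤ) + 1 ≤ 2 ^ n := by exact_mod_cast Nat.lt_two_pow_self
  have ha : (apery n : ℤ) ≤ 16 ^ n := by exact_mod_cast apery_le n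
  have hb : (apery (n - 1) : ℤ) ≤ 16 ^ n := by
    exact_mod_cast (apery_le _).trans (Nat.pow_le_pow_right (by norm_num) (by omega))
  have hc : (apery (n + 1) : ℤ) ≤ 16 * 16 ^ n := by
    rw [← pow_succ']
    exact_mod_cast apery_le (n + 1)
  have h32 : (32 : ℤ) ^ n = 2 ^ n * 16 ^ n := by rw [← mul_pow]; norm_num
  have hn : (0 : ℤ) ≤ n := by positivity
  have h16 : (0 : ℤ) ≤ 16 ^ n := by positivity
  have hm : ((n : ℤ) + 1) * 16 ^ n ≤ 32 ^ n := by
    rw [h32]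
    exact mul_le_mul_of_nonneg_right h1 h16
  have ha' := mul_le_mul_of_nonneg_left ha hn
  have hb' := mul_le_mul_of_nonneg_left hb hn
  have hc' := mul_le_mul_of_nonneg_left hc (by omega : (0 : ℤ) ≤ n + 1)
  have ha0 : (0 : ℤ) ≤ n * apery n := by positivity
  have hb0 : (0 : ℤ) ≤ n * apery (n - 1) := by positivity
  have hc0 : (0 : ℤ) ≤ (n + 1) * apery (n + 1) := by positivity
  rw [abs_le]
  fin_cases i <;> simp only [aperySol, Fin.zero_eta, Fin.mk_one, Fin.reduceFinMk,
    Matrix.cons_val] <;> constructor <;> nlinarith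

/-- The power series solution of the system. -/
def aperySeries (i : Fin 3) : PowerSeries ℂ := PowerSeries.mk fun n => (aperySol n i : ℂ) / n !

lemma coeff_aperySeries (i : Fin 3) (n : ℕ) :
    PowerSeries.coeff n (aperySeries i) = (aperySol n i : ℂ) / n ! := by
  simp [aperySeries]

lemma constantCoeff_aperySeries (i : Fin 3) : PowerSeries.constantCoeff (aperySeries i) = 0 := by
  rw [← PowerSeries.coeff_zero_eq_constantCoeff_apply, coeff_aperySeries, aperySol_zero]
  simp

/-- The unit part of the first component of the solution. -/
def aperyUnit : PowerSeries ℂ := PowerSeries.mk fun n => (apery n : ℂ) / n !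

lemma aperySeries_zero : aperySeries 0 = PowerSeries.X * aperyUnit := by
  ext n
  rw [coeff_aperySeries]
  obtain _ | n := n
  · simp [aperySol_zero]
  · rw [PowerSeries.coeff_succ_X_mul, aperyUnit, PowerSeries.coeff_mk, aperySol]
    have : ((n : ℂ) + 1) ≠ 0 := by exact_mod_cast n.succ_ne_zero
    have h2 : (n ! : ℂ) ≠ 0 := by exact_mod_cast n.factorial_ne_zero
    simp only [Matrix.cons_val_zero, Nat.factorial_succ, Nat.add_sub_cancel]
    push_cast
    field_simp

lemma constantCoeff_aperyUnit : PowerSeries.constantCoeff aperyUnit ≠ 0 := by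
  have h0 : apery 0 = 1 := by decide
  rw [← PowerSeries.coeff_zero_eq_constantCoeff_apply, aperyUnit, PowerSeries.coeff_mk]
  simp [h0]

lemma exists_aperySeries_eq_mul (i : Fin 3) : ∃ s, aperySeries i = s * aperySeries 0 := by
  obtain ⟨G, hG⟩ := PowerSeries.X_dvd_iff.mpr (constantCoeff_aperySeries i)
  obtain ⟨u, hu⟩ : IsUnit aperyUnit := by
    rw [PowerSeries.isUnit_iff_constantCoeff, isUnit_iff_ne_zero]
    exact constantCoeff_aperyUnit
  refine ⟨G * (u⁻¹ : (PowerSeries ℂ)ˣ), ?_⟩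
  rw [aperySeries_zero, ← hu, hG, mul_comm PowerSeries.X (u : PowerSeries ℂ), mul_assoc,
    Units.inv_mul_cancel_left, mul_comm]

/-- The Euler derivation on power series. -/
def euler : Derivation ℤ (PowerSeries ℂ) (PowerSeries ℂ) :=
  ((PowerSeries.X : PowerSeries ℂ) • PowerSeries.derivative ℂ).restrictScalars ℤ

lemma coeff_euler (F : PowerSeries ℂ) (n : ℕ) :
    PowerSeries.coeff n (euler F) = n * PowerSeries.coeff n F := by
  change PowerSeries.coeff n (PowerSeries.X * PowerSeries.derivative ℂ F) = _
  obtain _ | n := n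
  · simp
  · rw [PowerSeries.coeff_succ_X_mul, PowerSeries.coeff_derivative]
    push_cast
    ring

lemma coeff_iterate_euler (F : PowerSeries ℂ) (n k : ℕ) :
    PowerSeries.coeff n (euler^[k] F) = (n : ℂ) ^ k * PowerSeries.coeff n F := by
  induction k with
  | zero => simp
  | succ k ih => rw [Function.iterate_succ_apply', coeff_euler, ih]; ring

lemma euler_aperySeries (i : Fin 3) : euler (aperySeries i) =
    subst aperySeries (sysDer ℂ Unit (X ((), i))) := by
  have hA : ∀ i j, ((matA ℤ i j : ℤ) : ℂ) = matA ℂ i j := by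
    intro i j; fin_cases i <;> fin_cases j <;> simp [matA]
  have hB : ∀ i j, ((matB ℤ i j : ℤ) : ℂ) = matB ℂ i j := by
    intro i j; fin_cases i <;> fin_cases j <;> simp [matB]
  have h : subst aperySeries (sysDer ℂ Unit (X ((), i))) = ∑ k,
      (PowerSeries.X * PowerSeries.C (matA ℂ i k) + PowerSeries.C (matB ℂ i k)) *
        aperySeries k := by
    simp [subst, mul_comm PowerSeries.X]
  rw [h]
  ext n
  rw [coeff_euler, coeff_aperySeries, map_sum]
  simp only [add_mul, mul_assoc, map_add, PowerSeries.coeff_C_mul, coeff_aperySeries]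
  obtain _ | n := n
  · simp [aperySol_zero]
  · simp only [PowerSeries.coeff_succ_X_mul, PowerSeries.coeff_C_mul, coeff_aperySeries]
    have := congrArg (Int.cast : ℤ → ℂ) (aperySol_succ n i)
    push_cast at this
    simp only [hA, hB, Fin.sum_univ_three] at this
    have h1 : ((n : ℂ) + 1) ≠ 0 := by exact_mod_cast n.succ_ne_zero
    have h2 : (n ! : ℂ) ≠ 0 := by exact_mod_cast n.factorial_ne_zero
    simp only [Fin.sum_univ_three, Nat.factorial_succ]
    push_cast
    field_simp
    linear_combination this

lemma euler_subst (p : Pol ℂ Unit) :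
    euler (subst aperySeries p) = subst aperySeries (sysDer ℂ Unit p) := by
  refine derivation_comp_eq (subst aperySeries) euler (fun r => ?_) ?_ (fun s => ?_) p
  · ext n
    rw [coeff_euler]
    obtain _ | n := n <;> simp [subst, PowerSeries.coeff_C]
  · ext n
    rw [coeff_euler]
    simp +contextual [subst, PowerSeries.coeff_X]
  · obtain ⟨⟨⟩, i⟩ := s
    rw [← euler_aperySeries]
    simp [subst]

lemma iterate_euler_subst (p : Pol ℂ Unit) (k : ℕ) :
    euler^[k] (subst aperySeries p) = subst aperySeries ((sysDer ℂ Unit)^[k] p) := by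
  induction k with
  | zero => simp
  | succ k ih => rw [Function.iterate_succ_apply', ih, euler_subst, Function.iterate_succ_apply']

end Apery

/-! ### Spanning the monomials at an algebraic point -/

section Span

/-- The exponents of total degree at most `N`. -/
abbrev Mon (σ : Type) (N : ℕ) : Type := {m : σ →₀ ℕ // m.degree ≤ N}

instance {σ : Type} [Finite σ] (N : ℕ) : Finite (Mon σ N) := Finsupp.finite_of_degree_le N

instance {σ : Type} [Finite σ] (N : ℕ) : Fintype (Mon σ N) := Fintype.ofFinite _

lemma eq_sum_mon {σ : Type} [Finite σ] {A : Type*} [CommRing A] {N : ℕ} (p : MvPolynomial σ A)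
    (hp : p.totalDegree ≤ N) : p = ∑ m : Mon σ N, monomial m.1 (coeff m.1 p) := by
  classical
  have h1 : p.support ⊆ (Finset.univ : Finset (Mon σ N)).image Subtype.val := by
    intro m hm
    rw [Finset.mem_image]
    exact ⟨⟨m, (le_totalDegree hm).trans hp⟩, Finset.mem_univ _, rfl⟩
  conv_lhs => rw [p.as_sum]
  rw [Finset.sum_subset h1, Finset.sum_image fun x _ y _ h => Subtype.ext h]
  intro m _ hm
  rw [notMem_support_iff.mp hm, monomial_zero]

lemma mem_span_of_mul_mem_span (α : ℂ) (hα : α ≠ 0) (P : Pol ℂ Unit) (τ : ℕ) :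
    ∀ (j : ℕ) (G : Pol ℂ Unit), C ((Polynomial.X - Polynomial.C α) ^ τ) * G ∈
      Submodule.span (Polynomial ℂ) ((fun k => (sysDer ℂ Unit)^[k] P) '' Set.Iic j) →
    map (Polynomial.evalRingHom α) G ∈ Submodule.span ℂ
      ((fun k => map (Polynomial.evalRingHom α) ((sysDer ℂ Unit)^[k] P)) '' Set.Iic (j + τ)) := by
  induction τ with
  | zero =>
    intro j G hG
    rw [pow_zero, C_1, one_mul] at hG
    induction hG using Submodule.span_induction with
    | mem x hx =>
      obtain ⟨k, hk, rfl⟩ := hx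
      exact Submodule.subset_span ⟨k, by simpa using hk, rfl⟩
    | zero => simp
    | add x y _ _ hx hy => rw [map_add]; exact add_mem hx hy
    | smul a x _ hx =>
      rw [smul_eq_C_mul, map_mul, map_C, ← smul_eq_C_mul]
      exact Submodule.smul_mem _ _ hx
  | succ τ ih =>
    intro j G hG
    have hstep : ∀ x ∈ Submodule.span (Polynomial ℂ)
        ((fun k => (sysDer ℂ Unit)^[k] P) '' Set.Iic j), sysDer ℂ Unit x ∈
        Submodule.span (Polynomial ℂ) ((fun k => (sysDer ℂ Unit)^[k] P) '' Set.Iic (j + 1)) := by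
      intro x hx
      induction hx using Submodule.span_induction with
      | mem x hx =>
        obtain ⟨k, hk, rfl⟩ := hx
        refine Submodule.subset_span ⟨k + 1, by simpa using hk, ?_⟩
        exact Function.iterate_succ_apply' _ _ _
      | zero => simp
      | add x y _ _ hx hy => rw [map_add]; exact add_mem hx hy
      | smul a x hx' hx =>
        rw [smul_eq_C_mul, Derivation.leibniz, sysDer_C, smul_eq_mul, smul_eq_mul,
          mul_comm x, ← smul_eq_C_mul, ← smul_eq_C_mul]
        refine add_mem (Submodule.smul_mem _ _ hx) (Submodule.smul_mem _ _ ?_)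
        exact Submodule.span_mono (Set.image_mono (Set.Iic_subset_Iic.mpr (by omega))) hx'
    have h1 := hstep _ hG
    have h2 : sysDer ℂ Unit (C ((Polynomial.X - Polynomial.C α) ^ (τ + 1)) * G) =
        C ((Polynomial.X - Polynomial.C α) ^ τ) * (C (Polynomial.C ((τ : ℂ) + 1) * Polynomial.X) *
          G +
          C (Polynomial.X - Polynomial.C α) * sysDer ℂ Unit G) := by
      rw [Derivation.leibniz, sysDer_C, Polynomial.derivative_X_sub_C_pow]
      simp only [smul_eq_mul, map_mul, map_pow, Nat.add_sub_cancel, Nat.cast_add, Nat.cast_one,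
        map_add, map_natCast, map_one]
      ring
    rw [h2] at h1
    have h3 := ih (j + 1) _ h1
    have h4 : map (Polynomial.evalRingHom α) (C (Polynomial.C ((τ : ℂ) + 1) * Polynomial.X) * G +
          C (Polynomial.X - Polynomial.C α) * sysDer ℂ Unit G) =
        (((τ : ℂ) + 1) * α) • map (Polynomial.evalRingHom α) G := by
      simp only [map_add, map_mul, map_sub, map_C, smul_eq_C_mul]
      simp
    rw [h4] at h3
    have h5 : ((τ : ℂ) + 1) * α ≠ 0 := mul_ne_zero (by exact_mod_cast τ.succ_ne_zero) hα
    have h6 := Submodule.smul_mem _ (((τ : ℂ) + 1) * α)⁻¹ h3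
    rwa [smul_smul, inv_mul_cancel₀ h5, one_smul, show j + 1 + τ = j + (τ + 1) by ring] at h6

lemma coeff_coeff_toPoly {R J : Type*} [CommRing R] (p : Pol R J) (m : J × Fin 3 →₀ ℕ) (i : ℕ) :
    coeff m ((toPoly R J p).coeff i) = (coeff m p).coeff i := by
  induction p using MvPolynomial.induction_on' with
  | monomial u a =>
    induction a using Polynomial.induction_on' with
    | add p q hp hq => simp only [map_add, Polynomial.coeff_add, coeff_add, hp, hq]
    | monomial n a =>
      have h : toPoly R J (monomial u (Polynomial.monomial n a)) =
          Polynomial.monomial n (monomial u a) := by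
        rw [monomial_eq, map_mul, ← Polynomial.C_mul_X_pow_eq_monomial]
        simp only [toPoly, map_finsuppProd, map_pow, coe_eval₂Hom, eval₂_C, eval₂_X]
        simp only [Polynomial.coe_mapRingHom, Polynomial.map_mul, Polynomial.map_pow,
          Polynomial.map_X, Polynomial.map_C]
        rw [mul_right_comm, ← Polynomial.C_mul_X_pow_eq_monomial, monomial_eq (s := u), map_mul,
          map_finsuppProd]
        simp
      rw [h]
      classical
      simp only [Polynomial.coeff_monomial, coeff_monomial]
      split_ifs <;> simp [Polynomial.coeff_monomial, *]
  | add p q hp hq => simp only [map_add, Polynomial.coeff_add, coeff_add, hp, hq]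

lemma natDegree_coeff_le {R J : Type*} [CommRing R] (p : Pol R J) (m : J × Fin 3 →₀ ℕ) :
    (coeff m p).natDegree ≤ (toPoly R J p).natDegree := by
  rw [Polynomial.natDegree_le_iff_coeff_eq_zero]
  intro i hi
  rw [← coeff_coeff_toPoly, Polynomial.coeff_eq_zero_of_natDegree_lt hi, coeff_zero]

theorem monomial_mem_span (α : ℂ) (hα : α ≠ 0) (Y : Fin 3 → PowerSeries ℂ) (P : Pol ℂ Unit)
    (n N T M K : ℕ) (hM : M = Fintype.card (Mon (Unit × Fin 3) N))
    (hn : (toPoly ℂ Unit P).natDegree ≤ n) (hN : P.totalDegree ≤ N)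
    (hT : ∀ k, PowerSeries.X ^ T ∣ subst Y ((sysDer ℂ Unit)^[k] P))
    (hli : LinearIndependent (Polynomial ℂ) fun k : Fin M => (sysDer ℂ Unit)^[k] P)
    (hK : M + M * (n + M) ≤ K + 1 + T) (m : Mon (Unit × Fin 3) N) :
    monomial m.1 1 ∈ Submodule.span ℂ
      ((fun k => map (Polynomial.evalRingHom α) ((sysDer ℂ Unit)^[k] P)) '' Set.Iic K) := by
  classical
  obtain ⟨e⟩ : Nonempty (Mon (Unit × Fin 3) N ≃ Fin M) := ⟨Fintype.equivFinOfCardEq hM.symm⟩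
  set Q : Matrix (Mon (Unit × Fin 3) N) (Mon (Unit × Fin 3) N) (Polynomial ℂ) :=
    Matrix.of fun k m => coeff m.1 ((sysDer ℂ Unit)^[e k] P) with hQ
  have hdeg : ∀ k, ((sysDer ℂ Unit)^[k] P).totalDegree ≤ N := fun k =>
    (totalDegree_iterate_sysDer_le _ _).trans hN
  have hdet : Q.det ≠ 0 := by
    intro h0
    obtain ⟨v, hv0, hv⟩ := Matrix.exists_vecMul_eq_zero_iff.mpr h0
    have hsum : ∑ k, v k • (sysDer ℂ Unit)^[e k] P = 0 := by
      ext1 m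
      rw [coeff_sum, coeff_zero]
      by_cases hm : m.degree ≤ N
      · have := congrFun hv ⟨m, hm⟩
        simpa [Matrix.vecMul, dotProduct, hQ, coeff_smul] using this
      · refine Finset.sum_eq_zero fun k _ => ?_
        rw [coeff_smul, coeff_eq_zero_of_totalDegree_lt, smul_zero]
        exact (hdeg _).trans_lt (not_le.mp hm)
    have := Fintype.linearIndependent_iff.mp (hli.comp e e.injective) v hsum
    exact hv0 (funext this)
  have hnd : Q.det.natDegree ≤ M * (n + M) := by
    rw [hM]
    refine natDegree_det_le _ _ fun k m => (natDegree_coeff_le _ _).trans ?_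
    refine (natDegree_toPoly_iterate_sysDer_le _ n hn _).trans ?_
    have := (e k).isLt
    omega
  have hrow : ∀ m : Mon (Unit × Fin 3) N, C Q.det * monomial m.1 1 =
      ∑ k, Q.adjugate m k • (sysDer ℂ Unit)^[e k] P := by
    intro m
    have h1 : ∀ k, (sysDer ℂ Unit)^[e k] P = ∑ m', Q k m' • monomial m'.1 1 := by
      intro k
      conv_lhs => rw [eq_sum_mon _ (hdeg (e k))]
      refine Finset.sum_congr rfl fun m' _ => ?_
      rw [smul_monomial, smul_eq_mul, mul_one]
      rfl
    simp only [h1, Finset.smul_sum, smul_smul]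
    rw [Finset.sum_comm]
    simp only [← Finset.sum_smul, ← Matrix.mul_apply, Matrix.adjugate_mul]
    rw [Finset.sum_eq_single m]
    · simp [smul_eq_C_mul]
    · intro m' _ hm'
      simp [Matrix.one_apply_ne hm'.symm]
    · simp
  have hXT : (Polynomial.X : Polynomial ℂ) ^ T ∣ Q.det := by
    have h1 := congrArg (subst Y) (hrow ⟨0, by simp⟩)
    rw [map_sum] at h1
    have h2 : PowerSeries.X ^ T ∣ subst Y (C Q.det * monomial 0 1) := by
      rw [h1]
      refine Finset.dvd_sum fun k _ => ?_
      rw [smul_eq_C_mul, map_mul]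
      exact (hT _).mul_left _
    have h3 : subst Y (C Q.det * monomial 0 1) = (Q.det : PowerSeries ℂ) := by
      simp [subst]
    rw [h3, PowerSeries.X_pow_dvd_iff] at h2
    rw [Polynomial.X_pow_dvd_iff]
    intro d hd
    simpa using h2 d hd
  obtain ⟨G, hG, hG0⟩ := Polynomial.exists_eq_pow_rootMultiplicity_mul_and_not_dvd _ hdet α
  rw [Polynomial.dvd_iff_isRoot, Polynomial.IsRoot.def] at hG0
  set τ := Q.det.rootMultiplicity α
  have hXG : (Polynomial.X : Polynomial ℂ) ^ T ∣ G := by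
    rw [hG] at hXT
    refine (IsCoprime.pow ?_).dvd_of_dvd_mul_left hXT
    have := Polynomial.isCoprime_X_sub_C_of_isUnit_sub (a := (0 : ℂ)) (b := α) (by
      simpa using hα)
    simpa using this
  have hGne : G ≠ 0 := by rintro rfl; simp at hG0
  have hTG : T ≤ G.natDegree := by
    have := Polynomial.natDegree_le_of_dvd hXG hGne
    simpa using this
  have hτ : τ + T ≤ M * (n + M) := by
    refine le_trans ?_ hnd
    conv_rhs => rw [hG]
    rw [Polynomial.natDegree_mul (pow_ne_zero _ (Polynomial.X_sub_C_ne_zero α)) hGne,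
      Polynomial.natDegree_pow, Polynomial.natDegree_X_sub_C]
    omega
  have hmem := mem_span_of_mul_mem_span α hα P τ (M - 1) (C G * monomial m.1 1) (by
    rw [← mul_assoc, ← C_mul, ← hG, hrow]
    refine Submodule.sum_mem _ fun k _ => Submodule.smul_mem _ _
      (Submodule.subset_span ⟨e k, ?_, rfl⟩)
    have := (e k).isLt
    simp only [Set.mem_Iic]
    omega)
  have h5 : map (Polynomial.evalRingHom α) (C G * monomial m.1 1) =
      (G.eval α) • (monomial m.1 1 : MvPolynomial (Unit × Fin 3) ℂ) := by
    rw [map_mul, map_C, map_monomial, smul_eq_C_mul]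
    simp
  rw [h5] at hmem
  have h6 := Submodule.smul_mem _ (G.eval α)⁻¹ hmem
  rw [smul_smul, inv_mul_cancel₀ hG0, one_smul] at h6
  refine Submodule.span_mono (Set.image_mono (Set.Iic_subset_Iic.mpr ?_)) h6
  have : 0 < M := by rw [hM]; exact Fintype.card_pos_iff.mpr ⟨m⟩
  omega

end Span

/-! ### Bounds for the iterated derivatives -/

section Size

/-- `HasSize d N w p` expresses, dually, that `p` is a combination of the monomials `z ^ j * x ^ m`
with `j ≤ d` and `m.degree ≤ N` with sum of absolute values of the coefficients at most `w`. -/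
def HasSize (d N : ℕ) (w : ℝ) (p : Pol ℤ Unit) : Prop :=
  ∀ (F : Pol ℤ Unit →+ ℂ) (W : ℝ), (∀ j ≤ d, ∀ m : Unit × Fin 3 →₀ ℕ, m.degree ≤ N →
    ‖F (monomial m (Polynomial.X ^ j))‖ ≤ W) → ‖F p‖ ≤ w * W

variable {d d' N N' : ℕ} {w w' : ℝ} {p q : Pol ℤ Unit}

lemma hasSize_monomial (j : ℕ) (m : Unit × Fin 3 →₀ ℕ) :
    HasSize j m.degree 1 (monomial m (Polynomial.X ^ j)) := fun F W h => by
  simpa using h j le_rfl m le_rfl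

lemma HasSize.mono (h : HasSize d N w p) (hd : d ≤ d') (hN : N ≤ N') (hw : w ≤ w') :
    HasSize d' N' w' p := fun F W hF => by
  have hW : 0 ≤ W := (norm_nonneg _).trans (hF 0 (Nat.zero_le _) 0 (by simp))
  exact (h F W fun j hj m hm => hF j (hj.trans hd) m (hm.trans hN)).trans
    (mul_le_mul_of_nonneg_right hw hW)

lemma HasSize.add (hp : HasSize d N w p) (hq : HasSize d N w' q) :
    HasSize d N (w + w') (p + q) := fun F W hF => by
  rw [map_add, add_mul]
  exact (norm_add_le _ _).trans (add_le_add (hp F W hF) (hq F W hF))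

lemma hasSize_zero : HasSize d N 0 0 := fun F W _ => by simp

lemma HasSize.sum {ι : Type*} (s : Finset ι) (f : ι → Pol ℤ Unit) (w : ι → ℝ)
    (h : ∀ i ∈ s, HasSize d N (w i) (f i)) : HasSize d N (∑ i ∈ s, w i) (∑ i ∈ s, f i) := by
  classical
  induction s using Finset.induction_on with
  | empty => simpa using hasSize_zero
  | insert a s ha ih =>
    rw [Finset.sum_insert ha, Finset.sum_insert ha]
    exact (h a (by simp)).add (ih fun i hi => h i (Finset.mem_insert_of_mem hi))

lemma HasSize.zsmul (hp : HasSize d N w p) (c : ℤ) : HasSize d N (|c| * w) (c • p) :=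
  fun F W hF => by
    rw [map_zsmul, mul_assoc, zsmul_eq_mul, norm_mul, Complex.norm_intCast, Int.cast_abs]
    exact mul_le_mul_of_nonneg_left (hp F W hF) (abs_nonneg _)

lemma HasSize.mul (hp : HasSize d N w p) (hq : HasSize d' N' w' q) :
    HasSize (d + d') (N + N') (w * w') (p * q) := fun F W hF => by
  rw [mul_assoc]
  refine hp (F.comp (AddMonoidHom.mulRight q)) _ fun j hj m hm => ?_
  refine hq (F.comp (AddMonoidHom.mulLeft (monomial m (Polynomial.X ^ j))))
    _ fun j' hj' m' hm' => ?_
  simp only [AddMonoidHom.comp_apply, AddMonoidHom.coe_mulLeft, monomial_mul, ← pow_add]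
  refine hF _ (by omega) _ ?_
  rw [map_add]
  omega

lemma hasSize_sysDer_X (s : Unit × Fin 3) : HasSize 1 1 99 (sysDer ℤ Unit (X s)) := by
  have h0 : ∀ t : Unit × Fin 3, HasSize 1 1 1 (C Polynomial.X * X t : Pol ℤ Unit) := fun t => by
    have := hasSize_monomial 1 (Finsupp.single t 1)
    rw [Finsupp.degree_single, ← mul_one (Polynomial.X ^ 1), ← C_mul_monomial, pow_one] at this
    exact this
  have h1 : ∀ t : Unit × Fin 3, HasSize 1 1 1 (X t : Pol ℤ Unit) := fun t => by
    have := hasSize_monomial 0 (Finsupp.single t 1)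
    rw [Finsupp.degree_single, pow_zero] at this
    exact this.mono (by omega) le_rfl le_rfl
  have h2 : sysDer ℤ Unit (X s) = ∑ k, (matA ℤ s.2 k • (C Polynomial.X * X (s.1, k)) +
      matB ℤ s.2 k • X (s.1, k)) := by
    rw [sysDer_X]
    refine Finset.sum_congr rfl fun k _ => ?_
    rw [zsmul_eq_mul, zsmul_eq_mul]
    simp only [map_add, map_mul, ← map_intCast (C : Polynomial ℤ →+* Pol ℤ Unit),
      ← map_intCast (Polynomial.C : ℤ →+* Polynomial ℤ)]
    simp
    ring
  rw [h2]
  refine (HasSize.sum Finset.univ _ (fun k => |matA ℤ s.2 k| * 1 + |matB ℤ s.2 k| * 1)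
    fun k _ => ((h0 _).zsmul _).add ((h1 _).zsmul _)).mono le_rfl le_rfl ?_
  obtain ⟨⟨⟩, i⟩ := s
  fin_cases i <;> simp [Fin.sum_univ_three, matA, matB] <;> norm_num

lemma hasSize_sysDer_monomial_one (e : ℕ) : ∀ m : Unit × Fin 3 →₀ ℕ, m.degree = e →
    HasSize 1 e (99 * e) (sysDer ℤ Unit (monomial m 1)) := by
  induction e with
  | zero =>
    intro m hm
    rw [Finsupp.degree_eq_zero_iff] at hm
    subst hm
    simpa using hasSize_zero
  | succ e ih =>
    intro m hm
    have hs0 : m ≠ 0 := by rintro rfl; simp at hm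
    obtain ⟨i, hi⟩ := Finsupp.ne_iff.mp hs0
    have hle : Finsupp.single i 1 ≤ m := by
      rw [Finsupp.single_le_iff]
      exact Nat.one_le_iff_ne_zero.mpr hi
    obtain ⟨m, rfl⟩ := exists_add_of_le hle
    rw [map_add, Finsupp.degree_single] at hm
    have hm' : m.degree = e := by omega
    rw [← one_mul (1 : Polynomial ℤ), ← monomial_mul, Derivation.leibniz, smul_eq_mul, smul_eq_mul]
    have h1 := (hasSize_monomial 0 (Finsupp.single i 1)).mul (ih m hm')
    have h2 := (hasSize_monomial 0 m).mul (hasSize_sysDer_X i)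
    rw [Finsupp.degree_single, pow_zero] at h1
    rw [hm', pow_zero] at h2
    refine (HasSize.add (h1.mono (by omega) (by omega : _ ≤ e + 1) le_rfl)
      (h2.mono (by omega) le_rfl le_rfl)).mono
      le_rfl le_rfl ?_
    push_cast
    linarith

lemma HasSize.derivation (hp : HasSize d N w p) :
    HasSize (d + 1) N (w * (d + 99 * N)) (sysDer ℤ Unit p) := fun F W hF => by
  rw [mul_assoc]
  refine hp (F.comp (sysDer ℤ Unit : Pol ℤ Unit →ₗ[ℤ] Pol ℤ Unit).toAddMonoidHom) _
    fun j hj m hm => ?_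
  have h1 : (sysDer ℤ Unit) (monomial m (Polynomial.X ^ j)) =
      (j : ℤ) • monomial m (Polynomial.X ^ j) +
        monomial 0 (Polynomial.X ^ j) * sysDer ℤ Unit (monomial m 1) := by
    conv_lhs => rw [← mul_one (Polynomial.X ^ j), ← C_mul_monomial, Derivation.leibniz, sysDer_C]
    rw [smul_eq_mul, smul_eq_mul, mul_comm (monomial m 1), C_mul_monomial, add_comm]
    congr 1
    rw [Polynomial.derivative_X_pow, zsmul_eq_mul, ← map_intCast (C : Polynomial ℤ →+* Pol ℤ Unit),
      C_mul_monomial]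
    congr 1
    obtain _ | j := j
    · simp
    · simp only [Nat.add_sub_cancel]
      push_cast
      simp
      ring
  have h2 : HasSize (d + 1) N (d + 99 * N) (sysDer ℤ Unit (monomial m (Polynomial.X ^ j))) := by
    rw [h1]
    have h3 := (hasSize_monomial j 0).mul (hasSize_sysDer_monomial_one _ m rfl)
    refine (HasSize.add (((hasSize_monomial j m).zsmul j).mono (by omega) hm le_rfl)
      (h3.mono (by omega) (by simpa using hm) le_rfl)).mono le_rfl le_rfl ?_
    have h4 : (j : ℝ) ≤ d := by exact_mod_cast hj
    have h5 : (m.degree : ℝ) ≤ N := by exact_mod_cast hm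
    simp
    linarith
  exact h2 F W hF

lemma HasSize.iterate (hp : HasSize d N w p) (hw : 0 ≤ w) (k : ℕ) (hk : k ≤ d) :
    HasSize (d + k) N (w * (2 * d + 99 * N) ^ k) ((sysDer ℤ Unit)^[k] p) := by
  induction k with
  | zero => simpa using hp
  | succ k ih =>
    rw [Function.iterate_succ_apply']
    refine (ih (by omega)).derivation.mono (by omega) le_rfl ?_
    rw [pow_succ, ← mul_assoc]
    have : (k : ℝ) ≤ d := by exact_mod_cast (by omega : k ≤ d)
    refine mul_le_mul_of_nonneg_left ?_ (by positivity)
    push_cast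
    linarith

/-- Additive subgroups containing the images of the monomials contain the image of everything. -/
lemma map_mem_of_degree_le {A : Type*} [AddCommGroup A] (F : Pol ℤ Unit →+ A) (G : AddSubgroup A)
    (hF : ∀ j ≤ d, ∀ m : Unit × Fin 3 →₀ ℕ, m.degree ≤ N → F (monomial m (Polynomial.X ^ j)) ∈ G)
    (hd : (toPoly ℤ Unit p).natDegree ≤ d) (hN : p.totalDegree ≤ N) : F p ∈ G := by
  rw [eq_sum_mon p hN, map_sum]
  refine sum_mem fun m _ => ?_
  rw [(coeff m.1 p).as_sum_range' (d + 1)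
    (Nat.lt_succ_of_le ((natDegree_coeff_le p m.1).trans hd)), map_sum, map_sum]
  refine sum_mem fun j hj => ?_
  have h : (Polynomial.monomial j ((coeff m.1 p).coeff j) : Polynomial ℤ) =
      (coeff m.1 p).coeff j • Polynomial.X ^ j := by
    rw [Polynomial.smul_X_eq_monomial]
  rw [h, map_zsmul, map_zsmul]
  exact zsmul_mem (hF j (by simpa [Nat.lt_succ_iff] using hj) m.1 m.2) _

end Size

/-! ### The auxiliary function -/

section Siegel

/-- `F` is an exponential generating series of integers of geometric growth. -/
def IsIntExp (K C : ℝ) (F : PowerSeries ℂ) : Prop :=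
  ∃ y : ℕ → ℤ, ∀ n, PowerSeries.coeff n F = (y n : ℂ) / n ! ∧ |(y n : ℝ)| ≤ K * C ^ n

lemma isIntExp_one : IsIntExp 1 1 1 := by
  refine ⟨fun n => if n = 0 then 1 else 0, fun n => ?_⟩
  rw [PowerSeries.coeff_one]
  split_ifs with h <;> simp [h]

lemma IsIntExp.mul {K C K' C' : ℝ} {F G : PowerSeries ℂ} (hC : 0 ≤ C)
    (hF : IsIntExp K C F) (hG : IsIntExp K' C' G) : IsIntExp (K * K') (C + C') (F * G) := by
  obtain ⟨y, hy⟩ := hF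
  obtain ⟨x, hx⟩ := hG
  have hK : 0 ≤ K := by simpa using (abs_nonneg _).trans (hy 0).2
  refine ⟨fun n => ∑ ij ∈ Finset.HasAntidiagonal.antidiagonal n,
      (n.choose ij.1 : ℤ) * (y ij.1 * x ij.2),
    fun n => ⟨?_, ?_⟩⟩
  · rw [PowerSeries.coeff_mul]
    push_cast
    rw [Finset.sum_div]
    refine Finset.sum_congr rfl fun ij hij => ?_
    rw [Finset.HasAntidiagonal.mem_antidiagonal] at hij
    rw [(hy _).1, (hx _).1, ← hij, Nat.cast_add_choose]
    have h1 : ((ij.1 + ij.2)! : ℂ) ≠ 0 := by exact_mod_cast Nat.factorial_ne_zero _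
    have h2 : (ij.1 ! : ℂ) ≠ 0 := by exact_mod_cast Nat.factorial_ne_zero _
    have h3 : (ij.2 ! : ℂ) ≠ 0 := by exact_mod_cast Nat.factorial_ne_zero _
    field_simp
  · push_cast
    refine (Finset.abs_sum_le_sum_abs _ _).trans ?_
    rw [(Commute.all C C').add_pow', Finset.mul_sum]
    refine Finset.sum_le_sum fun ij _ => ?_
    rw [abs_mul, abs_mul, Nat.abs_cast, nsmul_eq_mul]
    calc (n.choose ij.1 : ℝ) * (|(y ij.1 : ℝ)| * |(x ij.2 : ℝ)|)
        ≤ n.choose ij.1 * ((K * C ^ ij.1) * (K' * C' ^ ij.2)) := by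
          refine mul_le_mul_of_nonneg_left ?_ (by positivity)
          exact mul_le_mul (hy _).2 (hx _).2 (abs_nonneg _) (by positivity)
      _ = _ := by ring

lemma isIntExp_aperySeries (i : Fin 3) : IsIntExp 32 32 (aperySeries i) :=
  ⟨fun n => aperySol n i, fun n => ⟨coeff_aperySeries i n, by exact_mod_cast abs_aperySol_le n i⟩⟩

lemma exists_isIntExp_monomial (m : Unit × Fin 3 →₀ ℕ) :
    ∃ K C : ℝ, 1 ≤ K ∧ 1 ≤ C ∧ IsIntExp K C (subst aperySeries (monomial m 1)) := by
  induction m using Finsupp.induction_linear with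
  | zero =>
    refine ⟨1, 1, le_rfl, le_rfl, ?_⟩
    have : (monomial 0 1 : Pol ℂ Unit) = 1 := rfl
    rw [this, map_one]
    exact isIntExp_one
  | add f g hf hg =>
    obtain ⟨K, C, hK, hC, h⟩ := hf
    obtain ⟨K', C', hK', hC', h'⟩ := hg
    refine ⟨K * K', C + C', by nlinarith, by linarith, ?_⟩
    rw [← one_mul (1 : Polynomial ℂ), ← monomial_mul, map_mul]
    exact h.mul (by linarith) h'
  | single s b =>
    induction b with
    | zero =>
      refine ⟨1, 1, le_rfl, le_rfl, ?_⟩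
      rw [Finsupp.single_zero]
      have : (monomial 0 1 : Pol ℂ Unit) = 1 := rfl
      rw [this, map_one]
      exact isIntExp_one
    | succ b ih =>
      obtain ⟨K, C, hK, hC, h⟩ := ih
      refine ⟨K * 32, C + 32, by linarith, by linarith, ?_⟩
      rw [Finsupp.single_add, ← one_mul (1 : Polynomial ℂ), ← monomial_mul, map_mul]
      refine h.mul (by linarith) ?_
      have : subst aperySeries (monomial (Finsupp.single s 1) 1) = aperySeries s.2 :=
        eval₂_X _ _ _
      rw [this]
      exact isIntExp_aperySeries _

lemma exists_int_vec_le {ι κ : Type*} [Fintype ι] [Fintype κ] (A : Matrix ι κ ℤ) (B : ℝ)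
    (hB : 1 ≤ B) (hA : ∀ i j, |(A i j : ℝ)| ≤ B) (E : ℕ) (h0 : 0 < Fintype.card ι)
    (hlt : Fintype.card ι < Fintype.card κ)
    (hE : Fintype.card ι ≤ E * (Fintype.card κ - Fintype.card ι)) :
    ∃ t : κ → ℤ, t ≠ 0 ∧ A.mulVec t = 0 ∧ ∀ j, |(t j : ℝ)| ≤ (Fintype.card κ * B) ^ E := by
  obtain ⟨t, ht0, ht, hle⟩ := Int.Matrix.exists_ne_zero_int_vec_norm_le A hlt h0
  refine ⟨t, ht0, ht, fun j => ?_⟩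
  have h1 : |(t j : ℝ)| ≤ ‖t‖ := by
    have := norm_le_pi_norm t j
    rwa [Int.norm_eq_abs] at this
  let _ : SeminormedAddCommGroup (Matrix ι κ ℤ) := Matrix.seminormedAddCommGroup
  have hA' : ‖A‖ ≤ B := by
    rw [Matrix.norm_le_iff (by linarith)]
    intro i j
    rw [Int.norm_eq_abs]
    exact hA i j
  have hκ : (1 : ℝ) ≤ Fintype.card κ := by exact_mod_cast (by omega : 1 ≤ Fintype.card κ)
  have hmax : max 1 ‖A‖ ≤ B := max_le hB hA'
  have hone : (1 : ℝ) ≤ max 1 ‖A‖ := le_max_left _ _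
  have hlt' : (0 : ℝ) < (Fintype.card κ : ℝ) - Fintype.card ι := by
    rw [sub_pos]; exact_mod_cast hlt
  refine h1.trans (hle.trans ?_)
  rw [← Real.rpow_natCast]
  refine (Real.rpow_le_rpow_of_exponent_le (y := (Fintype.card ι : ℝ) / _) (z := (E : ℝ))
    (by nlinarith) ?_).trans (Real.rpow_le_rpow (by positivity) ?_ (by positivity))
  · rw [div_le_iff₀ hlt', ← Nat.cast_sub hlt.le]
    exact_mod_cast hE
  · exact mul_le_mul_of_nonneg_left hmax (by positivity)

lemma card_bound (M l : ℕ) (hl : 1 ≤ l) : M * (2 * l + 1) ≤ (3 * M) ^ l := by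
  have h4 : 2 * l + 1 ≤ 3 ^ l := by
    induction l, hl using Nat.le_induction with
    | base => norm_num
    | succ l _ ih => rw [pow_succ]; omega
  rw [mul_pow, mul_comm]
  exact Nat.mul_le_mul h4 (Nat.le_self_pow (by omega) M)

lemma exists_int_combination {ι : Type*} [Fintype ι] [Nonempty ι] (y : ι → ℕ → ℤ) (K C : ℝ)
    (hK : 1 ≤ K) (hC : 1 ≤ C) (hy : ∀ i n, |(y i n : ℝ)| ≤ K * C ^ n) (l : ℕ) (hl : 1 ≤ l) :
    ∃ t : ι × Fin (2 * l + 1) → ℤ, t ≠ 0 ∧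
      (∀ ν < (2 * Fintype.card ι - 1) * l, ∑ c, t c * (ν.choose c.2 * y c.1 (ν - c.2)) = 0) ∧
      ∀ c, |(t c : ℝ)| ≤
        ((3 * Fintype.card ι * K * (2 * C) ^ (2 * Fintype.card ι)) ^ (2 * Fintype.card ι)) ^ l := by
  set M := Fintype.card ι with hM
  have hM1 : 1 ≤ M := Fintype.card_pos
  have hM1' : (1 : ℝ) ≤ M := by exact_mod_cast hM1
  set T := (2 * M - 1) * l with hT
  have hTM : T + l = 2 * M * l := by
    rw [hT, ← Nat.succ_mul]
    congr 1
    omega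
  have hcard : Fintype.card (ι × Fin (2 * l + 1)) = 2 * M * l + M := by
    rw [Fintype.card_prod, Fintype.card_fin, ← hM]
    ring
  have h2 : (1 : ℝ) ≤ (2 * C) ^ T := one_le_pow₀ (by linarith)
  have hA : ∀ (ν : Fin T) (c : ι × Fin (2 * l + 1)), |((Matrix.of
      fun (ν : Fin T) (c : ι × Fin (2 * l + 1)) => ((ν : ℕ).choose c.2 : ℤ) * y c.1 (ν - c.2))
      ν c : ℝ)| ≤ K * (2 * C) ^ T := by
    intro ν c
    simp only [Matrix.of_apply, Int.cast_mul, Int.cast_natCast, abs_mul, Nat.abs_cast]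
    calc (((ν : ℕ).choose c.2 : ℕ) : ℝ) * |(y c.1 (ν - c.2) : ℝ)|
        ≤ 2 ^ (ν : ℕ) * (K * C ^ (ν - c.2 : ℕ)) := by
          refine mul_le_mul ?_ (hy _ _) (abs_nonneg _) (by positivity)
          exact_mod_cast Nat.choose_le_two_pow _ _
      _ ≤ 2 ^ T * (K * C ^ T) := by
          have := ν.2
          gcongr
          · norm_num
          · omega
      _ = _ := by rw [mul_pow]; ring
  obtain ⟨t, ht0, ht, hle⟩ := exists_int_vec_le
    (Matrix.of fun (ν : Fin T) (c : ι × Fin (2 * l + 1)) =>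
      ((ν : ℕ).choose c.2 : ℤ) * y c.1 (ν - c.2)) (K * (2 * C) ^ T) (by nlinarith) hA (2 * M - 1)
    (by rw [Fintype.card_fin]; exact Nat.mul_pos (by omega) hl)
    (by rw [Fintype.card_fin, hcard]; omega)
    (by
      rw [Fintype.card_fin, hcard]
      exact Nat.mul_le_mul_left _ (by omega))
  refine ⟨t, ht0, fun ν hν => ?_, fun c => (hle c).trans ?_⟩
  · have := congrFun ht ⟨ν, hν⟩
    simp only [Matrix.mulVec, dotProduct, Matrix.of_apply, Pi.zero_apply] at this
    rw [← this]
    exact Finset.sum_congr rfl fun c _ => mul_comm _ _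
  · have hc2 : (1 : ℝ) ≤ 3 * M * K * (2 * C) ^ (2 * M) := by
      have : (1 : ℝ) ≤ (2 * C) ^ (2 * M) := one_le_pow₀ (by linarith)
      have : 1 ≤ 3 * M * K := by nlinarith
      nlinarith
    have h3 : ((Fintype.card (ι × Fin (2 * l + 1)) : ℕ) : ℝ) ≤ (3 * M) ^ l := by
      rw [Fintype.card_prod, Fintype.card_fin]
      exact_mod_cast card_bound M l hl
    rw [pow_right_comm _ (2 * M) l]
    refine (pow_le_pow_left₀ (by positivity) ?_ _).trans
      (pow_le_pow_right₀ (one_le_pow₀ hc2) (by omega : 2 * M - 1 ≤ 2 * M))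
    calc ((Fintype.card (ι × Fin (2 * l + 1)) : ℕ) : ℝ) * (K * (2 * C) ^ T)
        ≤ (3 * M) ^ l * (K ^ l * (2 * C) ^ (2 * M * l)) := by
          gcongr
          · exact le_self_pow₀ hK (by omega)
          · linarith
          · omega
      _ = _ := by rw [pow_mul, ← mul_pow, ← mul_pow, mul_assoc (3 * (M : ℝ))]

/-- The polynomial with prescribed integral coefficients on a box of monomials. -/
def comb {n N : ℕ} (a : Mon (Unit × Fin 3) N × Fin (n + 1) → ℤ) : Pol ℤ Unit :=
  ∑ c, a c • monomial c.1.1 (Polynomial.X ^ (c.2 : ℕ))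

variable {n N : ℕ} (a : Mon (Unit × Fin 3) N × Fin (n + 1) → ℤ)

lemma coeff_coeff_comb (m : Unit × Fin 3 →₀ ℕ) (i : ℕ) :
    (coeff m (comb a)).coeff i = ∑ c, if c.1.1 = m ∧ (c.2 : ℕ) = i then a c else 0 := by
  classical
  rw [comb, coeff_sum, Polynomial.finsetSum_coeff]
  refine Finset.sum_congr rfl fun c _ => ?_
  rw [coeff_smul, Polynomial.coeff_smul, coeff_monomial]
  by_cases h1 : c.1.1 = m
  · by_cases h2 : (c.2 : ℕ) = i
    · simp [h1, h2]
    · simp [h1, h2, Polynomial.coeff_X_pow, Ne.symm h2]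
  · simp [h1]

lemma comb_ne_zero (ha : a ≠ 0) : comb a ≠ 0 := by
  obtain ⟨c, hc⟩ := Function.ne_iff.mp ha
  intro h
  have h1 := coeff_coeff_comb a c.1.1 c.2
  rw [h, coeff_zero, Polynomial.coeff_zero, Finset.sum_eq_single c] at h1
  · exact hc (by simpa using h1.symm)
  · intro c' _ hne
    refine if_neg fun h2 => hne ?_
    exact Prod.ext (Subtype.ext h2.1) (Fin.ext h2.2)
  · simp

lemma natDegree_toPoly_comb_le : (toPoly ℤ Unit (comb a)).natDegree ≤ n := by
  rw [Polynomial.natDegree_le_iff_coeff_eq_zero]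
  intro i hi
  ext m
  rw [coeff_coeff_toPoly, coeff_coeff_comb, coeff_zero]
  refine Finset.sum_eq_zero fun c _ => if_neg fun h => ?_
  have := c.2.2
  omega

lemma totalDegree_comb_le : (comb a).totalDegree ≤ N := by
  refine totalDegree_finsetSum_le fun c _ => (totalDegree_smul_le _ _).trans ?_
  refine (totalDegree_monomial_le _ _).trans ?_
  exact c.1.2

lemma hasSize_comb (w : ℝ) (hw : ∀ c, |(a c : ℝ)| ≤ w) :
    HasSize n N (Fintype.card (Mon (Unit × Fin 3) N × Fin (n + 1)) * w) (comb a) := by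
  refine (HasSize.sum Finset.univ _ (fun c => |a c| * 1) fun c _ =>
    ((hasSize_monomial c.2 c.1.1).zsmul (a c)).mono (by have := c.2.2; omega) c.1.2
      le_rfl).mono le_rfl le_rfl ?_
  rw [← nsmul_eq_mul, ← Finset.card_univ]
  refine Finset.sum_le_card_nsmul _ _ _ fun c _ => ?_
  rw [mul_one]
  exact_mod_cast hw c

lemma coeff_subst_comb (y : Mon (Unit × Fin 3) N → ℕ → ℤ) (hy : ∀ m k, PowerSeries.coeff k
    (subst aperySeries (monomial m.1 1)) = (y m k : ℂ) / k !)
    (t : Mon (Unit × Fin 3) N × Fin (n + 1) → ℤ) (ν : ℕ) :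
    PowerSeries.coeff ν (subst aperySeries (map (Polynomial.mapRingHom (Int.castRingHom ℂ))
      (comb fun c => t c * (n ! / (c.2 : ℕ)! : ℕ)))) =
    (n ! : ℂ) / ν ! * ((∑ c, t c * (ν.choose c.2 * y c.1 (ν - c.2)) : ℤ) : ℂ) := by
  rw [comb, map_sum, map_sum, map_sum, Int.cast_sum, Finset.mul_sum]
  refine Finset.sum_congr rfl fun c _ => ?_
  obtain ⟨m, j⟩ := c
  simp only
  rw [map_zsmul, map_zsmul, map_zsmul, map_monomial, Polynomial.coe_mapRingHom, Polynomial.map_pow,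
    Polynomial.map_X, ← mul_one (Polynomial.X ^ (j : ℕ)), ← C_mul_monomial, map_mul]
  have h1 : subst aperySeries (C (Polynomial.X ^ (j : ℕ))) = PowerSeries.X ^ (j : ℕ) := by
    simp [subst]
  rw [h1, PowerSeries.coeff_X_pow_mul', zsmul_eq_mul]
  have hf : ∀ k : ℕ, (k ! : ℂ) ≠ 0 := fun k => by exact_mod_cast Nat.factorial_ne_zero _
  have h2 : ((n ! / (j : ℕ)! : ℕ) : ℂ) = (n ! : ℂ) / (j : ℕ)! :=
    Nat.cast_div (Nat.factorial_dvd_factorial (by have := j.2; omega)) (hf _)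
  rw [Int.cast_mul, Int.cast_natCast, h2]
  push_cast
  split_ifs with h
  · rw [hy, Nat.cast_choose ℂ h]
    have := hf ν
    have := hf j
    have := hf (ν - j)
    field_simp
  · rw [Nat.choose_eq_zero_of_lt (by omega)]
    simp

instance (σ : Type) (N : ℕ) : Nonempty (Mon σ N) := ⟨⟨0, by simp⟩⟩

/-- The auxiliary polynomial. -/
theorem exists_auxiliary (N : ℕ) : ∃ C : ℝ, 1 ≤ C ∧ ∀ l : ℕ, 1 ≤ l → ∃ P : Pol ℤ Unit, P ≠ 0 ∧
    (toPoly ℤ Unit P).natDegree ≤ 2 * l ∧ P.totalDegree ≤ N ∧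
    HasSize (2 * l) N ((2 * l)! * C ^ l) P ∧
    (∀ ν < (2 * Fintype.card (Mon (Unit × Fin 3) N) - 1) * l, PowerSeries.coeff ν
      (subst aperySeries (map (Polynomial.mapRingHom (Int.castRingHom ℂ)) P)) = 0) ∧
    ∀ ν, ‖PowerSeries.coeff ν (subst aperySeries
      (map (Polynomial.mapRingHom (Int.castRingHom ℂ)) P))‖ ≤ (2 * l)! / ν ! * C ^ l * C ^ ν := by
  choose K' C' hK' hC' h using fun m : Mon (Unit × Fin 3) N => exists_isIntExp_monomial m.1
  choose y hy using h
  set M := Fintype.card (Mon (Unit × Fin 3) N) with hM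
  obtain ⟨K, hK⟩ : ∃ K, ∀ m, K' m ≤ K := by
    obtain ⟨K, hK⟩ := (Set.finite_range K').bddAbove
    exact ⟨K, fun m => hK ⟨m, rfl⟩⟩
  obtain ⟨C, hC⟩ : ∃ K, ∀ m, C' m ≤ K := by
    obtain ⟨K, hK⟩ := (Set.finite_range C').bddAbove
    exact ⟨K, fun m => hK ⟨m, rfl⟩⟩
  have hK1 : 1 ≤ K := (hK' _).trans (hK (Classical.arbitrary _))
  have hC1 : 1 ≤ C := (hC' _).trans (hC (Classical.arbitrary _))
  have hyb : ∀ m k, |(y m k : ℝ)| ≤ K * C ^ k := fun m k => (hy m k).2.trans (by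
    have := hC' m
    have := hK' m
    gcongr
    · exact hK m
    · exact hC m)
  have hM1 : (1 : ℝ) ≤ M := by exact_mod_cast (Fintype.card_pos : 0 < M)
  set c := (3 * M * K * (2 * C) ^ (2 * M)) ^ (2 * M) with hc
  have hc1 : 1 ≤ c := by
    have : (1 : ℝ) ≤ (2 * C) ^ (2 * M) := one_le_pow₀ (by linarith)
    have : 1 ≤ 3 * M * K := by nlinarith
    exact one_le_pow₀ (by nlinarith)
  have h3M : 1 ≤ 3 * (M : ℝ) := by linarith
  have h3Mc : 1 ≤ 3 * (M : ℝ) * c := by nlinarith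
  have h3McK : 1 ≤ 3 * (M : ℝ) * c * K := by nlinarith
  have h1 : 3 * M * c ≤ 3 * M * c * K := le_mul_of_one_le_right (by linarith) hK1
  have h2 : 3 * M * c * K ≤ 3 * M * c * K * (2 * C) :=
    le_mul_of_one_le_right (by linarith) (by linarith)
  refine ⟨3 * M * c * K * (2 * C), by nlinarith, fun l hl => ?_⟩
  obtain ⟨t, ht0, ht, hle⟩ := exists_int_combination y K C hK1 hC1 hyb l hl
  rw [← hM, ← hc] at hle
  have hcard : ((Fintype.card (Mon (Unit × Fin 3) N × Fin (2 * l + 1)) : ℕ) : ℝ) ≤ (3 * M) ^ l := by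
    rw [Fintype.card_prod, Fintype.card_fin, ← hM]
    exact_mod_cast card_bound M l hl
  refine ⟨comb fun c => t c * ((2 * l)! / (c.2 : ℕ)! : ℕ), comb_ne_zero _ ?_,
    natDegree_toPoly_comb_le _, totalDegree_comb_le _, ?_, fun ν hν => ?_, fun ν => ?_⟩
  · obtain ⟨x, hx⟩ := Function.ne_iff.mp ht0
    refine Function.ne_iff.mpr ⟨x, mul_ne_zero hx ?_⟩
    have : 0 < (2 * l)! / (x.2 : ℕ)! := Nat.div_pos (Nat.factorial_le (by have := x.2.2; omega))
      (Nat.factorial_pos _)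
    exact_mod_cast this.ne'
  · refine (hasSize_comb _ ((2 * l)! * c ^ l) fun x => ?_).mono le_rfl le_rfl ?_
    · rw [Int.cast_mul, Int.cast_natCast, abs_mul, mul_comm, Nat.abs_cast]
      have : (((2 * l)! / (x.2 : ℕ)! : ℕ) : ℝ) ≤ (2 * l)! := by
        exact_mod_cast Nat.div_le_self _ _
      exact mul_le_mul this (hle x) (abs_nonneg _) (by positivity)
    · calc _ ≤ (3 * M) ^ l * ((2 * l)! * c ^ l) := by gcongr
        _ = (2 * l)! * (3 * M * c) ^ l := by rw [mul_pow (3 * (M : ℝ))]; ring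
        _ ≤ _ := by
          refine mul_le_mul_of_nonneg_left (pow_le_pow_left₀ (by positivity) ?_ _) (by positivity)
          exact h1.trans h2
  · rw [coeff_subst_comb y (fun m k => (hy m k).1), ht ν hν]
    simp
  · rw [coeff_subst_comb y (fun m k => (hy m k).1), norm_mul, norm_div, Complex.norm_natCast,
      Complex.norm_natCast, Complex.norm_intCast, mul_assoc]
    refine mul_le_mul_of_nonneg_left ?_ (by positivity)
    rw [← Int.cast_abs]
    push_cast
    calc _ ≤ ∑ x : Mon (Unit × Fin 3) N × Fin (2 * l + 1), c ^ l * (2 ^ ν * (K * C ^ ν)) := by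
          refine (Finset.abs_sum_le_sum_abs _ _).trans (Finset.sum_le_sum fun x _ => ?_)
          rw [abs_mul, abs_mul, Nat.abs_cast]
          refine mul_le_mul (hle x) (mul_le_mul ?_ ((hyb _ _).trans ?_) (abs_nonneg _)
            (by positivity)) (by positivity) (by positivity)
          · exact_mod_cast Nat.choose_le_two_pow _ _
          · gcongr
            omega
      _ ≤ (3 * M) ^ l * (c ^ l * (2 ^ ν * (K * C ^ ν))) := by
          rw [Finset.sum_const, Finset.card_univ, nsmul_eq_mul]
          gcongr
      _ ≤ (3 * M) ^ l * (c ^ l * (2 ^ ν * (K ^ l * C ^ ν))) := by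
          gcongr
          exact le_self_pow₀ hK1 (by omega)
      _ = (3 * M * c * K) ^ l * (2 * C) ^ ν := by
          rw [mul_pow (3 * (M : ℝ) * c), mul_pow (3 * (M : ℝ)), mul_pow 2 C]
          ring
      _ ≤ _ := by
          have h3 : 2 * C ≤ 3 * M * c * K * (2 * C) := le_mul_of_one_le_left (by linarith) h3McK
          gcongr

end Siegel

/-! ### Evaluation of power series -/

section Evaluation

/-- Absolute convergence of a power series at `α`. -/
def Conv (α : ℂ) (F : PowerSeries ℂ) : Prop :=
  Summable fun n => ‖PowerSeries.coeff n F * α ^ n‖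

/-- The value of a power series at `α`. -/
def evalAt (α : ℂ) (F : PowerSeries ℂ) : ℂ := ∑' n, PowerSeries.coeff n F * α ^ n

variable {α : ℂ} {F G : PowerSeries ℂ}

lemma Conv.add (hF : Conv α F) (hG : Conv α G) : Conv α (F + G) := by
  refine Summable.of_nonneg_of_le (fun _ => norm_nonneg _) (fun n => ?_) (Summable.add hF hG)
  rw [map_add, add_mul]
  exact norm_add_le _ _

lemma evalAt_add (hF : Conv α F) (hG : Conv α G) : evalAt α (F + G) = evalAt α F + evalAt α G := by
  rw [evalAt, evalAt, evalAt, ← hF.of_norm.tsum_add hG.of_norm]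
  simp only [map_add, add_mul]

lemma coeff_mul_mul_pow (n : ℕ) : PowerSeries.coeff n (F * G) * α ^ n =
    ∑ kl ∈ Finset.HasAntidiagonal.antidiagonal n,
      (PowerSeries.coeff kl.1 F * α ^ kl.1) * (PowerSeries.coeff kl.2 G * α ^ kl.2) := by
  rw [PowerSeries.coeff_mul, Finset.sum_mul]
  refine Finset.sum_congr rfl fun kl hkl => ?_
  rw [Finset.HasAntidiagonal.mem_antidiagonal] at hkl
  rw [← hkl, pow_add]
  ring

lemma Conv.mul (hF : Conv α F) (hG : Conv α G) : Conv α (F * G) := by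
  have := summable_norm_sum_mul_antidiagonal_of_summable_norm hF hG
  simpa only [Conv, coeff_mul_mul_pow] using this

lemma evalAt_mul (hF : Conv α F) (hG : Conv α G) : evalAt α (F * G) = evalAt α F * evalAt α G := by
  rw [evalAt, evalAt, evalAt, tsum_mul_tsum_eq_tsum_sum_antidiagonal_of_summable_norm hF hG]
  simp only [coeff_mul_mul_pow]

lemma conv_coe (p : Polynomial ℂ) : Conv α (p : PowerSeries ℂ) := by
  refine summable_of_ne_finset_zero (s := Finset.range (p.natDegree + 1)) fun n hn => ?_
  rw [Finset.mem_range, not_lt] at hn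
  rw [Polynomial.coeff_coe, Polynomial.coeff_eq_zero_of_natDegree_lt (by omega), zero_mul,
    norm_zero]

lemma evalAt_coe (p : Polynomial ℂ) : evalAt α (p : PowerSeries ℂ) = p.eval α := by
  rw [evalAt, Polynomial.eval_eq_sum_range, tsum_eq_sum (s := Finset.range (p.natDegree + 1))]
  · simp only [Polynomial.coeff_coe]
  · intro n hn
    rw [Finset.mem_range, not_lt] at hn
    rw [Polynomial.coeff_coe, Polynomial.coeff_eq_zero_of_natDegree_lt (by omega), zero_mul]

lemma conv_of_norm_coeff_le (K C : ℝ) (h : ∀ n, ‖PowerSeries.coeff n F‖ ≤ K * C ^ n / n !) :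
    Conv α F := by
  refine Summable.of_nonneg_of_le (fun _ => norm_nonneg _) (fun n => ?_)
    ((Real.summable_pow_div_factorial (C * ‖α‖)).mul_left K)
  rw [norm_mul, norm_pow, mul_pow]
  refine (mul_le_mul_of_nonneg_right (h n) (by positivity)).trans (le_of_eq ?_)
  ring

lemma conv_aperySeries (i : Fin 3) : Conv α (aperySeries i) := by
  refine conv_of_norm_coeff_le 32 32 fun n => ?_
  rw [coeff_aperySeries, norm_div, Complex.norm_natCast, Complex.norm_intCast]
  gcongr
  exact_mod_cast abs_aperySol_le n i

lemma conv_aperyUnit : Conv α aperyUnit := by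
  refine conv_of_norm_coeff_le 1 16 fun n => ?_
  rw [aperyUnit, PowerSeries.coeff_mk, norm_div, Complex.norm_natCast, Complex.norm_natCast,
    one_mul]
  gcongr
  exact_mod_cast apery_le n

lemma evalAt_aperySeries_zero : evalAt α (aperySeries 0) = α * evalAt α aperyUnit := by
  rw [aperySeries_zero, ← Polynomial.coe_X, evalAt_mul (conv_coe _) conv_aperyUnit, evalAt_coe,
    Polynomial.eval_X]

lemma conv_subst_and_evalAt_subst (p : Pol ℂ Unit) : Conv α (subst aperySeries p) ∧
    evalAt α (subst aperySeries p) =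
      eval₂ (Polynomial.evalRingHom α) (fun s => evalAt α (aperySeries s.2)) p := by
  induction p using MvPolynomial.induction_on with
  | C a =>
    have : subst aperySeries (C a) = (a : PowerSeries ℂ) := by simp [subst]
    rw [this, eval₂_C]
    exact ⟨conv_coe a, evalAt_coe a⟩
  | add p q hp hq =>
    rw [map_add, eval₂_add]
    exact ⟨hp.1.add hq.1, by rw [evalAt_add hp.1 hq.1, hp.2, hq.2]⟩
  | mul_X p s hp =>
    have : subst aperySeries (X s) = aperySeries s.2 := by simp [subst]
    rw [map_mul, this, eval₂_mul, eval₂_X]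
    exact ⟨hp.1.mul (conv_aperySeries _), by rw [evalAt_mul hp.1 (conv_aperySeries _), hp.2]⟩

lemma norm_evalAt_iterate_euler_le (hα : ∀ k, Conv α (euler^[k] F)) (n T : ℕ) (B C : ℝ)
    (hB : 0 ≤ B) (hC : 0 ≤ C) (h0 : ∀ ν < T, PowerSeries.coeff ν F = 0)
    (h : ∀ ν, ‖PowerSeries.coeff ν F‖ ≤ n ! / ν ! * B * C ^ ν) (k : ℕ) (hk : k ≤ n) :
    ‖evalAt α (euler^[k] F)‖ ≤ n ! * n ! * B * ((Real.exp 1 * C * ‖α‖) ^ T / T !) *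
      ∑' i : ℕ, (Real.exp 1 * C * ‖α‖) ^ i / i ! := by
  set c := Real.exp 1 * C * ‖α‖ with hc
  have hc0 : 0 ≤ c := by positivity
  have h1 : ∀ ν, ‖PowerSeries.coeff ν (euler^[k] F) * α ^ ν‖ ≤ n ! * n ! * B * (c ^ ν / ν !) := by
    intro ν
    have h2 : (ν : ℝ) ^ k ≤ n ! * Real.exp 1 ^ ν := by
      have h3 := Real.pow_div_factorial_le_exp (ν : ℝ) (by positivity) k
      rw [div_le_iff₀ (by positivity)] at h3
      rw [Real.exp_one_pow, mul_comm]
      refine h3.trans (mul_le_mul_of_nonneg_left ?_ (by positivity))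
      exact_mod_cast Nat.factorial_le hk
    rw [coeff_iterate_euler, norm_mul, norm_mul, norm_pow, norm_pow, Complex.norm_natCast]
    calc (ν : ℝ) ^ k * ‖PowerSeries.coeff ν F‖ * ‖α‖ ^ ν
        ≤ (n ! * Real.exp 1 ^ ν) * (n ! / ν ! * B * C ^ ν) * ‖α‖ ^ ν := by
          gcongr
          exact h ν
      _ = _ := by
          rw [hc, mul_pow, mul_pow]
          ring
  have h4 : evalAt α (euler^[k] F) =
      ∑' i, PowerSeries.coeff (i + T) (euler^[k] F) * α ^ (i + T) := by
    rw [evalAt, ← (hα k).of_norm.sum_add_tsum_nat_add T, Finset.sum_eq_zero, zero_add]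
    intro ν hν
    rw [coeff_iterate_euler, h0 ν (Finset.mem_range.mp hν), mul_zero, zero_mul]
  rw [h4]
  refine tsum_of_norm_bounded ((Real.summable_pow_div_factorial c).hasSum.mul_left _) fun i => ?_
  refine (h1 _).trans ?_
  rw [mul_assoc (_ * _ * B)]
  refine mul_le_mul_of_nonneg_left ?_ (by positivity)
  rw [div_mul_div_comm, ← pow_add, add_comm T i]
  refine div_le_div_of_nonneg_left (by positivity) (by positivity) ?_
  rw [mul_comm]
  exact_mod_cast Nat.le_of_dvd (Nat.factorial_pos _)
    (Nat.factorial_mul_factorial_dvd_factorial_add i T)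

end Evaluation

/-! ### A Liouville inequality for determinants -/

section Liouville

lemma norm_det_le {ι : Type*} [Fintype ι] [DecidableEq ι] (A : Matrix ι ι ℂ) (b : ι → ℝ)
    (h : ∀ i j, ‖A i j‖ ≤ b j) : ‖A.det‖ ≤ (Fintype.card ι)! * ∏ j, b j := by
  rw [Matrix.det_apply]
  refine (norm_sum_le _ _).trans ?_
  refine (Finset.sum_le_card_nsmul _ _ (∏ j, b j) fun σ _ => ?_).trans (le_of_eq ?_)
  · rw [Units.smul_def, zsmul_eq_mul, norm_mul, norm_prod]
    have : ‖((Equiv.Perm.sign σ : ℤ) : ℂ)‖ = 1 := by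
      rcases Int.units_eq_one_or (Equiv.Perm.sign σ) with h | h <;> simp [h]
    rw [this, one_mul]
    exact Finset.prod_le_prod (fun _ _ => norm_nonneg _) fun j _ => h _ j
  · rw [Finset.card_univ, Fintype.card_perm, nsmul_eq_mul]

variable {K : Type*} [Field K] [NumberField K]

lemma one_le_prod_norm {x : K} (hx : x ≠ 0) (hinteg : IsIntegral ℤ x) :
    1 ≤ ∏ σ : K →ₐ[ℚ] ℂ, ‖σ x‖ := by
  have h1 : IsIntegral ℤ (Algebra.norm ℚ x) := Algebra.isIntegral_norm ℚ hinteg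
  obtain ⟨z, hz⟩ := IsIntegrallyClosed.isIntegral_iff.mp h1
  rw [← norm_prod, ← Algebra.norm_eq_prod_embeddings ℚ ℂ x, ← hz]
  have hz0 : z ≠ 0 := by
    rintro rfl
    rw [map_zero] at hz
    exact hx (Algebra.norm_eq_zero_iff.mp hz.symm)
  simp only [algebraMap_int_eq, eq_intCast, eq_ratCast, Rat.cast_intCast, Complex.norm_intCast]
  exact_mod_cast Int.one_le_abs hz0

theorem one_le_of_det_ne_zero {ι : Type*} [Fintype ι] [DecidableEq ι] (σ₀ : K →ₐ[ℚ] ℂ)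
    (A : Matrix ι ι K) (hA : A.det ≠ 0) (d : ℕ) (hd : d ≠ 0)
    (hinteg : ∀ i j, IsIntegral ℤ ((d : K) * A i j)) (B : ℝ) (hB : 1 ≤ B)
    (hbd : ∀ (σ : K →ₐ[ℚ] ℂ) i j, ‖σ (A i j)‖ ≤ B) (j₀ : ι) (w : ι → ℂ) (hw : w j₀ = 1) (Δ : ℝ)
    (hΔ : ∀ i, ‖∑ j, σ₀ (A i j) * w j‖ ≤ Δ) :
    1 ≤ ((Fintype.card ι)! * (d * B) ^ Fintype.card ι) ^ Module.finrank ℚ K * Δ := by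
  set ρ := Fintype.card ι with hρ
  have hΔ0 : 0 ≤ Δ := (norm_nonneg _).trans (hΔ j₀)
  have hd1 : (1 : ℝ) ≤ d := by exact_mod_cast Nat.one_le_iff_ne_zero.mpr hd
  have hdK : (d : K) ≠ 0 := by exact_mod_cast hd
  have hρ1 : 1 ≤ ρ := Fintype.card_pos_iff.mpr ⟨j₀⟩
  have hfac : (1 : ℝ) ≤ ρ ! := by
    exact_mod_cast Nat.one_le_iff_ne_zero.mpr (Nat.factorial_ne_zero _)
  have hone : 1 ≤ (ρ ! : ℝ) * (d * B) ^ ρ :=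
    one_le_mul_of_one_le_of_one_le hfac (one_le_pow₀ (one_le_mul_of_one_le_of_one_le hd1 hB))
  have hx : ((d : K) • A).det ≠ 0 := by
    rw [Matrix.det_smul]
    exact mul_ne_zero (pow_ne_zero _ hdK) hA
  have hxi : IsIntegral ℤ ((d : K) • A).det := IsIntegral.det fun i j => by
    simpa using hinteg i j
  have hmap : ∀ σ : K →ₐ[ℚ] ℂ, σ ((d : K) • A).det = d ^ ρ * (A.map σ).det := fun σ => by
    rw [Matrix.det_smul, map_mul, map_pow, map_natCast, AlgHom.map_det]
    rfl
  have h1 : ∀ σ : K →ₐ[ℚ] ℂ, ‖σ ((d : K) • A).det‖ ≤ ρ ! * (d * B) ^ ρ := fun σ => by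
    rw [hmap, norm_mul, norm_pow, Complex.norm_natCast]
    have := norm_det_le (A.map σ) (fun _ => B) fun i j => hbd σ i j
    rw [Finset.prod_const, Finset.card_univ] at this
    calc _ ≤ (d : ℝ) ^ ρ * (ρ ! * B ^ ρ) := by gcongr
      _ = _ := by rw [mul_pow]; ring
  have h2 : ‖σ₀ ((d : K) • A).det‖ ≤ ρ ! * (d * B) ^ ρ * Δ := by
    rw [hmap, norm_mul, norm_pow, Complex.norm_natCast]
    have h3 := Matrix.det_updateCol_sum (A.map σ₀) j₀ w
    rw [hw, one_smul] at h3
    rw [← h3]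
    have := norm_det_le ((A.map σ₀).updateCol j₀ fun k => ∑ i, w i • (A.map σ₀) k i)
      (Function.update (fun _ => B) j₀ Δ) fun i j => by
        rw [Matrix.updateCol_apply, Function.update_apply]
        split_ifs
        · simpa [mul_comm] using hΔ i
        · exact hbd σ₀ i j
    rw [Finset.prod_update_of_mem (Finset.mem_univ _), Finset.prod_const,
      Finset.sdiff_singleton_eq_erase,
      Finset.card_erase_of_mem (Finset.mem_univ _), Finset.card_univ] at this
    calc _ ≤ (d : ℝ) ^ ρ * (ρ ! * (Δ * B ^ (ρ - 1))) := by gcongr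
      _ ≤ (d : ℝ) ^ ρ * (ρ ! * (Δ * B ^ ρ)) := by
        gcongr
        omega
      _ = _ := by rw [mul_pow]; ring
  classical
  refine (one_le_prod_norm hx hxi).trans ?_
  rw [← Finset.mul_prod_erase _ _ (Finset.mem_univ σ₀)]
  have h4 : ∏ σ ∈ Finset.univ.erase σ₀, ‖σ ((d : K) • A).det‖ ≤
      (ρ ! * (d * B) ^ ρ) ^ (Module.finrank ℚ K - 1) := by
    refine (Finset.prod_le_prod (fun _ _ => norm_nonneg _) fun σ _ => h1 σ).trans_eq ?_
    rw [Finset.prod_const, Finset.card_erase_of_mem (Finset.mem_univ _), Finset.card_univ,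
      AlgHom.card]
  calc _ ≤ (ρ ! * (d * B) ^ ρ * Δ) * (ρ ! * (d * B) ^ ρ) ^ (Module.finrank ℚ K - 1) :=
        mul_le_mul h2 h4 (by positivity) (by positivity)
    _ = _ := by
      have : Module.finrank ℚ K = Module.finrank ℚ K - 1 + 1 :=
        (Nat.sub_add_cancel Module.finrank_pos).symm
      conv_rhs => rw [this, pow_succ]
      ring

end Liouville

/-! ### Specialization -/

section Specialization

variable {S : Type*} [CommRing S]

/-- Specialization of the independent variable and of the first unknown. -/
def spec (a b : S) : Pol ℤ Unit →+* MvPolynomial (Fin 2) S :=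
  eval₂Hom (C.comp (Polynomial.eval₂RingHom (Int.castRingHom S) a)) fun s => ![C b, X 0, X 1] s.2

lemma map_spec {S' : Type*} [CommRing S'] (g : S →+* S') (a b : S) (p : Pol ℤ Unit) :
    map g (spec a b p) = spec (g a) (g b) p := by
  have : (map g).comp (spec a b) = spec (g a) (g b) := by
    refine MvPolynomial.ringHom_ext' (Polynomial.ringHom_ext (fun n => ?_) ?_) fun s => ?_
    · simp [spec]
    · simp [spec]
    · obtain ⟨⟨⟩, i⟩ := s
      fin_cases i <;> simp [spec]
  exact RingHom.congr_fun this p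

lemma spec_monomial (a b : S) (j : ℕ) (m : Unit × Fin 3 →₀ ℕ) :
    spec a b (monomial m (Polynomial.X ^ j)) =
      monomial (Finsupp.single 0 (m ((), 1)) + Finsupp.single 1 (m ((), 2)))
        (a ^ j * b ^ m ((), 0)) := by
  have h1 : (monomial m (Polynomial.X ^ j) : Pol ℤ Unit) = C (Polynomial.X ^ j) *
      (X ((), 0) ^ m ((), 0) * X ((), 1) ^ m ((), 1) * X ((), 2) ^ m ((), 2)) := by
    rw [monomial_eq, Finsupp.prod_fintype _ _ fun _ => pow_zero _, Fintype.prod_prod_type]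
    simp [Fin.prod_univ_three]
  have h2 : (monomial (Finsupp.single 0 (m ((), 1)) + Finsupp.single 1 (m ((), 2)))
      (a ^ j * b ^ m ((), 0)) : MvPolynomial (Fin 2) S) = C (a ^ j) * (C b ^ m ((), 0) *
        X 0 ^ m ((), 1) * X 1 ^ m ((), 2)) := by
    rw [monomial_add_single, ← C_mul_X_pow_eq_monomial, map_mul, map_pow C b]
    ring
  rw [h1, h2]
  simp [spec]

lemma coeff_spec_monomial (a b : S) (j : ℕ) (m : Unit × Fin 3 →₀ ℕ) (m' : Fin 2 →₀ ℕ) :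
    coeff m' (spec a b (monomial m (Polynomial.X ^ j))) = 0 ∨
      coeff m' (spec a b (monomial m (Polynomial.X ^ j))) = a ^ j * b ^ m ((), 0) := by
  classical
  rw [spec_monomial, coeff_monomial]
  split_ifs
  · exact Or.inr rfl
  · exact Or.inl rfl

lemma degree_unit_prod (m : Unit × Fin 3 →₀ ℕ) :
    m.degree = m ((), 0) + m ((), 1) + m ((), 2) := by
  rw [Finsupp.degree_eq_sum, Fintype.sum_prod_type]
  simp [Fin.sum_univ_three]

lemma totalDegree_spec_le (a b : S) (p : Pol ℤ Unit) (N : ℕ) (hp : p.totalDegree ≤ N) :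
    (spec a b p).totalDegree ≤ N := by
  rw [← mem_restrictTotalDegree]
  refine map_mem_of_degree_le (spec a b).toAddMonoidHom
    (restrictTotalDegree (Fin 2) S N).toAddSubgroup (fun j _ m hm => ?_) le_rfl hp
  change spec a b _ ∈ restrictTotalDegree (Fin 2) S N
  rw [mem_restrictTotalDegree, spec_monomial]
  refine (totalDegree_monomial_le _ _).trans ?_
  rw [degree_unit_prod] at hm
  have h := (Finsupp.degree (σ := Fin 2) (R := ℕ)).map_add (Finsupp.single 0 (m ((), 1)))
    (Finsupp.single 1 (m ((), 2)))
  simp only [Finsupp.degree_single] at h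
  change Finsupp.degree _ ≤ N
  omega

lemma eval_spec (a b : S) (x : Fin 2 → S) (p : Pol ℤ Unit) (N : ℕ) (hp : p.totalDegree ≤ N) :
    eval x (spec a b p) =
      ∑ m : Mon (Fin 2) N, coeff m.1 (spec a b p) * (x 0 ^ m.1 0 * x 1 ^ m.1 1) := by
  conv_lhs => rw [eq_sum_mon _ (totalDegree_spec_le a b p N hp), map_sum]
  refine Finset.sum_congr rfl fun m _ => ?_
  rw [eval_monomial, Finsupp.prod_fintype _ _ fun _ => pow_zero _, Fin.prod_univ_two]

lemma isIntegral_coeff_spec {K : Type*} [Field K] (a b : K) (d : ℕ)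
    (ha : IsIntegral ℤ ((d : K) * a)) (hb : IsIntegral ℤ ((d : K) * b)) (p : Pol ℤ Unit) (n N : ℕ)
    (hn : (toPoly ℤ Unit p).natDegree ≤ n) (hN : p.totalDegree ≤ N) (m' : Fin 2 →₀ ℕ) :
    IsIntegral ℤ (((d ^ (n + N) : ℕ) : K) * coeff m' (spec a b p)) := by
  refine map_mem_of_degree_le ((AddMonoidHom.mulLeft ((d ^ (n + N) : ℕ) : K)).comp
    ((coeffAddMonoidHom m').comp (spec a b).toAddMonoidHom))
    (integralClosure ℤ K).toSubring.toAddSubgroup (fun j hj m hm => ?_) hn hN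
  change IsIntegral ℤ (((d ^ (n + N) : ℕ) : K) * coeff m' (spec a b _))
  rcases coeff_spec_monomial a b j m m' with h | h
  · rw [h, mul_zero]
    exact isIntegral_zero
  · rw [h]
    rw [degree_unit_prod] at hm
    obtain ⟨r, hr⟩ := Nat.exists_eq_add_of_le (by omega : j + m ((), 0) ≤ n + N)
    rw [hr]
    have : ((d ^ (j + m ((), 0) + r) : ℕ) : K) * (a ^ j * b ^ m ((), 0)) =
        ((d ^ r : ℕ) : K) * ((d * a) ^ j * (d * b) ^ m ((), 0)) := by
      push_cast
      ring
    rw [this]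
    exact (isIntegral_natCast _).mul ((ha.pow _).mul (hb.pow _))

lemma HasSize.norm_coeff_spec_le {d N : ℕ} {w : ℝ} {p : Pol ℤ Unit} (h : HasSize d N w p) (a b : ℂ)
    (B : ℝ) (hB : 1 ≤ B) (ha : ‖a‖ ≤ B) (hb : ‖b‖ ≤ B) (m' : Fin 2 →₀ ℕ) :
    ‖coeff m' (spec a b p)‖ ≤ w * B ^ (d + N) := by
  refine h ((coeffAddMonoidHom m').comp (spec a b).toAddMonoidHom) _ fun j hj m hm => ?_
  change ‖coeff m' (spec a b _)‖ ≤ _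
  rcases coeff_spec_monomial a b j m m' with h | h
  · rw [h, norm_zero]
    positivity
  · rw [h, norm_mul, norm_pow, norm_pow, pow_add]
    rw [degree_unit_prod] at hm
    have : m ((), 0) ≤ N := by omega
    gcongr
    · exact (pow_le_pow_left₀ (norm_nonneg _) ha _).trans (pow_le_pow_right₀ hB hj)
    · exact (pow_le_pow_left₀ (norm_nonneg _) hb _).trans (pow_le_pow_right₀ hB this)

lemma map_iterate_sysDer {R J : Type*} [CommRing R] (g : R →+* S) (p : Pol R J) (k : ℕ) :
    map (Polynomial.mapRingHom g) ((sysDer R J)^[k] p) =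
      (sysDer S J)^[k] (map (Polynomial.mapRingHom g) p) := by
  induction k with
  | zero => rfl
  | succ k ih => rw [Function.iterate_succ_apply', Function.iterate_succ_apply', map_sysDer, ih]

lemma evalAt_iterate_euler (α : ℂ) (P : Pol ℤ Unit) (k : ℕ) :
    evalAt α (euler^[k] (subst aperySeries (map (Polynomial.mapRingHom (Int.castRingHom ℂ)) P))) =
      eval ![evalAt α (aperySeries 1), evalAt α (aperySeries 2)]
        (spec α (evalAt α (aperySeries 0)) ((sysDer ℤ Unit)^[k] P)) := by
  rw [iterate_euler_subst, (conv_subst_and_evalAt_subst _).2, ← map_iterate_sysDer]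
  generalize (sysDer ℤ Unit)^[k] P = p
  have : (eval₂Hom (Polynomial.evalRingHom α) fun s : Unit × Fin 3 =>
      evalAt α (aperySeries s.2)).comp
      (map (Polynomial.mapRingHom (Int.castRingHom ℂ))) =
      (eval ![evalAt α (aperySeries 1), evalAt α (aperySeries 2)]).comp
        (spec α (evalAt α (aperySeries 0))) := by
    refine MvPolynomial.ringHom_ext' (Polynomial.ringHom_ext (fun n => ?_) ?_) fun s => ?_
    · simp [spec]
    · simp [spec]
    · obtain ⟨⟨⟩, i⟩ := s
      fin_cases i <;> simp [spec]
  exact RingHom.congr_fun this p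

lemma span_range_coeff_spec (α β : ℂ) (P : Pol ℤ Unit) (N K : ℕ)
    (h : ∀ m : Mon (Unit × Fin 3) N, monomial m.1 1 ∈ Submodule.span ℂ ((fun k =>
      map (Polynomial.evalRingHom α) ((sysDer ℂ Unit)^[k]
        (map (Polynomial.mapRingHom (Int.castRingHom ℂ)) P))) '' Set.Iic K)) :
    Submodule.span ℂ (Set.range fun (k : Set.Iic K) (m : Mon (Fin 2) N) =>
      coeff m.1 (spec α β ((sysDer ℤ Unit)^[k] P))) = ⊤ := by
  classical
  let L : MvPolynomial (Unit × Fin 3) ℂ →ₗ[ℂ] (Mon (Fin 2) N → ℂ) := LinearMap.pi fun m =>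
    (lcoeff ℂ m.1).comp
      (aeval (R := ℂ) fun s : Unit × Fin 3 =>
        (![C β, X 0, X 1] s.2 : MvPolynomial (Fin 2) ℂ)).toLinearMap
  have hL : ∀ p : Pol ℤ Unit, L (map (Polynomial.evalRingHom α)
      (map (Polynomial.mapRingHom (Int.castRingHom ℂ)) p)) =
        fun m : Mon (Fin 2) N => coeff m.1 (spec α β p) := fun p => by
    have : ((aeval (R := ℂ) fun s : Unit × Fin 3 =>
        (![C β, X 0, X 1] s.2 : MvPolynomial (Fin 2) ℂ)).toRingHom.comp
          (map (Polynomial.evalRingHom α))).comp (map (Polynomial.mapRingHom (Int.castRingHom ℂ))) =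
        spec α β := by
      refine MvPolynomial.ringHom_ext' (Polynomial.ringHom_ext (fun n => ?_) ?_) fun s => ?_
      · simp [spec]
      · simp [spec]
      · simp [spec]
    rw [← this]
    rfl
  rw [eq_top_iff, ← (Pi.basisFun ℂ (Mon (Fin 2) N)).span_eq, Submodule.span_le]
  rintro _ ⟨m, rfl⟩
  have hm := m.2
  rw [Finsupp.degree_eq_sum, Fin.sum_univ_two] at hm
  have hdeg : (Finsupp.single ((), 1) (m.1 0) + Finsupp.single ((), 2) (m.1 1) :
      Unit × Fin 3 →₀ ℕ).degree ≤ N := by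
    rw [map_add, Finsupp.degree_single, Finsupp.degree_single]
    exact hm
  have h1 := Submodule.mem_map_of_mem (f := L) (h ⟨_, hdeg⟩)
  rw [Submodule.map_span, ← Set.image_comp] at h1
  have h2 : L (monomial (Finsupp.single ((), 1) (m.1 0) + Finsupp.single ((), 2) (m.1 1)) 1) =
      Pi.basisFun ℂ (Mon (Fin 2) N) m := by
    ext m'
    have h3 : (X 0 ^ m.1 0 * X 1 ^ m.1 1 : MvPolynomial (Fin 2) ℂ) = monomial m.1 1 := by
      rw [monomial_eq, Finsupp.prod_fintype _ _ fun _ => pow_zero _, Fin.prod_univ_two]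
      simp
    have h4 : L (monomial (Finsupp.single ((), 1) (m.1 0) + Finsupp.single ((), 2) (m.1 1)) 1) m' =
        coeff m'.1 (X 0 ^ m.1 0 * X 1 ^ m.1 1 : MvPolynomial (Fin 2) ℂ) := by
      change coeff m'.1 (aeval _ (monomial _ (1 : ℂ))) = _
      rw [← one_mul (1 : ℂ), ← monomial_mul, map_mul, aeval_monomial, aeval_monomial]
      simp
    rw [h4, h3, coeff_monomial, Pi.basisFun_apply, Pi.single_apply]
    simp [Subtype.ext_iff, eq_comm]
  rw [h2] at h1
  refine Submodule.span_mono ?_ h1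
  rintro _ ⟨k, hk, rfl⟩
  refine ⟨⟨k, hk⟩, ?_⟩
  rw [Function.comp_apply, ← map_iterate_sysDer, hL]

end Specialization

/-! ### The main inequality -/

section MainInequality

lemma natDegree_toPoly_map_le {R S J : Type*} [CommRing R] [CommRing S] (g : R →+* S)
    (p : Pol R J) :
    (toPoly S J (map (Polynomial.mapRingHom g) p)).natDegree ≤ (toPoly R J p).natDegree := by
  rw [Polynomial.natDegree_le_iff_coeff_eq_zero]
  intro i hi
  ext m
  rw [coeff_coeff_toPoly, coeff_map, Polynomial.coe_mapRingHom, Polynomial.coeff_map,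
    ← coeff_coeff_toPoly, Polynomial.coeff_eq_zero_of_natDegree_lt hi, coeff_zero, map_zero,
      coeff_zero]

theorem main_inequality {K : Type*} [Field K] [NumberField K] (σ₀ : K →ₐ[ℚ] ℂ) (a b : K) (α : ℂ)
    (hα : α ≠ 0) (ha : σ₀ a = α) (hb : σ₀ b = evalAt α (aperySeries 0)) (d : ℕ) (hd : d ≠ 0)
    (hda : IsIntegral ℤ ((d : K) * a)) (hdb : IsIntegral ℤ ((d : K) * b)) (A : ℝ) (hA : 1 ≤ A)
    (haA : ∀ σ : K →ₐ[ℚ] ℂ, ‖σ a‖ ≤ A) (hbA : ∀ σ : K →ₐ[ℚ] ℂ, ‖σ b‖ ≤ A) (N M ρ : ℕ)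
    (hM : M = Fintype.card (Mon (Unit × Fin 3) N)) (hρ : ρ = Fintype.card (Mon (Fin 2) N)) :
    ∃ C c S : ℝ, 1 ≤ C ∧ 0 ≤ c ∧ 0 ≤ S ∧ ∀ l : ℕ, M * M + M * N + M < l →
      1 ≤ (ρ ! * ((d ^ (4 * l + N) : ℕ) * ((2 * l)! * C ^ l * (2 * (2 * l : ℕ) + 99 * N) ^ (2 * l) *
          A ^ (4 * l + N))) ^ ρ) ^ Module.finrank ℚ K *
        ((2 * l)! * (2 * l)! * C ^ l * (c ^ ((2 * M - 1) * l) / ((2 * M - 1) * l)!) * S) := by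
  classical
  obtain ⟨C, hC1, hC⟩ := exists_auxiliary N
  refine ⟨C, Real.exp 1 * C * ‖α‖, ∑' i : ℕ, (Real.exp 1 * C * ‖α‖) ^ i / i !, hC1, by positivity,
    tsum_nonneg fun i => by positivity, fun l hl => ?_⟩
  obtain ⟨P, hP0, hPd, hPN, hPs, hPv, hPc⟩ := hC l (by omega)
  rw [← hM] at hPv
  have hM1 : 1 ≤ M := hM ▸ Fintype.card_pos
  set T := (2 * M - 1) * l with hT
  have hTM : T + l = 2 * (M * l) := by
    rw [hT, ← Nat.succ_mul, ← mul_assoc]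
    congr 1
    omega
  set Q := map (Polynomial.mapRingHom (Int.castRingHom ℂ)) P with hQ
  have hQ0 : Q ≠ 0 := by
    rw [hQ, Ne, map_eq_zero_iff _ (map_injective _ (Polynomial.map_injective _ Int.cast_injective))]
    exact hP0
  have hQd : (toPoly ℂ Unit Q).natDegree ≤ 2 * l := (natDegree_toPoly_map_le _ _).trans hPd
  have hQN : Q.totalDegree ≤ N := (Finset.sup_mono (support_map_subset _ _)).trans hPN
  have hQT : ∀ k, PowerSeries.X ^ T ∣ subst aperySeries ((sysDer ℂ Unit)^[k] Q) := fun k => by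
    rw [← iterate_euler_subst, PowerSeries.X_pow_dvd_iff]
    intro ν hν
    rw [coeff_iterate_euler, hPv ν hν, mul_zero]
  obtain ⟨s, hs⟩ := exists_aperySeries_eq_mul 1
  obtain ⟨t, ht⟩ := exists_aperySeries_eq_mul 2
  have hli := linearIndependent_iterate_sysDer aperySeries aperyUnit s t aperySeries_zero
    constantCoeff_aperyUnit hs ht Q hQ0 (2 * l) N T M hQd hQN hQT (by
      obtain ⟨m, rfl⟩ := Nat.exists_eq_add_of_le' hM1
      simp only [Nat.add_sub_cancel]
      nlinarith)
  have hspan := span_range_coeff_spec α (evalAt α (aperySeries 0)) P N (2 * l)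
    (monomial_mem_span α hα aperySeries Q (2 * l) N T M (2 * l) hM hQd hQN hQT hli (by nlinarith))
  obtain ⟨e, he⟩ := exists_det_ne_zero_of_span_eq_top _ hspan
  set D : Matrix (Mon (Fin 2) N) (Mon (Fin 2) N) K :=
    Matrix.of fun i m => coeff m.1 (spec a b ((sysDer ℤ Unit)^[e i] P)) with hD
  have hDσ : ∀ (σ : K →ₐ[ℚ] ℂ) i m, σ (D i m) =
      coeff m.1 (spec (σ a) (σ b) ((sysDer ℤ Unit)^[e i] P)) := fun σ i m => by
    have := map_spec (σ : K →+* ℂ) a b ((sysDer ℤ Unit)^[e i] P)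
    simp only [RingHom.coe_coe] at this
    rw [← this, coeff_map]
    rfl
  have hD0 : D.det ≠ 0 := by
    intro h0
    apply he
    have h1 := congrArg σ₀ h0
    rw [AlgHom.map_det, map_zero] at h1
    rw [← h1]
    congr 1
    ext i m
    have h2 := hDσ σ₀ i m
    rw [ha, hb] at h2
    exact h2.symm
  have hCl : 1 ≤ C ^ l := one_le_pow₀ hC1
  have hfac : (1 : ℝ) ≤ (2 * l)! := by
    exact_mod_cast Nat.one_le_iff_ne_zero.mpr (Nat.factorial_ne_zero _)
  have hbase : (1 : ℝ) ≤ 2 * (2 * l : ℕ) + 99 * N := by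
    have : (1 : ℝ) ≤ l := by exact_mod_cast (by omega : 1 ≤ l)
    push_cast
    have : (0 : ℝ) ≤ N := by positivity
    linarith
  have hek : ∀ i, (e i : ℕ) ≤ 2 * l := fun i => (e i).2
  rw [hρ]
  refine one_le_of_det_ne_zero σ₀ D hD0 (d ^ (4 * l + N)) (pow_ne_zero _ hd) (fun i m => ?_) _
    (one_le_mul_of_one_le_of_one_le (one_le_mul_of_one_le_of_one_le
      (one_le_mul_of_one_le_of_one_le hfac hCl) (one_le_pow₀ hbase)) (one_le_pow₀ hA))
    (fun σ i m => ?_) ⟨0, by simp⟩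
    (fun m => evalAt α (aperySeries 1) ^ m.1 0 * evalAt α (aperySeries 2) ^ m.1 1) (by simp) _
    (fun i => ?_)
  · refine isIntegral_coeff_spec a b d hda hdb _ _ _ ?_ ?_ _
    · refine (natDegree_toPoly_iterate_sysDer_le _ _ hPd _).trans ?_
      have := hek i
      omega
    · exact (totalDegree_iterate_sysDer_le _ _).trans hPN
  · rw [hDσ]
    have h1 := hPs.iterate (by positivity) _ (hek i)
    have h2 : HasSize (4 * l) N ((2 * l)! * C ^ l * (2 * (2 * l : ℕ) + 99 * N) ^ (2 * l))
        ((sysDer ℤ Unit)^[e i] P) :=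
      h1.mono (by have := hek i; omega) le_rfl
        (mul_le_mul_of_nonneg_left (pow_le_pow_right₀ hbase (hek i)) (by positivity))
    exact h2.norm_coeff_spec_le _ _ A hA (haA σ) (hbA σ) _
  · have h1 := evalAt_iterate_euler α P (e i)
    rw [eval_spec _ _ _ _ N ((totalDegree_iterate_sysDer_le _ _).trans hPN)] at h1
    have h2 : ∑ m, σ₀ (D i m) *
        (evalAt α (aperySeries 1) ^ m.1 0 * evalAt α (aperySeries 2) ^ m.1 1) =
        evalAt α (euler^[e i] (subst aperySeries Q)) := by
      rw [h1]
      refine Finset.sum_congr rfl fun m _ => ?_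
      rw [hDσ, ha, hb]
      simp
    rw [h2]
    refine norm_evalAt_iterate_euler_le (fun k => ?_) (2 * l) T (C ^ l) C (by positivity)
      (by positivity) hPv hPc _ (hek i)
    rw [iterate_euler_subst]
    exact (conv_subst_and_evalAt_subst _).1

end MainInequality

/-! ### Asymptotics of the main inequality -/

section Asymptotics

/-- The growth of the right hand side is incompatible with the lower bound `1`, because
`((2 * M - 1) * l)!` eventually dominates. -/
theorem main_inequality_asymptotics {C c S A : ℝ} (hC : 1 ≤ C) (hc : 0 ≤ c) (hS : 0 ≤ S)
    (hA : 1 ≤ A) {d N M ρ h l₀ : ℕ} (hd : d ≠ 0) (hM : 4 * ρ * h + 5 ≤ 2 * M - 1)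
    (H : ∀ l : ℕ, l₀ < l →
      1 ≤ (ρ ! * ((d ^ (4 * l + N) : ℕ) * ((2 * l)! * C ^ l *
        (2 * (2 * l : ℕ) + 99 * N) ^ (2 * l) * A ^ (4 * l + N))) ^ ρ) ^ h *
        ((2 * l)! * (2 * l)! * C ^ l * (c ^ ((2 * M - 1) * l) / ((2 * M - 1) * l)!) * S)) :
    False := by
  generalize 2 * M - 1 = T at hM H
  have hd1 : (1 : ℝ) ≤ d := by exact_mod_cast Nat.one_le_iff_ne_zero.mpr hd
  set G₁ : ℝ := (d : ℝ) ^ (4 + N) * C * 9 * A ^ (4 + N) with hG₁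
  set G : ℝ := ((ρ ! : ℝ) * G₁ ^ ρ) ^ h * (C * c ^ T * Real.exp 2 * max 1 S) with hG
  have hG₁0 : 0 ≤ G₁ := by positivity
  have hG0 : 0 ≤ G := by positivity
  obtain ⟨g, hg⟩ := exists_nat_gt G
  set l := l₀ + 99 * N + g + 1 with hl
  have hl0 : l ≠ 0 := by omega
  have hNl : 99 * N ≤ l := by omega
  set n : ℝ := 2 * (l : ℝ) with hn
  have hlR : (1 : ℝ) ≤ l := by exact_mod_cast Nat.one_le_iff_ne_zero.mpr hl0
  have hn0 : 0 < n := by positivity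
  have hn1 : 1 ≤ n := by linarith
  have hgl : (g : ℝ) ≤ l := by exact_mod_cast (show g ≤ l by omega)
  have hfact : ((2 * l)! : ℝ) ≤ (n ^ 2) ^ l := by
    rw [← pow_mul, hn]
    exact_mod_cast Nat.factorial_le_pow (2 * l)
  have hpow {x : ℝ} (hx : 1 ≤ x) : x ^ (4 * l + N) ≤ (x ^ (4 + N)) ^ l := by
    rw [← pow_mul]
    refine pow_le_pow_right₀ hx ?_
    rw [add_mul]
    exact Nat.add_le_add_left (Nat.le_mul_of_pos_right _ (Nat.pos_of_ne_zero hl0)) _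
  have hlin : (2 * (2 * l : ℕ) + 99 * N : ℝ) ^ (2 * l) ≤ (9 * n ^ 2) ^ l := by
    rw [show (9 * n ^ 2 : ℝ) = (3 * n) ^ 2 by ring, ← pow_mul]
    refine pow_le_pow_left₀ (by positivity) ?_ _
    have : (99 * N : ℝ) ≤ l := by exact_mod_cast hNl
    push_cast
    linarith
  have hB : ((d ^ (4 * l + N) : ℕ) : ℝ) * ((2 * l)! * C ^ l *
      (2 * (2 * l : ℕ) + 99 * N) ^ (2 * l) * A ^ (4 * l + N)) ≤ (G₁ * n ^ 4) ^ l := by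
    calc _ ≤ ((d : ℝ) ^ (4 + N)) ^ l * ((n ^ 2) ^ l * C ^ l * (9 * n ^ 2) ^ l *
          (A ^ (4 + N)) ^ l) := by
          push_cast at hlin ⊢
          gcongr
          · exact hpow hd1
          · exact hpow hA
      _ = _ := by
          simp only [← mul_pow]
          congr 1
          rw [hG₁]
          ring
  have hle {x : ℝ} (hx : 1 ≤ x) : x ≤ x ^ l := le_self_pow₀ hx hl0
  have hX : ((ρ ! : ℝ) * ((d ^ (4 * l + N) : ℕ) * ((2 * l)! * C ^ l *
      (2 * (2 * l : ℕ) + 99 * N) ^ (2 * l) * A ^ (4 * l + N))) ^ ρ) ^ h ≤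
      (((ρ ! : ℝ) * G₁ ^ ρ) ^ h * n ^ (4 * ρ * h)) ^ l := by
    calc _ ≤ ((ρ ! : ℝ) ^ l * ((G₁ * n ^ 4) ^ l) ^ ρ) ^ h := by
          gcongr
          exact hle (by exact_mod_cast Nat.one_le_iff_ne_zero.mpr ρ.factorial_ne_zero)
      _ = _ := by
          rw [pow_right_comm _ l ρ, ← mul_pow, pow_right_comm _ l h]
          congr 1
          rw [mul_pow G₁, ← mul_assoc, mul_pow _ _ h, ← pow_mul n, ← pow_mul n]
  have hT : (1 : ℝ) / (T * l)! ≤ (Real.exp 2 / n ^ T) ^ l := by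
    have h1 := Real.pow_div_factorial_le_exp n hn0.le (T * l)
    rw [div_pow, ← pow_mul, ← Real.exp_nat_mul, mul_comm (l : ℝ), ← hn,
      div_le_div_iff₀ (by positivity) (by positivity)]
    rw [div_le_iff₀ (by positivity)] at h1
    linarith
  have hY : ((2 * l)! * (2 * l)! * C ^ l * (c ^ (T * l) / (T * l)!) * S : ℝ) ≤
      (n ^ 4 * (C * c ^ T * Real.exp 2 * max 1 S) / n ^ T) ^ l := by
    calc ((2 * l)! * (2 * l)! * C ^ l * (c ^ (T * l) / (T * l)!) * S : ℝ)
        = (2 * l)! * (2 * l)! * C ^ l * ((c ^ T) ^ l * (1 / (T * l)!)) * S := by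
          rw [← pow_mul, mul_one_div]
      _ ≤ (n ^ 2) ^ l * (n ^ 2) ^ l * C ^ l * ((c ^ T) ^ l * (Real.exp 2 / n ^ T) ^ l) *
          (max 1 S) ^ l := by
          gcongr
          exact (le_max_right 1 S).trans (hle (le_max_left 1 S))
      _ = _ := by
          simp only [← mul_pow]
          congr 1
          ring
  have hfin : 1 ≤ (G * n ^ (4 * ρ * h + 4) / n ^ T) ^ l := by
    refine (H l (by omega)).trans ((mul_le_mul hX hY (by positivity) (by positivity)).trans_eq ?_)
    rw [← mul_pow]
    congr 1
    rw [hG, pow_add]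
    ring
  have h1 : 1 ≤ G * n ^ (4 * ρ * h + 4) / n ^ T := by
    by_contra! hlt
    exact absurd hfin (not_le.mpr (pow_lt_one₀ (by positivity) hlt hl0))
  rw [le_div_iff₀ (by positivity), one_mul] at h1
  have h2 := (pow_le_pow_right₀ hn1 hM).trans h1
  rw [pow_succ' _ (4 * ρ * h + 4)] at h2
  have h3 := le_of_mul_le_mul_right h2 (by positivity)
  linarith

end Asymptotics

/-! ### Counting monomials -/

section Counting

lemma card_mon_fin_two_le (N : ℕ) : Fintype.card (Mon (Fin 2) N) ≤ (N + 1) ^ 2 := by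
  have hle (m : Mon (Fin 2) N) (i : Fin 2) : m.1 i < N + 1 :=
    Nat.lt_succ_of_le ((Finsupp.le_degree i m.1).trans m.2)
  let g (m : Mon (Fin 2) N) : Fin 2 → Fin (N + 1) := fun i => ⟨m.1 i, hle m i⟩
  have hg : Function.Injective g := fun m m' h => Subtype.ext <| Finsupp.ext fun i => by
    simpa [g] using congr_fun h i
  simpa using Fintype.card_le_of_injective g hg

lemma le_card_mon_unit_prod (q : ℕ) :
    (q + 1) ^ 3 ≤ Fintype.card (Mon (Unit × Fin 3) (3 * q)) := by
  let e (v : Fin 3 → Fin (q + 1)) : Unit × Fin 3 →₀ ℕ :=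
    Finsupp.equivFunOnFinite.symm fun p => (v p.2 : ℕ)
  have he (v : Fin 3 → Fin (q + 1)) : (e v).degree ≤ 3 * q := by
    rw [degree_unit_prod]
    simp only [e, Finsupp.equivFunOnFinite_symm_apply_apply]
    omega
  let g (v : Fin 3 → Fin (q + 1)) : Mon (Unit × Fin 3) (3 * q) := ⟨e v, he v⟩
  have hg : Function.Injective g := fun v w h => funext fun i => Fin.ext <| by
    simpa [g, e] using DFunLike.congr_fun (congr_arg Subtype.val h) ((), i)
  simpa using Fintype.card_le_of_injective g hg

lemma exists_card_mon_lt (h : ℕ) (hh : h ≠ 0) :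
    ∃ N, 4 * Fintype.card (Mon (Fin 2) N) * h + 5 ≤
      2 * Fintype.card (Mon (Unit × Fin 3) N) - 1 := by
  refine ⟨3 * (18 * h), ?_⟩
  have h1 := card_mon_fin_two_le (3 * (18 * h))
  have h2 := le_card_mon_unit_prod (18 * h)
  have h3 : 4 * (3 * (18 * h) + 1) ^ 2 * h + 6 ≤ 2 * (18 * h + 1) ^ 3 := by
    have : 1 ≤ h := Nat.one_le_iff_ne_zero.mpr hh
    nlinarith [sq_nonneg h]
  have h4 := Nat.mul_le_mul_right h (Nat.mul_le_mul_left 4 h1)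
  omega

end Counting

/-! ### Transcendence of the values -/

section Transcendence

lemma exists_nat_mul_isIntegral {K : Type*} [Field K] [NumberField K] (a b : K) :
    ∃ d : ℕ, d ≠ 0 ∧ IsIntegral ℤ ((d : K) * a) ∧ IsIntegral ℤ ((d : K) * b) := by
  classical
  obtain ⟨y, hy, h⟩ := exists_integral_multiples ℤ ℚ ({a, b} : Finset K)
  have key (x : K) (hx : IsIntegral ℤ (y • x)) : IsIntegral ℤ ((y.natAbs : K) * x) := by
    rcases Int.natAbs_eq y with hy' | hy'
    · rw [hy', zsmul_eq_mul] at hx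
      simpa using hx
    · rw [hy', zsmul_eq_mul] at hx
      simpa using hx.neg
  exact ⟨y.natAbs, Int.natAbs_ne_zero.mpr hy, key a (h a (by simp)), key b (h b (by simp))⟩

lemma exists_conjugates_norm_le {K : Type*} [Field K] [NumberField K] (a b : K) :
    ∃ A : ℝ, 1 ≤ A ∧ (∀ σ : K →ₐ[ℚ] ℂ, ‖σ a‖ ≤ A) ∧ ∀ σ : K →ₐ[ℚ] ℂ, ‖σ b‖ ≤ A := by
  have hle (x : K) (σ : K →ₐ[ℚ] ℂ) : ‖σ x‖ ≤ ∑ τ : K →ₐ[ℚ] ℂ, ‖τ x‖ :=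
    Finset.single_le_sum (f := fun τ : K →ₐ[ℚ] ℂ => ‖τ x‖) (fun _ _ => norm_nonneg _)
      (Finset.mem_univ σ)
  have h0 (x : K) : 0 ≤ ∑ τ : K →ₐ[ℚ] ℂ, ‖τ x‖ := Finset.sum_nonneg fun _ _ => norm_nonneg _
  refine ⟨1 + ∑ τ : K →ₐ[ℚ] ℂ, ‖τ a‖ + ∑ τ : K →ₐ[ℚ] ℂ, ‖τ b‖, ?_, fun σ => ?_, fun σ => ?_⟩
  · linarith [h0 a, h0 b]
  · linarith [h0 b, hle a σ]
  · linarith [h0 a, hle b σ]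

theorem transcendental_evalAt_aperyUnit {α : ℂ} (hα : IsAlgebraic ℚ α) (hα0 : α ≠ 0) :
    Transcendental ℚ (evalAt α aperyUnit) := by
  intro hβ
  set β := evalAt α aperyUnit with hβdef
  let K := IntermediateField.adjoin ℚ {α, β}
  have : FiniteDimensional ℚ K :=
    IntermediateField.finiteDimensional_adjoin_pair hα.isIntegral hβ.isIntegral
  have : NumberField K := ⟨⟩
  have hαK : α ∈ K := IntermediateField.subset_adjoin _ _ (by simp)
  have hβK : β ∈ K := IntermediateField.subset_adjoin _ _ (by simp)
  let a : K := ⟨α, hαK⟩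
  let b : K := ⟨α * β, mul_mem hαK hβK⟩
  obtain ⟨d, hd, hda, hdb⟩ := exists_nat_mul_isIntegral a b
  obtain ⟨A, hA, haA, hbA⟩ := exists_conjugates_norm_le a b
  obtain ⟨N, hN⟩ := exists_card_mon_lt (Module.finrank ℚ K) Module.finrank_pos.ne'
  obtain ⟨C, c, S, hC, hc, hS, H⟩ := main_inequality K.val a b α hα0 rfl
    evalAt_aperySeries_zero.symm d hd hda hdb A hA haA hbA N _ _ rfl rfl
  exact main_inequality_asymptotics hC hc hS hA hd hN H

end Transcendence

end AperyE

/-- The E-function `f(z) = ∑ₙ aₙ/n! zⁿ`, where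
`aₙ = ∑ₖ (n choose k)² ((n+k) choose n)`, takes transcendental values at all nonzero
algebraic points. -/
theorem example_one_values_transcendental
    (a : ℕ → ℕ)
    (ha : ∀ n, a n = ∑ k ∈ Finset.range (n + 1), (n.choose k) ^ 2 * ((n + k).choose n))
    (f : ℂ → ℂ)
    (hf : ∀ z : ℂ, f z = ∑' n : ℕ, (a n : ℂ) / (n ! : ℂ) * z ^ n) :
    ∀ α : ℂ, IsAlgebraic ℚ α → α ≠ 0 → Transcendental ℚ (f α) := by
  intro α hα hα0
  have hfα : f α = AperyE.evalAt α AperyE.aperyUnit := by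
    simp only [hf, AperyE.evalAt, AperyE.aperyUnit, PowerSeries.coeff_mk, AperyE.apery, ha]
  rw [hfα]
  exact AperyE.transcendental_evalAt_aperyUnit hα hα0
end
end

section
/- Let f : ℂ → ℂ be the entire function f(z) = Σ_{n≥0} (n² · binom(2n,n) / (n+1)²) · (z/2)^{n+1} / n!. Then for all z ∈ ℂ, z(1 − z)² f''(z) = (z − 1)(1 − z + 2z²) f'(z) − z(1 + z) f(z) + (1/2) z(1 + z). -/
noncomputable section

open scoped Nat

/-- Termwise differentiation of an everywhere convergent power series. -/
theorem hasDerivAt_tsum_pow {a : ℕ → ℂ} (ha : ∀ r : ℝ, 0 ≤ r → Summable fun n ↦ ‖a n‖ * r ^ n)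
    (z : ℂ) :
    HasDerivAt (fun w ↦ ∑' n, a n * w ^ n) (∑' n : ℕ, ((n : ℂ) + 1) * a (n + 1) * z ^ n) z := by
  have hz : z ∈ Metric.ball (0 : ℂ) (‖z‖ + 1) := by simp
  have hu : Summable fun n ↦ ‖a n‖ * (2 * (‖z‖ + 1)) ^ n := ha _ (by positivity)
  have hbound : ∀ (n : ℕ) (y : ℂ), y ∈ Metric.ball (0 : ℂ) (‖z‖ + 1) →
      ‖a n * (n * y ^ (n - 1))‖ ≤ ‖a n‖ * (2 * (‖z‖ + 1)) ^ n := by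
    intro n y hy
    have hy' : ‖y‖ ≤ ‖z‖ + 1 := (mem_ball_zero_iff.mp hy).le
    have hn : (n : ℝ) ≤ 2 ^ n := by exact_mod_cast Nat.lt_two_pow_self.le
    rw [norm_mul, norm_mul, norm_pow, Complex.norm_natCast, mul_pow]
    gcongr
    calc ‖y‖ ^ (n - 1) ≤ (‖z‖ + 1) ^ (n - 1) := by gcongr
      _ ≤ (‖z‖ + 1) ^ n := pow_le_pow_right₀ (by linarith [norm_nonneg z]) (Nat.sub_le _ _)
  have h := hasDerivAt_tsum_of_isPreconnected hu Metric.isOpen_ball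
    (convex_ball (0 : ℂ) (‖z‖ + 1)).isPreconnected
    (fun n y _ ↦ (hasDerivAt_pow n y).const_mul (a n)) hbound
    (Metric.mem_ball_self (by positivity)) (summable_of_ne_finset_zero (s := {0}) (by simp +contextual)) hz
  refine h.congr_deriv ?_
  rw [(Summable.of_norm_bounded hu fun n ↦ hbound n z hz).tsum_eq_zero_add]
  simp only [Nat.cast_zero, zero_mul, mul_zero, zero_add, Nat.cast_add, Nat.cast_one,
    Nat.add_sub_cancel]
  exact tsum_congr fun n ↦ by ring

theorem summable_norm_deriv_coeff {a : ℕ → ℂ}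
    (ha : ∀ r : ℝ, 0 ≤ r → Summable fun n ↦ ‖a n‖ * r ^ n) (r : ℝ) (hr : 0 ≤ r) :
    Summable fun n : ℕ ↦ ‖((n : ℂ) + 1) * a (n + 1)‖ * r ^ n := by
  refine Summable.of_nonneg_of_le (fun n ↦ by positivity) (fun n ↦ ?_)
    ((summable_nat_add_iff 1).mpr (ha (2 * (r + 1)) (by positivity)))
  have hn : ‖(n : ℂ) + 1‖ ≤ 2 ^ (n + 1) := by
    have : ((n + 1 : ℕ) : ℝ) ≤ 2 ^ (n + 1) := by exact_mod_cast Nat.lt_two_pow_self.le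
    rw [← Complex.norm_natCast] at this
    exact_mod_cast this
  have hrn : r ^ n ≤ (r + 1) ^ (n + 1) :=
    calc r ^ n ≤ (r + 1) ^ n := by gcongr; linarith
      _ ≤ (r + 1) ^ (n + 1) := pow_le_pow_right₀ (by linarith) (Nat.le_succ n)
  calc ‖((n : ℂ) + 1) * a (n + 1)‖ * r ^ n
      = ‖a (n + 1)‖ * (‖(n : ℂ) + 1‖ * r ^ n) := by rw [norm_mul]; ring
    _ ≤ ‖a (n + 1)‖ * (2 ^ (n + 1) * (r + 1) ^ (n + 1)) := by gcongr
    _ = ‖a (n + 1)‖ * (2 * (r + 1)) ^ (n + 1) := by rw [mul_pow]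

theorem summable_mul_pow_of_summable_norm {a : ℕ → ℂ}
    (ha : ∀ r : ℝ, 0 ≤ r → Summable fun n ↦ ‖a n‖ * r ^ n) (z : ℂ) :
    Summable fun n ↦ a n * z ^ n :=
  Summable.of_norm (by simpa using ha ‖z‖ (norm_nonneg z))

/-- The number `C(2n,n) / (2^{n+1} n!)`. -/
def scaledCentralBinom (n : ℕ) : ℂ := (2 * n).choose n / (2 ^ (n + 1) * n !)

theorem scaledCentralBinom_succ (n : ℕ) :
    scaledCentralBinom (n + 1) = (2 * n + 1) / ((n : ℂ) + 1) ^ 2 * scaledCentralBinom n := by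
  have h : ((n : ℂ) + 1) * ((2 * (n + 1)).choose (n + 1) : ℕ)
      = 2 * (2 * n + 1) * ((2 * n).choose n : ℕ) := by
    exact_mod_cast Nat.succ_mul_centralBinom_succ n
  have h1 : (n : ℂ) + 1 ≠ 0 := by exact_mod_cast n.succ_ne_zero
  have h2 : (n ! : ℂ) ≠ 0 := by exact_mod_cast n.factorial_ne_zero
  unfold scaledCentralBinom
  rw [Nat.factorial_succ, eq_div_of_mul_eq h1 ((mul_comm _ _).trans h)]
  push_cast
  field_simp
  ring

theorem norm_scaledCentralBinom_le (n : ℕ) : ‖scaledCentralBinom n‖ ≤ 2 ^ n / n ! := by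
  have h : ((2 * n).choose n : ℝ) ≤ 2 ^ n * 2 ^ n := by
    rw [← pow_add, ← two_mul]
    exact_mod_cast Nat.choose_le_two_pow _ _
  have h2 : (0 : ℝ) < n ! := by exact_mod_cast n.factorial_pos
  have h3 : (0 : ℝ) < 2 ^ n := by positivity
  simp only [scaledCentralBinom, norm_div, norm_mul, norm_pow, Complex.norm_natCast,
    Complex.norm_ofNat]
  rw [div_le_div_iff₀ (by positivity) h2, pow_succ]
  nlinarith [mul_le_mul_of_nonneg_right h h2.le, mul_pos (mul_pos h3 h3) h2]

/-- The Taylor coefficients at `0` of `∑ₙ (n² C(2n,n)/(n+1)²) (z/2)^{n+1}/n!`. -/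
def taylorCoeff : ℕ → ℂ
  | 0 => 0
  | n + 1 => (n : ℂ) ^ 2 / ((n : ℂ) + 1) ^ 2 * scaledCentralBinom n

theorem summable_norm_taylorCoeff (r : ℝ) (hr : 0 ≤ r) :
    Summable fun n ↦ ‖taylorCoeff n‖ * r ^ n := by
  rw [← summable_nat_add_iff 1]
  refine Summable.of_nonneg_of_le (fun n ↦ by positivity) (fun n ↦ ?_)
    ((Real.summable_pow_div_factorial (2 * r)).mul_right r)
  have h : ‖(n : ℂ) ^ 2 / ((n : ℂ) + 1) ^ 2‖ ≤ 1 := by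
    have hn : ‖(n : ℂ) + 1‖ = n + 1 := by exact_mod_cast Complex.norm_natCast (n + 1)
    rw [norm_div, norm_pow, norm_pow, Complex.norm_natCast, hn]
    exact div_le_one_of_le₀ (by gcongr; linarith) (by positivity)
  calc ‖taylorCoeff (n + 1)‖ * r ^ (n + 1)
      = ‖(n : ℂ) ^ 2 / ((n : ℂ) + 1) ^ 2‖ * ‖scaledCentralBinom n‖ * r ^ (n + 1) := by
        rw [taylorCoeff, norm_mul]
    _ ≤ 1 * (2 ^ n / n !) * r ^ (n + 1) := by
        gcongr
        exact norm_scaledCentralBinom_le n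
    _ = (2 * r) ^ n / n ! * r := by ring

theorem taylorCoeff_recurrence (n : ℕ) :
    ((n : ℂ) + 4) ^ 2 * taylorCoeff (n + 4) - 2 * ((n : ℂ) + 3) ^ 2 * taylorCoeff (n + 3)
      + ((n : ℂ) + 3) ^ 2 * taylorCoeff (n + 2) - (2 * n + 1) * taylorCoeff (n + 1) = 0 := by
  have h1 : (n : ℂ) + 1 ≠ 0 := by exact_mod_cast (n + 0).succ_ne_zero
  have h2 : (n : ℂ) + 2 ≠ 0 := by exact_mod_cast (n + 1).succ_ne_zero
  have h3 : (n : ℂ) + 3 ≠ 0 := by exact_mod_cast (n + 2).succ_ne_zero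
  have h4 : (n : ℂ) + 4 ≠ 0 := by exact_mod_cast (n + 3).succ_ne_zero
  simp only [taylorCoeff, scaledCentralBinom_succ]
  push_cast
  rw [show (n : ℂ) + 3 + 1 = n + 4 by ring, show (n : ℂ) + 2 + 1 = n + 3 by ring,
    show (n : ℂ) + 1 + 1 = n + 2 by ring]
  field_simp
  ring

/-- The entire function `f(z) = ∑ₙ (n² C(2n,n)/(n+1)²) (z/2)^{n+1}/n!` satisfies the
inhomogeneous differential equation
`z(1-z)² f'' = (z-1)(1 - z + 2z²) f' - z(1+z) f + z(1+z)/2`. -/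
theorem example_two_differential_equation
    (f : ℂ → ℂ)
    (hf : ∀ z : ℂ, f z = ∑' n : ℕ,
      ((n : ℂ) ^ 2 * ((2 * n).choose n : ℂ) / ((n : ℂ) + 1) ^ 2)
        * (z / 2) ^ (n + 1) / (n ! : ℂ)) :
    ∀ z : ℂ, z * (1 - z) ^ 2 * iteratedDeriv 2 f z
      = (z - 1) * (1 - z + 2 * z ^ 2) * deriv f z - z * (1 + z) * f z
        + (1 / 2) * z * (1 + z) := by
  intro z
  have ha := summable_norm_taylorCoeff
  have hb := summable_norm_deriv_coeff ha
  have hc := summable_norm_deriv_coeff hb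
  have hf' : f = fun w ↦ ∑' n, taylorCoeff n * w ^ n := by
    funext w
    rw [hf w, (summable_mul_pow_of_summable_norm ha w).tsum_eq_zero_add]
    simp only [taylorCoeff, zero_mul, zero_add]
    refine tsum_congr fun n ↦ ?_
    rw [scaledCentralBinom, div_pow]
    ring
  have hd : deriv f = fun w ↦ ∑' n : ℕ, ((n : ℂ) + 1) * taylorCoeff (n + 1) * w ^ n := by
    funext w
    rw [hf', (hasDerivAt_tsum_pow ha w).deriv]
  have hd2 : iteratedDeriv 2 f z = ∑' n : ℕ,
      ((n : ℂ) + 1) * (((n + 1 : ℕ) + 1) * taylorCoeff (n + 1 + 1)) * z ^ n := by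
    rw [iteratedDeriv_succ, iteratedDeriv_one, hd, (hasDerivAt_tsum_pow hb z).deriv]
  have s0 := (summable_mul_pow_of_summable_norm ha z).hasSum
  have s1 := (summable_mul_pow_of_summable_norm hb z).hasSum
  have s2 := (summable_mul_pow_of_summable_norm hc z).hasSum
  rw [← congrFun hf' z] at s0
  rw [← congrFun hd z] at s1
  rw [← hd2] at s2
  have t1 := (((hasSum_nat_add_iff' 2).mpr s2).mul_left z).sub
    (((hasSum_nat_add_iff' 1).mpr s2).mul_left (2 * z ^ 2)) |>.add (s2.mul_left (z ^ 3))
  have t2 := ((((hasSum_nat_add_iff' 3).mpr s1).sub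
    (((hasSum_nat_add_iff' 2).mpr s1).mul_left (2 * z))).add
    (((hasSum_nat_add_iff' 1).mpr s1).mul_left (3 * z ^ 2))).sub (s1.mul_left (2 * z ^ 3))
  have t3 := (((hasSum_nat_add_iff' 2).mpr s0).mul_left z).add
    (((hasSum_nat_add_iff' 1).mpr s0).mul_left (z ^ 2))
  have t := ((t1.add t2).add t3).tsum_eq.symm.trans ((tsum_congr (g := fun _ ↦ 0) fun n ↦ by
    have h := taylorCoeff_recurrence n
    simp only [add_assoc, Nat.reduceAdd]
    push_cast
    linear_combination z ^ (n + 3) * h).trans tsum_zero)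
  have h1 : taylorCoeff 1 = 0 := by simp [taylorCoeff]
  have h2 : taylorCoeff 2 = 1 / 8 := by
    norm_num [taylorCoeff, scaledCentralBinom]
  have h3 : taylorCoeff 3 = 1 / 6 := by
    norm_num [taylorCoeff, scaledCentralBinom, Nat.choose, Nat.factorial]
  have h0 : taylorCoeff 0 = 0 := rfl
  simp only [Finset.sum_range_succ, Finset.sum_range_zero, zero_add, Nat.reduceAdd, h0, h1, h2,
    h3] at t
  push_cast at t
  linear_combination t
end
end
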